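/- Assume additionally m ≥ 2, and let s, s′ be distinct rational numbers in I_1(r;n) ∪ I_2(r;n) such that u_s is conjugate in Heck(r;n) to u_{s′} or to u_{s′}^{−1}. Then every term of CS(s) and every term of CS(s′) is equal to m or to m+1. -/

import Mathlib

/- Formalization of statements from "Homotopically equivalent simple loops on
2-bridge spheres in Heckoid orbifolds for 2-bridge links (II)" by Lee-Sakuma.

We work in the free group `F` on two generators `a = gen 0`, `b = gen 1`.
For a rational `s` (in lowest terms `q/p`, with `0 ≤ s ≤ 1`), `uWord s` is the
word `u_s = a b^{ε₁} a^{ε₂} ⋯ b^{ε_{2p-1}}` with `ε_i = (-1)^⌊i·s⌋`.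
`CS s` is (a linear representative of) the cyclic sequence of lengths of
maximal constant-sign runs of exponents of `u_s`; since `u_s` begins with a
positive letter and (for `0 < s ≤ 1`) ends with a negative letter, the linear
run-length sequence represents the cyclic one.  `CyclicContains L T` says the
cyclic sequence represented by `L` contains `T` as a block of consecutive
terms.  `cfQ [m₁,…,m_k]` is the continued fraction `1/(m₁+1/(m₂+⋯+1/m_k))`.
`memI1 M n s` / `memI2 M n s` express `s ∈ I₁(r;n)` / `s ∈ I₂(r;n)` where
`r = cfQ M`, and `memI1hat` / `memI2hat` express `s ∈ I₁(r)` / `s ∈ I₂(r)`.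
The Heckoid group `Heck(r;n) = ⟨a,b | u_r^n⟩` is the quotient of `F` by the
normal closure `heckN r n` of `u_r^n`, with quotient map `heckQ r n`. -/

namespace Heckoid

abbrev F : Type := FreeGroup (Fin 2)

/-- The generators: `gen 0 = a`, `gen 1 = b` (and `gen i` depends on parity). -/
def gen (i : ℕ) : F := FreeGroup.of ⟨i % 2, Nat.mod_lt _ (by norm_num)⟩

/-- The word `u_s = a b^{ε₁} a^{ε₂} b^{ε₃} ⋯ a^{ε_{2p-2}} b^{ε_{2p-1}}`,
where `s = q/p` in lowest terms and `ε_i = (-1)^⌊iq/p⌋`. -/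
def uWord (s : ℚ) : F :=
  ((List.range (2 * s.den)).map
    (fun i => gen i ^ ((-1 : ℤ) ^ (⌊(i : ℚ) * s⌋.toNat)))).prod

/-- The sequence of exponent signs `ε₀, ε₁, …, ε_{2p-1}` of `u_s`. -/
def signList (s : ℚ) : List ℤ :=
  (List.range (2 * s.den)).map (fun i => (-1 : ℤ) ^ (⌊(i : ℚ) * s⌋.toNat))

/-- Lengths of the maximal runs of equal consecutive entries. -/
def runLengths {α : Type} [BEq α] (l : List α) : List ℕ :=
  (l.splitBy (· == ·)).map List.length

/-- `CS s = CS(u_s)`: the cyclic sequence of lengths of maximal constant-sign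
runs of `u_s`, represented by a list. -/
def CS (s : ℚ) : List ℕ := runLengths (signList s)

/-- The cyclic sequence represented by `L` contains `T` as a block of
consecutive terms. -/
def CyclicContains (L T : List ℕ) : Prop := ∃ k, T <+: L.rotate k

/-- The continued fraction `[m₁, m₂, …, m_k] = 1/(m₁+1/(m₂+⋯+1/m_k))`. -/
def cfQ : List ℕ → ℚ
  | [] => 0
  | a :: l => 1 / ((a : ℚ) + cfQ l)

/-- `d⟨T, T'⟩`: `d` consecutive repetitions of the concatenation of `T` and `T'`. -/
def rep2 (d : ℕ) (T T' : List ℕ) : List ℕ := (List.replicate d (T ++ T')).flatten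

/-- `s ∈ I₁(r;n)` where `r = cfQ M`:  `[0, [m₁,…,m_{k-1},m_k-1,2]]` for `k` even,
`[0, [m₁,…,m_k,2n-2])` for `k` odd. -/
def memI1 (M : List ℕ) (n : ℕ) (s : ℚ) : Prop :=
  if Even M.length then 0 ≤ s ∧ s ≤ cfQ (M.dropLast ++ [M.getLast! - 1, 2])
  else 0 ≤ s ∧ s < cfQ (M ++ [2 * n - 2])

/-- `s ∈ I₂(r;n)` where `r = cfQ M`: `([m₁,…,m_k,2n-2], 1]` for `k` even,
`[[m₁,…,m_{k-1},m_k-1,2], 1]` for `k` odd. -/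
def memI2 (M : List ℕ) (n : ℕ) (s : ℚ) : Prop :=
  if Even M.length then cfQ (M ++ [2 * n - 2]) < s ∧ s ≤ 1
  else cfQ (M.dropLast ++ [M.getLast! - 1, 2]) ≤ s ∧ s ≤ 1

/-- `s ∈ I₁(r)` where `r = cfQ M`. -/
def memI1hat (M : List ℕ) (s : ℚ) : Prop :=
  if Even M.length then 0 ≤ s ∧ s ≤ cfQ (M.dropLast ++ [M.getLast! - 1])
  else 0 ≤ s ∧ s ≤ cfQ M.dropLast

/-- `s ∈ I₂(r)` where `r = cfQ M`. -/
def memI2hat (M : List ℕ) (s : ℚ) : Prop :=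
  if Even M.length then cfQ M.dropLast ≤ s ∧ s ≤ 1
  else cfQ (M.dropLast ++ [M.getLast! - 1]) ≤ s ∧ s ≤ 1

/-- The normal closure of `u_r^n`, so that `Heck(r;n) = F ⧸ heckN r n`. -/
abbrev heckN (r : ℚ) (n : ℕ) : Subgroup F := Subgroup.normalClosure {uWord r ^ n}

/-- The quotient map `F → Heck(r;n) = ⟨a, b | u_r^n⟩`. -/
def heckQ (r : ℚ) (n : ℕ) : F →* F ⧸ heckN r n := QuotientGroup.mk' (heckN r n)

/-- The sign of the letter of phase `c` of a strip word with denominator `p`: positive iff the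
number `⌊c / p⌋` is even. -/
def sgn (p c : ℤ) : Bool := decide (Even (c / p))

/-- The word of length `N` read along a line of slope `q / p`, from phase `c` and from a letter of
type `g` on: the `i`-th letter has type `g + i` and sign `sgn p (c + i * q)`. -/
def strip (p q : ℤ) : ℕ → Fin 2 → ℤ → List (Fin 2 × Bool)
  | 0, _, _ => []
  | N + 1, g, c => (g, sgn p c) :: strip p q N (g + 1) (c + q)

/-- The type of the letter `i` places after a letter of type `g`. -/
def typeAt (g : Fin 2) (i : ℕ) : Fin 2 := g + i • 1

theorem typeAt_succ (g : Fin 2) (i : ℕ) : typeAt g (i + 1) = typeAt g i + 1 := by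
  simp [typeAt, succ_nsmul, add_assoc]

theorem typeAt_zero (g : Fin 2) : typeAt g 0 = g := by simp [typeAt]

theorem typeAt_add_one (g : Fin 2) (i : ℕ) : typeAt (g + 1) i = typeAt g (i + 1) := by
  simp [typeAt, succ_nsmul]; abel

theorem typeAt_mod {L : ℕ} (hL : Even L) (g : Fin 2) (i : ℕ) :
    typeAt g (i % L) = typeAt g i := by
  obtain ⟨l, rfl⟩ := hL
  have h : (2 : ℕ) • (1 : Fin 2) = 0 := rfl
  conv_rhs => rw [← Nat.mod_add_div i (l + l), ← two_mul, mul_assoc]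
  simp [typeAt, add_nsmul, mul_nsmul, h, ← two_mul]

theorem sgn_add (p c : ℤ) (hp : 0 < p) (k : ℤ) : sgn p (c + 2 * p * k) = sgn p c := by
  unfold sgn
  have : (c + 2 * p * k) / p = c / p + 2 * k := by
    rw [show c + 2 * p * k = c + p * (2 * k) by ring, Int.add_mul_ediv_left _ _ hp.ne']
  rw [this]
  simp [Int.even_add]

theorem neg_one_sub_ediv (p c : ℤ) (hp : 0 < p) : (-1 - c) / p = -1 - c / p := by
  rw [Int.ediv_eq_iff_of_pos hp]
  have h1 := Int.mul_ediv_add_emod c p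
  have h2 := Int.emod_nonneg c hp.ne'
  have h3 := Int.emod_lt_of_pos c hp
  constructor <;> nlinarith

theorem sgn_mirror (p c : ℤ) (hp : 0 < p) : sgn p (-1 - c) = !sgn p c := by
  unfold sgn
  rw [neg_one_sub_ediv p c hp]
  by_cases h : Even (c / p)
  · simp [h, Int.even_sub]
  · simp [h, Int.even_sub]

@[simp] theorem strip_length (p q : ℤ) (N : ℕ) (g : Fin 2) (c : ℤ) :
    (strip p q N g c).length = N := by
  induction N generalizing g c with
  | zero => rfl
  | succ N ih => simp [strip, ih]

theorem strip_getElem (p q : ℤ) (N : ℕ) (g : Fin 2) (c : ℤ) (i : ℕ)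
    (hi : i < (strip p q N g c).length) :
    (strip p q N g c)[i] = (typeAt g i, sgn p (c + i * q)) := by
  induction N generalizing g c i with
  | zero => simp [strip] at hi
  | succ N ih =>
    cases i with
    | zero => simp [strip, typeAt]
    | succ i =>
      simp only [strip, List.getElem_cons_succ]
      rw [ih, typeAt_add_one]
      congr 2
      push_cast
      ring

theorem strip_eq_map_range (p q : ℤ) (N : ℕ) (g : Fin 2) (c : ℤ) :
    strip p q N g c = (List.range N).map fun i => (typeAt g i, sgn p (c + i * q)) := by
  apply List.ext_getElem
  · simp
  · intro i h1 h2
    simp [strip_getElem]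

theorem strip_add (p q : ℤ) (N K : ℕ) (g : Fin 2) (c : ℤ) :
    strip p q (N + K) g c = strip p q N g c ++ strip p q K (typeAt g N) (c + N * q) := by
  induction N generalizing g c with
  | zero => simp [strip, typeAt]
  | succ N ih =>
    rw [show N + 1 + K = (N + K) + 1 by ring]
    simp only [strip, List.cons_append, ih, typeAt_add_one]
    congr 3
    push_cast
    ring

theorem strip_congr (p q : ℤ) (hp : 0 < p) (N : ℕ) (g : Fin 2) {c c' : ℤ}
    (h : 2 * p ∣ c' - c) : strip p q N g c' = strip p q N g c := by
  obtain ⟨k, hk⟩ := h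
  obtain rfl : c' = c + 2 * p * k := by linarith
  rw [strip_eq_map_range, strip_eq_map_range]
  refine List.map_congr_left fun i _ => ?_
  rw [show c + 2 * p * k + i * q = c + i * q + 2 * p * k by ring, sgn_add _ _ hp]

/-- The element of the free group represented by a strip word. -/
def stripF (p q : ℤ) (N : ℕ) (g : Fin 2) (c : ℤ) : F := FreeGroup.mk (strip p q N g c)

theorem stripF_add (p q : ℤ) (N K : ℕ) (g : Fin 2) (c : ℤ) :
    stripF p q (N + K) g c = stripF p q N g c * stripF p q K (typeAt g N) (c + N * q) := by
  simp [stripF, strip_add, FreeGroup.mul_mk]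

theorem stripF_inv (p q : ℤ) (hp : 0 < p) (N : ℕ) (g : Fin 2) (c : ℤ) :
    (stripF p q (N + 1) g c)⁻¹ = stripF p q (N + 1) (typeAt g N) (-1 - (c + N * q)) := by
  unfold stripF
  rw [FreeGroup.inv_mk]
  congr 1
  apply List.ext_getElem
  · simp [FreeGroup.invRev]
  · intro i h1 h2
    have hi : i ≤ N := by simpa [Nat.lt_succ_iff] using h2
    simp only [FreeGroup.invRev, List.getElem_reverse, List.getElem_map, strip_getElem,
      List.length_map, strip_length]
    obtain ⟨j, rfl⟩ := Nat.exists_eq_add_of_le hi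
    have e : i + j + 1 - 1 - i = j := by omega
    rw [e]
    refine Prod.ext ?_ ?_
    · have h2 (x : Fin 2) : x + x = 0 := by revert x; decide
      simp only [typeAt, add_nsmul]
      rw [show g + (i • (1 : Fin 2) + j • 1) + i • 1 =
          g + j • 1 + (i • (1 : Fin 2) + i • 1) by abel,
        h2, add_zero]
    · show (!sgn p _) = sgn p _
      rw [← sgn_mirror _ _ hp]
      congr 1
      push_cast
      ring

theorem typeAt_two_mul (g : Fin 2) (N : ℕ) : typeAt g (2 * N) = g := by
  simp [typeAt, mul_nsmul, show 2 • (1 : Fin 2) = 0 from rfl]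

theorem stripF_pow (p q : ℤ) (hp : 0 < p) (P : ℕ) (hP : (P : ℤ) = p) (g : Fin 2) (c : ℤ) (n : ℕ) :
    stripF p q (2 * P * n) g c = stripF p q (2 * P) g c ^ n := by
  induction n with
  | zero => simp [stripF, strip, FreeGroup.one_eq_mk]
  | succ n ih =>
    rw [Nat.mul_succ, stripF_add, ih, pow_succ]
    congr 1
    rw [mul_assoc, typeAt_two_mul]
    unfold stripF
    rw [strip_congr p q hp]
    exact ⟨n * q, by push_cast; rw [hP]; ring⟩

theorem strip_isReduced (p q : ℤ) (N : ℕ) (g : Fin 2) (c : ℤ) :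
    FreeGroup.IsReduced (strip p q N g c) := by
  unfold FreeGroup.IsReduced
  rw [List.isChain_iff_getElem]
  intro i hi h
  exfalso
  simp only [strip_getElem, typeAt_succ] at h
  generalize typeAt g i = x at h
  revert x; decide

theorem gen_zpow (i : ℕ) (e : ℕ) :
    gen i ^ ((-1 : ℤ) ^ e) = FreeGroup.mk [(typeAt 0 i, decide (Even e))] := by
  have ht : (⟨i % 2, Nat.mod_lt _ (by norm_num)⟩ : Fin 2) = typeAt 0 i := by
    induction i with
    | zero => rfl
    | succ i ih =>
      rw [typeAt_succ, ← ih]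
      rcases Nat.mod_two_eq_zero_or_one i with h | h <;> simp [Nat.add_mod, h]
  rcases Nat.even_or_odd e with h | h
  · simp [gen, ht, h, h.neg_one_pow, FreeGroup.of]
  · rw [h.neg_one_pow]
    simp [gen, ht, FreeGroup.of, FreeGroup.invRev, Nat.not_even_iff_odd.mpr h]

theorem floor_toNat_even (s : ℚ) (hs : 0 ≤ s) (i : ℕ) :
    decide (Even ⌊(i : ℚ) * s⌋.toNat) = sgn s.den (i * s.num) := by
  have h : ⌊(i : ℚ) * s⌋ = (i * s.num) / (s.den : ℤ) := by
    have h := Rat.floor_intCast_div_natCast (i * s.num) s.den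
    rw [← h]
    congr 1
    push_cast
    rw [mul_div_assoc, Rat.num_div_den]
  have h0 : 0 ≤ ⌊(i : ℚ) * s⌋ := Int.floor_nonneg.mpr (by positivity)
  unfold sgn
  rw [← h, decide_eq_decide]
  conv_rhs => rw [← Int.toNat_of_nonneg h0, Int.even_coe_nat]

theorem uWord_eq (s : ℚ) (hs : 0 ≤ s) : uWord s = stripF s.den s.num (2 * s.den) 0 0 := by
  unfold uWord stripF
  rw [strip_eq_map_range]
  generalize 2 * s.den = N
  induction N with
  | zero => simp [FreeGroup.one_eq_mk]
  | succ N ih =>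
    rw [List.range_succ, List.map_append, List.prod_append, ih, List.map_append,
      ← FreeGroup.mul_mk]
    simp [gen_zpow, floor_toNat_even s hs]

/-- The lines of slopes `q / p` and `q' / p'` and of phases `c` and `c'` have the same integer parts
between `a` and `b`. -/
def Agree (p q c p' q' c' a b : ℤ) : Prop :=
  ∀ i, a ≤ i → i ≤ b → (c + i * q) / p = (c' + i * q') / p'

/-- The places between `a` and `b` where the line of slope `q / p` and phase `c` is lowest over
its integer part. -/
noncomputable def lows (p q c a b : ℤ) : Finset ℤ := (Finset.Icc a b).filter fun i => p ∣ c + i * q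

/-- The places between `a` and `b` where the line of slope `q / p` and phase `c` is highest over
its integer part. -/
noncomputable def ups (p q c a b : ℤ) : Finset ℤ :=
  (Finset.Icc a b).filter fun i => p ∣ c + i * q + 1

theorem mem_lows {p q c a b i : ℤ} : i ∈ lows p q c a b ↔ (a ≤ i ∧ i ≤ b) ∧ p ∣ c + i * q := by
  simp [lows]

theorem mem_ups {p q c a b i : ℤ} : i ∈ ups p q c a b ↔ (a ≤ i ∧ i ≤ b) ∧ p ∣ c + i * q + 1 := by
  simp [ups]

theorem Agree.flip {p q c p' q' c' a b : ℤ} (hp : 0 < p) (hp' : 0 < p')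
    (h : Agree p q c p' q' c' a b) : Agree p (-q) (-1 - c) p' (-q') (-1 - c') a b := by
  intro i ha hb
  rw [show -1 - c + i * -q = -1 - (c + i * q) by ring,
    show -1 - c' + i * -q' = -1 - (c' + i * q') by ring, neg_one_sub_ediv _ _ hp,
    neg_one_sub_ediv _ _ hp', h i ha hb]

theorem lows_flip (p q c a b : ℤ) : lows p (-q) (-1 - c) a b = ups p q c a b := by
  ext i
  rw [mem_lows, mem_ups, show -1 - c + i * -q = -(c + i * q + 1) by ring, dvd_neg]

theorem ups_flip (p q c a b : ℤ) : ups p (-q) (-1 - c) a b = lows p q c a b := by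
  ext i
  rw [mem_lows, mem_ups, show -1 - c + i * -q + 1 = -(c + i * q) by ring, dvd_neg]

/-- A line cannot climb too fast between a low place and a high place, if its integer parts there
are those of lines of a smaller slope. -/
theorem lows_ups_bound {p q c₁ c₂ p' q' c' x y : ℤ} (hp : 0 < p) (hp' : 0 < p')
    (hx : (c₁ + x * q) / p = (c' + x * q') / p') (hy : (c₂ + y * q) / p = (c' + y * q') / p')
    (hL : p ∣ c₁ + x * q) (hU : p ∣ c₂ + y * q + 1) :
    (q' * p - q * p') * (y - x) < p' * (c₂ - c₁ + 1) := by
  obtain ⟨A, hA⟩ := hL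
  obtain ⟨B, hB⟩ := hU
  have e1 : (c₁ + x * q) / p = A := by rw [hA, Int.mul_ediv_cancel_left _ hp.ne']
  have e2 : (c₂ + y * q) / p = B - 1 := by
    rw [Int.ediv_eq_iff_of_pos hp]
    constructor <;> nlinarith
  rw [e1, eq_comm, Int.ediv_eq_iff_of_pos hp'] at hx
  rw [e2, eq_comm, Int.ediv_eq_iff_of_pos hp'] at hy
  have h1 : q' * (y - x) ≤ p' * B - 1 - p' * A := by nlinarith
  have h2 := mul_le_mul_of_nonneg_left h1 hp.le
  nlinarith

theorem card_le_of_dvd (S : Finset ℤ) (p T : ℤ) (hp : 0 < p) (hT : 0 ≤ T)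
    (h : ∀ x ∈ S, ∀ y ∈ S, p ∣ y - x) (h2 : ∀ x ∈ S, ∀ y ∈ S, y - x < T * p) :
    (S.card : ℤ) ≤ T := by
  rcases S.eq_empty_or_nonempty with rfl | hS
  · simpa
  set a := S.min' hS
  have ha : a ∈ S := S.min'_mem hS
  have hcard : S.card ≤ (Finset.Ico 0 T).card := by
    refine Finset.card_le_card_of_injOn (fun x => (x - a) / p) ?_ ?_
    · intro x hx
      have h3 := S.min'_le x hx
      obtain ⟨k, hk⟩ := h a ha x hx
      have h4 := h2 a ha x hx
      simp only [Finset.coe_Ico, Set.mem_Ico]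
      rw [hk, Int.mul_ediv_cancel_left _ hp.ne']
      constructor
      · have : 0 ≤ p * k := by rw [← hk]; exact sub_nonneg.mpr h3
        exact nonneg_of_mul_nonneg_right this hp
      · rw [hk, mul_comm] at h4
        exact lt_of_mul_lt_mul_right h4 hp.le
    · intro x hx y hy hxy
      obtain ⟨k, hk⟩ := h a ha x hx
      obtain ⟨l, hl⟩ := h a ha y hy
      simp only [hk, hl, Int.mul_ediv_cancel_left _ hp.ne'] at hxy
      rw [hxy, ← hl] at hk
      linarith
  rw [Int.card_Ico] at hcard
  omega

theorem exists_far_of_le_card (S : Finset ℤ) (p T : ℤ) (hp : 0 < p) (hT : 0 < T)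
    (h : ∀ x ∈ S, ∀ y ∈ S, p ∣ y - x) (h2 : T ≤ S.card) :
    ∃ x ∈ S, ∃ y ∈ S, x + (T - 1) * p ≤ y := by
  by_contra! hcon
  have := card_le_of_dvd S p (T - 1) hp (by omega) h fun x hx y hy => by
    linarith [hcon x hx y hy]
  omega

theorem dvd_sub_of_dvd {p q c x y : ℤ} (hpq : IsCoprime p q) (hx : p ∣ c + x * q)
    (hy : p ∣ c + y * q) : p ∣ y - x := by
  have h := dvd_sub hy hx
  rw [show c + y * q - (c + x * q) = (y - x) * q by ring] at h
  exact hpq.dvd_of_dvd_mul_right h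

theorem dvd_sub_sub_of_dvd {p q c x y δ : ℤ} (hpq : IsCoprime p q) (hδ : p ∣ q * δ + 1)
    (hx : p ∣ c + x * q) (hy : p ∣ c + y * q + 1) : p ∣ y - x - δ := by
  have h := dvd_sub (dvd_sub hy hx) hδ
  rw [show c + y * q + 1 - (c + x * q) - (q * δ + 1) = (y - x - δ) * q by ring] at h
  exact hpq.dvd_of_dvd_mul_right h

theorem dvd_up_of_low {p q c x y δ : ℤ} (hδ : p ∣ q * δ + 1) (hx : p ∣ c + x * q)
    (hxy : p ∣ y - x - δ) : p ∣ c + y * q + 1 := by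
  have h := dvd_add (dvd_add hx hδ) (hxy.mul_right q)
  rwa [show c + x * q + (q * δ + 1) + (y - x - δ) * q = c + y * q + 1 by ring] at h

theorem dvd_low_of_up {p q c x y δ : ℤ} (hδ : p ∣ q * δ + 1) (hy : p ∣ c + y * q + 1)
    (hxy : p ∣ y - x - δ) : p ∣ c + x * q := by
  have h := dvd_sub hy (dvd_add hδ (hxy.mul_right q))
  rwa [show c + y * q + 1 - (q * δ + 1 + (y - x - δ) * q) = c + x * q by ring] at h

/-- The slope `q' / p'` is so much bigger than `q / p` that lines of these slopes have different
integer parts within `δ + (T - 1) * p` steps. -/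
structure Steep (p q p' q' δ T : ℤ) : Prop where
  pos : 0 < δ
  lt : δ < p
  dvd : p ∣ q * δ + 1
  le : p' ≤ (q' * p - q * p') * (δ + (T - 1) * p)

theorem Steep.sub_lt {p q c p' q' c' a b δ T : ℤ} (hp : 0 < p) (hp' : 0 < p')
    (hst : Steep p q p' q' δ T) (hT : 0 < T) (hag : Agree p q c p' q' c' a b) {x y : ℤ}
    (hx : x ∈ lows p q c a b) (hy : y ∈ ups p q c a b) : y - x < δ + (T - 1) * p := by
  rw [mem_lows] at hx
  rw [mem_ups] at hy
  have h1 := lows_ups_bound hp hp' (hag x hx.1.1 hx.1.2) (hag y hy.1.1 hy.1.2) hx.2 hy.2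
  have h2 := hst.le
  by_contra! hcon
  have h3 := hst.pos
  have h4 : 0 ≤ (T - 1) * p := mul_nonneg (by omega) hp.le
  have h5 : 0 < q' * p - q * p' := by
    by_contra! h
    nlinarith
  nlinarith

/-- In an interval on which the line has the integer parts of a much steeper line, there are at
most `T` low places and at most `T` high places. -/
theorem Steep.card_le {p q c p' q' c' a b δ T : ℤ} (hp : 0 < p) (hp' : 0 < p')
    (hpq : IsCoprime p q) (hst : Steep p q p' q' δ T) (hT : 0 < T)
    (hag : Agree p q c p' q' c' a b) :
    ((lows p q c a b).card : ℤ) ≤ T ∧ ((ups p q c a b).card : ℤ) ≤ T := by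
  have hlt := hst.lt
  have hpos := hst.pos
  constructor
  · by_contra! hcon
    obtain ⟨x, hx, y, hy, hxy⟩ := exists_far_of_le_card _ p (T + 1) hp (by omega)
      (fun x hx y hy => dvd_sub_of_dvd hpq (mem_lows.mp hx).2 (mem_lows.mp hy).2) hcon
    have hx' := mem_lows.mp hx
    have hy' := mem_lows.mp hy
    have hTp : 0 ≤ (T - 1) * p := mul_nonneg (by omega) hp.le
    have hz : y - p + δ ∈ ups p q c a b := by
      rw [mem_ups]
      refine ⟨⟨by linarith, by linarith⟩, dvd_up_of_low hst.dvd hy'.2 ⟨-1, by ring⟩⟩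
    have := hst.sub_lt hp hp' hT hag hx hz
    linarith
  · by_contra! hcon
    obtain ⟨x, hx, y, hy, hxy⟩ := exists_far_of_le_card _ p (T + 1) hp (by omega)
      (fun x hx y hy => dvd_sub_of_dvd (c := c + 1) hpq
        (by rw [add_right_comm]; exact (mem_ups.mp hx).2)
        (by rw [add_right_comm]; exact (mem_ups.mp hy).2)) hcon
    have hx' := mem_ups.mp hx
    have hy' := mem_ups.mp hy
    have hTp : 0 ≤ (T - 1) * p := mul_nonneg (by omega) hp.le
    have hz : x + p - δ ∈ lows p q c a b := by
      rw [mem_lows]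
      refine ⟨⟨by linarith, by linarith⟩, dvd_low_of_up hst.dvd hx'.2 ⟨-1, by ring⟩⟩
    have := hst.sub_lt hp hp' hT hag hz hy
    linarith

/-- The position of the low and high places in an interval as in `Steep.card_le` that contains
`T` of both kinds. -/
theorem Steep.exists_of_full {p q c p' q' c' a b δ T : ℤ} (hp : 0 < p) (hp' : 0 < p')
    (hpq : IsCoprime p q) (hst : Steep p q p' q' δ T) (hT : 2 ≤ T)
    (hag : Agree p q c p' q' c' a b) (hL : T ≤ (lows p q c a b).card)
    (hU : T ≤ (ups p q c a b).card) :
    ∃ l, l ∈ lows p q c a b ∧ l + δ + (T - 2) * p ∈ ups p q c a b ∧ a ≤ l + δ - p ∧ l < a + p ∧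
      l + (T - 1) * p ≤ b ∧ b < l + δ + (T - 1) * p := by
  have hlt := hst.lt
  have hpos := hst.pos
  have hTp : 0 ≤ (T - 2) * p := mul_nonneg (by omega) hp.le
  obtain ⟨x, hx, y, hy, hxy⟩ := exists_far_of_le_card _ p T hp (by omega)
    (fun x hx y hy => dvd_sub_of_dvd hpq (mem_lows.mp hx).2 (mem_lows.mp hy).2) hL
  obtain ⟨u, hu, v, hv, huv⟩ := exists_far_of_le_card _ p T hp (by omega)
    (fun x hx y hy => dvd_sub_of_dvd (c := c + 1) hpq
      (by rw [add_right_comm]; exact (mem_ups.mp hx).2)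
      (by rw [add_right_comm]; exact (mem_ups.mp hy).2)) hU
  have hx' := mem_lows.mp hx
  have hy' := mem_lows.mp hy
  have hu' := mem_ups.mp hu
  have hv' := mem_ups.mp hv
  refine ⟨x, hx, ?_, ?_, ?_, by linarith, ?_⟩
  · rw [mem_ups]
    exact ⟨⟨by linarith, by linarith⟩, dvd_up_of_low hst.dvd hx'.2 ⟨T - 2, by ring⟩⟩
  · have h1 := hst.sub_lt hp hp' (by omega) hag hx hv
    obtain ⟨k, hk⟩ := dvd_sub_sub_of_dvd hpq hst.dvd hx'.2 hv'.2
    have h2 : p * k < p * (T - 1) := by linarith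
    have h3 : k ≤ T - 2 := by
      have := lt_of_mul_lt_mul_left h2 hp.le
      omega
    have h4 := mul_le_mul_of_nonneg_left h3 hp.le
    linarith
  · by_contra! hcon
    have hz : x - p ∈ lows p q c a b := by
      rw [mem_lows]
      refine ⟨⟨by linarith, by linarith⟩, ?_⟩
      have := dvd_sub hx'.2 (dvd_mul_right p q)
      rwa [show c + x * q - p * q = c + (x - p) * q by ring] at this
    have hw : y - p + δ ∈ ups p q c a b := by
      rw [mem_ups]
      exact ⟨⟨by linarith, by linarith⟩, dvd_up_of_low hst.dvd hy'.2 ⟨-1, by ring⟩⟩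
    have := hst.sub_lt hp hp' (by omega) hag hz hw
    linarith
  · by_contra! hcon
    have hw : x + δ + (T - 1) * p ∈ ups p q c a b := by
      rw [mem_ups]
      exact ⟨⟨by linarith, by linarith⟩, dvd_up_of_low hst.dvd hx'.2 ⟨T - 1, by ring⟩⟩
    have := hst.sub_lt hp hp' (by omega) hag hx hw
    linarith

/-- Two intervals as in `Steep.exists_of_full` cannot follow one another on the same steep line. -/
theorem Steep.not_full_full {p q cf cg p' q' c' a b δ T : ℤ} (hp : 0 < p) (hp' : 0 < p')
    (hpq : IsCoprime p q) (hst : Steep p q p' q' δ T) (hT : 3 ≤ T) (hδ : 2 * δ ≤ p)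
    (hf : Agree p q cf p' q' c' 0 b) (hg : Agree p q cg p' q' c' a (-1))
    (hfL : T ≤ (lows p q cf 0 b).card) (hfU : T ≤ (ups p q cf 0 b).card)
    (hgL : T ≤ (lows p q cg a (-1)).card) (hgU : T ≤ (ups p q cg a (-1)).card) : False := by
  have hpos := hst.pos
  have hlt := hst.lt
  have hle := hst.le
  obtain ⟨lf, h1, h2, h3, h4, h5, h6⟩ := hst.exists_of_full hp hp' hpq (by omega) hf hfL hfU
  obtain ⟨lg, k1, k2, k3, k4, k5, k6⟩ := hst.exists_of_full hp hp' hpq (by omega) hg hgL hgU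
  have hΔ : 0 < q' * p - q * p' := by
    by_contra! h
    have : 0 ≤ (T - 1) * p := mul_nonneg (by omega) hp.le
    nlinarith
  have hw : p ≤ (T - 2) * p := by nlinarith
  rw [mem_lows] at h1 k1
  rw [mem_ups] at h2 k2
  set uf := lf + δ + (T - 2) * p with huf
  set ug := lg + δ + (T - 2) * p with hug
  have hfl := hf lf h1.1.1 h1.1.2
  have hfu := hf uf h2.1.1 h2.1.2
  have hgl := hg lg k1.1.1 k1.1.2
  have hgu := hg ug k2.1.1 k2.1.2
  have b1 := lows_ups_bound hp hp' hgl hfu k1.2 h2.2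
  have b2 := lows_ups_bound hp hp' hfl hgu h1.2 k2.2
  have b3 := lows_ups_bound hp hp' hfl hfu h1.2 h2.2
  have b4 : (q' * p - q * p') * (δ + p) < p' := by nlinarith
  have c1 : lf - ug ≤ 2 * p - 1 := by linarith
  rcases lt_trichotomy (cf - cg) 0 with hd | hd | hd
  · have : p' * (cf - cg + 1) ≤ 0 := mul_nonpos_of_nonneg_of_nonpos hp'.le (by omega)
    have : 0 < (q' * p - q * p') * (uf - lg) := mul_pos hΔ (by linarith)
    linarith
  · obtain rfl : cf = cg := by omega
    have e := dvd_sub_sub_of_dvd hpq hst.dvd k1.2 h2.2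
    have : (q' * p - q * p') * (δ + (T - 1) * p) ≤ (q' * p - q * p') * (uf - lg) :=
      mul_le_mul_of_nonneg_left (by linarith) hΔ.le
    linarith
  · rcases lt_trichotomy (cf - cg) 2 with hd2 | hd2 | hd2
    · obtain rfl : cf = cg + 1 := by omega
      obtain ⟨e, he⟩ := dvd_sub_of_dvd hpq (c := cg + 1) (x := ug) (y := lf)
        (by rw [add_right_comm]; exact k2.2) h1.2
      have e1 : p * 1 < p * e := by linarith
      have e2 : p * e < p * 2 := by linarith
      have := lt_of_mul_lt_mul_left e1 hp.le
      have := lt_of_mul_lt_mul_left e2 hp.le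
      omega
    · obtain rfl : cf = cg + 2 := by omega
      obtain ⟨e, he⟩ := dvd_sub_sub_of_dvd hpq hst.dvd (c := -(cg + 2)) (x := -lf) (y := -ug)
        (by rw [show -(cg + 2) + -lf * q = -(cg + 2 + lf * q) by ring, dvd_neg]; exact h1.2)
        (by rw [show -(cg + 2) + -ug * q + 1 = -(cg + ug * q + 1) by ring, dvd_neg]; exact k2.2)
      have e2 : p * e < p * 2 := by linarith
      have e3 := lt_of_mul_lt_mul_left e2 hp.le
      have e4 : p * e ≤ p * 1 := mul_le_mul_of_nonneg_left (by omega) hp.le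
      have : (q' * p - q * p') * (lf - ug) ≤ (q' * p - q * p') * (δ + p) :=
        mul_le_mul_of_nonneg_left (by linarith) hΔ.le
      have b2' : (q' * p - q * p') * (ug - lf) < -p' := by
        rwa [show p' * (cg - (cg + 2) + 1) = -p' by ring] at b2
      have b2'' : (q' * p - q * p') * (ug - lf) = -((q' * p - q * p') * (lf - ug)) := by ring
      linarith
    · have : p' * (cg - cf + 1) ≤ p' * (-2) := mul_le_mul_of_nonneg_left (by omega) hp'.le
      have : (q' * p - q * p') * (lf - ug) ≤ (q' * p - q * p') * (2 * (δ + p)) :=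
        mul_le_mul_of_nonneg_left (by linarith) hΔ.le
      have b2' : (q' * p - q * p') * (ug - lf) = -((q' * p - q * p') * (lf - ug)) := by ring
      have b2'' : (q' * p - q * p') * (2 * (δ + p)) = 2 * ((q' * p - q * p') * (δ + p)) := by ring
      linarith

theorem exists_dvd_mul_add_one {p q : ℤ} (hp : 1 < p) (hpq : IsCoprime p q) :
    ∃ δ, 0 < δ ∧ δ < p ∧ p ∣ q * δ + 1 := by
  have hp0 : 0 < p := by omega
  obtain ⟨u, v, huv⟩ := hpq
  refine ⟨(-v) % p, ?_, Int.emod_lt_of_pos _ hp0, ?_⟩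
  · rcases (Int.emod_nonneg (-v) hp0.ne').lt_or_eq with h | h
    · exact h
    · exfalso
      have h1 := Int.dvd_of_emod_eq_zero h.symm
      rw [dvd_neg] at h1
      have : p ∣ 1 := by
        rw [← huv]
        exact dvd_add (dvd_mul_left p u) (h1.mul_right q)
      have := Int.le_of_dvd one_pos this
      omega
  · refine ⟨u - q * ((-v) / p), ?_⟩
    have := Int.mul_ediv_add_emod (-v) p
    linear_combination q * this - huv

/-- Two different parallel lines have different integer parts within every two consecutive
marks. -/
theorem card_le_one_of_parallel {p q c c' a b : ℤ} (hp : 1 < p) (hpq : IsCoprime p q)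
    (hne : c ≠ c') (hag : Agree p q c p q c' a b) :
    (lows p q c a b).card + (ups p q c a b).card ≤ 1 := by
  have hp0 : 0 < p := by omega
  wlog hlt : c < c' generalizing q c c'
  · have := this (q := -q) (c := -1 - c) (c' := -1 - c') hpq.neg_right (by omega)
      (hag.flip hp0 hp0) (by omega)
    rw [lows_flip, ups_flip] at this
    omega
  obtain ⟨δ, hδ0, hδp, hδ⟩ := exists_dvd_mul_add_one hp hpq
  have hU : ups p q c a b = ∅ := by
    rw [Finset.eq_empty_iff_forall_notMem]
    intro i hi
    rw [mem_ups] at hi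
    obtain ⟨B, hB⟩ := hi.2
    have e := hag i hi.1.1 hi.1.2
    have e2 : (c + i * q) / p = B - 1 := by
      rw [Int.ediv_eq_iff_of_pos hp0]
      constructor <;> nlinarith
    rw [e2, eq_comm, Int.ediv_eq_iff_of_pos hp0] at e
    nlinarith
  have hL : ((lows p q c a b).card : ℤ) ≤ 1 := by
    by_contra! hcon
    obtain ⟨x, hx, y, hy, hxy⟩ := exists_far_of_le_card _ p 2 hp0 (by omega)
      (fun x hx y hy => dvd_sub_of_dvd hpq (mem_lows.mp hx).2 (mem_lows.mp hy).2) hcon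
    rw [mem_lows] at hx hy
    have : y - p + δ ∈ ups p q c a b := by
      rw [mem_ups]
      exact ⟨⟨by linarith, by linarith⟩, dvd_up_of_low hδ hy.2 ⟨-1, by ring⟩⟩
    rw [hU] at this
    simp at this
  rw [hU, Finset.card_empty]
  omega

theorem ediv_add_of_le {p q c : ℤ} (hp : 0 < p) (hq : 0 ≤ q) (hqp : q ≤ p) :
    (c + q) / p = c / p ∨ (c + q) / p = c / p + 1 := by
  have h1 : c / p ≤ (c + q) / p := Int.ediv_le_ediv hp (by omega)
  have h2 : (c + q) / p ≤ (c + p) / p := Int.ediv_le_ediv hp (by omega)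
  rw [Int.add_ediv_of_dvd_right (dvd_refl p), Int.ediv_self hp.ne'] at h2
  omega

/-- Strip words that agree come from lines with the same integer parts, up to translation. -/
theorem exists_agree {p q c p' q' c' : ℤ} {J : ℕ} (hp : 0 < p) (hq : 0 ≤ q) (hqp : q ≤ p)
    (hp' : 0 < p') (hq' : 0 ≤ q') (hqp' : q' ≤ p')
    (h : ∀ i ≤ J, sgn p (c + i * q) = sgn p' (c' + i * q')) :
    ∃ t, Agree p q (c + 2 * p * t) p' q' c' 0 J := by
  have h0 := h 0 (Nat.zero_le _)
  simp only [sgn, decide_eq_decide, Nat.cast_zero, zero_mul, add_zero] at h0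
  obtain ⟨t, ht⟩ : Even (c' / p' - c / p) := by rw [Int.even_sub]; exact h0.symm
  refine ⟨t, ?_⟩
  have key : ∀ i : ℕ, i ≤ J → (c + 2 * p * t + i * q) / p = (c' + i * q') / p' := by
    intro i
    induction i with
    | zero =>
      intro _
      rw [Nat.cast_zero, zero_mul, zero_mul, add_zero, add_zero, mul_comm 2 p, mul_assoc,
        Int.add_mul_ediv_left _ _ hp.ne']
      omega
    | succ i ih =>
      intro hi
      have h1 := ih (by omega)
      have h2 := h (i + 1) hi
      rw [show c + ((i + 1 : ℕ) : ℤ) * q =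
        c + ((i + 1 : ℕ) : ℤ) * q + 2 * p * t - 2 * p * t by ring]
        at h2
      rw [sub_eq_add_neg, ← mul_neg, sgn_add _ _ hp] at h2
      simp only [sgn, decide_eq_decide] at h2
      push_cast at h2 ⊢
      rw [show c + (i + 1 : ℤ) * q + 2 * p * t = c + 2 * p * t + i * q + q by ring,
        show c' + (i + 1 : ℤ) * q' = c' + i * q' + q' by ring] at h2
      rw [show c + 2 * p * t + (i + 1 : ℤ) * q = c + 2 * p * t + i * q + q by ring,
        show c' + (i + 1 : ℤ) * q' = c' + i * q' + q' by ring]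
      have h3 := ediv_add_of_le (c := c + 2 * p * t + i * q) hp hq hqp
      have h4 := ediv_add_of_le (c := c' + i * q') hp' hq' hqp'
      rw [Int.even_iff, Int.even_iff] at h2
      generalize (c + 2 * p * t + i * q + q) / p = A at *
      generalize (c' + i * q' + q') / p' = B at *
      generalize (c + 2 * p * t + i * q) / p = C at *
      generalize (c' + i * q') / p' = E at *
      omega
  intro i hi hi'
  lift i to ℕ using hi
  exact key i (by omega)

/-- Lines whose integer parts agree everywhere have the same slope. -/
theorem slope_eq_of_agree {p q c p' q' c' : ℤ} (hp : 0 < p) (hp' : 0 < p')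
    (h : ∀ b : ℕ, Agree p q c p' q' c' 0 b) : q * p' = q' * p := by
  by_contra hne
  have key : ∀ i : ℕ, |(q' * p - q * p') * i| ≤ |c * p' - c' * p| + p * p' := by
    intro i
    have e := h i i (by positivity) le_rfl
    have h1 := Int.mul_ediv_add_emod (c + i * q) p
    have h2 := Int.emod_nonneg (c + i * q) hp.ne'
    have h3 := Int.emod_lt_of_pos (c + i * q) hp
    have h4 := Int.mul_ediv_add_emod (c' + i * q') p'
    have h5 := Int.emod_nonneg (c' + i * q') hp'.ne'
    have h6 := Int.emod_lt_of_pos (c' + i * q') hp'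
    rw [e] at h1
    have e2 : (q' * p - q * p') * i = (c * p' - c' * p) +
        (p * ((c' + i * q') % p') - p' * ((c + i * q) % p)) := by
      linear_combination p' * h1 - p * h4
    rw [e2]
    refine (abs_add_le _ _).trans (add_le_add le_rfl ?_)
    rw [abs_le]
    constructor <;> nlinarith
  have h1 := key (|c * p' - c' * p| + p * p' + 1).toNat
  have h0 : 0 ≤ |c * p' - c' * p| + p * p' + 1 := by positivity
  rw [Int.toNat_of_nonneg h0, abs_mul, abs_of_nonneg h0] at h1
  have h2 : 1 ≤ |q' * p - q * p'| := by
    refine Int.one_le_abs fun h => hne (by linarith)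
  nlinarith

/-- The matrix of the linear fractional map `x ↦ 1 / (m₁ + 1 / (m₂ + ⋯ + 1 / (m_k + x)))`. -/
def cfMat : List ℕ → Matrix (Fin 2) (Fin 2) ℤ
  | [] => 1
  | a :: l => !![0, 1; 1, (a : ℤ)] * cfMat l

theorem cfMat_append (l l' : List ℕ) : cfMat (l ++ l') = cfMat l * cfMat l' := by
  induction l with
  | nil => simp [cfMat]
  | cons a l ih => rw [List.cons_append, cfMat, cfMat, ih, Matrix.mul_assoc]

theorem det_cfMat (l : List ℕ) : (cfMat l).det = (-1) ^ l.length := by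
  induction l with
  | nil => simp [cfMat]
  | cons a l ih =>
    rw [cfMat, Matrix.det_mul, ih, Matrix.det_fin_two_of, List.length_cons, pow_succ]
    ring

theorem cfMat_cons (a : ℕ) (l : List ℕ) :
    cfMat (a :: l) 0 0 = cfMat l 1 0 ∧ cfMat (a :: l) 0 1 = cfMat l 1 1 ∧
    cfMat (a :: l) 1 0 = cfMat l 0 0 + a * cfMat l 1 0 ∧
    cfMat (a :: l) 1 1 = cfMat l 0 1 + a * cfMat l 1 1 := by
  simp [cfMat, Matrix.mul_apply, Fin.sum_univ_two]

theorem cfMat_nonneg (l : List ℕ) : ∀ i j, 0 ≤ cfMat l i j := by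
  induction l with
  | nil => simp [cfMat, Fin.forall_fin_two]
  | cons a l ih =>
    obtain ⟨h1, h2, h3, h4⟩ := cfMat_cons a l
    simp only [Fin.forall_fin_two, h1, h2, h3, h4] at ih ⊢
    obtain ⟨⟨i1, i2⟩, i3, i4⟩ := ih
    exact ⟨⟨i3, i4⟩, by positivity, by positivity⟩

theorem cfMat_pos (l : List ℕ) (h : ∀ x ∈ l, 0 < x) : 0 < cfMat l 1 1 := by
  induction l with
  | nil => simp [cfMat]
  | cons a l ih =>
    obtain ⟨h1, h2, h3, h4⟩ := cfMat_cons a l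
    rw [h4]
    have := ih fun x hx => h x (by simp [hx])
    have ha : (0 : ℤ) < a := by exact_mod_cast h a (by simp)
    have := cfMat_nonneg l 0 1
    positivity

theorem cfQ_eq (l : List ℕ) (h : ∀ x ∈ l, 0 < x) :
    cfQ l = (cfMat l 0 1 : ℚ) / (cfMat l 1 1 : ℚ) := by
  induction l with
  | nil => simp [cfMat, cfQ]
  | cons a l ih =>
    obtain ⟨h1, h2, h3, h4⟩ := cfMat_cons a l
    have h0 : ∀ x ∈ l, 0 < x := fun x hx => h x (by simp [hx])
    have hpos : (0 : ℚ) < cfMat l 1 1 := by exact_mod_cast cfMat_pos l h0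
    rw [cfQ, ih h0, h2, h4]
    push_cast
    field_simp
    rw [add_comm]

theorem cfQ_num_den (l : List ℕ) (h : ∀ x ∈ l, 0 < x) :
    (cfQ l).num = cfMat l 0 1 ∧ ((cfQ l).den : ℤ) = cfMat l 1 1 := by
  have hpos := cfMat_pos l h
  have hco : Nat.Coprime (cfMat l 0 1).natAbs (cfMat l 1 1).natAbs := by
    rw [← Int.isCoprime_iff_nat_coprime]
    have hdet := det_cfMat l
    rw [Matrix.det_fin_two] at hdet
    have hsq : ((-1 : ℤ) ^ l.length) * (-1) ^ l.length = 1 := by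
      rw [← mul_pow]; simp
    refine ⟨-(-1) ^ l.length * cfMat l 1 0, (-1) ^ l.length * cfMat l 0 0, ?_⟩
    linear_combination (-1) ^ l.length * hdet + hsq
  rw [cfQ_eq l h]
  exact ⟨Rat.num_div_eq_of_coprime hpos hco, Rat.den_div_eq_of_coprime hpos hco⟩

theorem cfQ_nonneg (l : List ℕ) : 0 ≤ cfQ l := by
  induction l with
  | nil => simp [cfQ]
  | cons a l ih => rw [cfQ]; positivity

theorem cfQ_le_one (l : List ℕ) (h : ∀ x ∈ l, 0 < x) : cfQ l ≤ 1 := by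
  cases l with
  | nil => simp [cfQ]
  | cons a l =>
    have ha : (1 : ℚ) ≤ a := by exact_mod_cast h a (by simp)
    have := cfQ_nonneg l
    rw [cfQ, div_le_one (by positivity)]
    linarith

theorem cfQ_mem_Ioo (l : List ℕ) (hne : l ≠ []) (h : ∀ x ∈ l, 0 < x) (hlast : 2 ≤ l.getLast hne) :
    0 < cfQ l ∧ cfQ l < 1 := by
  induction l with
  | nil => exact absurd rfl hne
  | cons a l ih =>
    have ha : (1 : ℚ) ≤ a := by exact_mod_cast h a (by simp)
    have h0 := cfQ_nonneg l
    refine ⟨by rw [cfQ]; positivity, ?_⟩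
    rw [cfQ, div_lt_one (by positivity)]
    rcases eq_or_ne l [] with rfl | hl
    · have : (2 : ℚ) ≤ a := by exact_mod_cast hlast
      linarith
    · have := (ih hl (fun x hx => h x (by simp [hx])) (by rwa [List.getLast_cons hl] at hlast)).1
      linarith

theorem cfQ_num_den_bounds (M : List ℕ) (m : ℕ) (hMlen : 2 ≤ M.length) (hMpos : ∀ x ∈ M, 0 < x)
    (hMlast : 2 ≤ M.getLast!) (hm : M.head? = some m) :
    (cfQ M).num * m < (cfQ M).den ∧ ((cfQ M).den : ℤ) < (cfQ M).num * (m + 1) := by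
  obtain ⟨l, rfl⟩ : ∃ l, M = m :: l := ⟨M.tail, by
    cases M with
    | nil => simp at hm
    | cons a l => simpa using hm⟩
  have hl : l ≠ [] := by rintro rfl; simp at hMlen
  rw [List.getLast!_eq_getLast?_getD, List.getLast?_eq_getLast_of_ne_nil (by simp),
    Option.getD_some, List.getLast_cons hl] at hMlast
  obtain ⟨h0, h1⟩ := cfQ_mem_Ioo l hl (fun x hx => hMpos x (by simp [hx])) hMlast
  have hr : cfQ (m :: l) * (m + cfQ l) = 1 := by
    rw [cfQ, one_div, inv_mul_cancel₀ (by positivity)]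
  have hpos : 0 < cfQ (m :: l) := by rw [cfQ]; positivity
  set r := cfQ (m :: l)
  have hden : (0 : ℚ) < r.den := by exact_mod_cast r.den_pos
  have hmul : r * r.den = r.num := Rat.mul_den_eq_num r
  constructor
  · have : (r.num * m : ℚ) < r.den := by
      rw [← hmul]
      have : r * m < 1 := by nlinarith
      nlinarith
    exact_mod_cast this
  · have : (r.den : ℚ) < r.num * (m + 1) := by
      rw [← hmul]
      have : 1 < r * (m + 1) := by nlinarith
      nlinarith
    exact_mod_cast this

theorem rat_lt_iff (s : ℚ) (a b : ℤ) (hb : 0 < b) : s < a / b ↔ s.num * b < s.den * a := by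
  have hden : (0 : ℚ) < s.den := by exact_mod_cast s.den_pos
  conv_lhs => rw [← Rat.num_div_den s]
  rw [div_lt_div_iff₀ hden (by exact_mod_cast hb), mul_comm (a : ℚ)]
  exact_mod_cast Iff.rfl

theorem lt_rat_iff (s : ℚ) (a b : ℤ) (hb : 0 < b) : a / b < s ↔ s.den * a < s.num * b := by
  have hden : (0 : ℚ) < s.den := by exact_mod_cast s.den_pos
  conv_lhs => rw [← Rat.num_div_den s]
  rw [div_lt_div_iff₀ (by exact_mod_cast hb) hden, mul_comm (a : ℚ)]
  exact_mod_cast Iff.rfl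

/-- A slope in one of the intervals `I₁(r;n)`, `I₂(r;n)` is much steeper than `r`, or much less
steep. -/
theorem exists_steep_of_mem (M : List ℕ) (n : ℕ) (hMlen : 2 ≤ M.length) (hMpos : ∀ x ∈ M, 0 < x)
    (hMlast : 2 ≤ M.getLast!) (hn : 2 ≤ n) (s : ℚ) (hs : memI1 M n s ∨ memI2 M n s) :
    0 ≤ s ∧ s ≤ 1 ∧ ∃ δ T : ℤ,
      (Steep (cfQ M).den (cfQ M).num s.den s.num δ T ∨
        Steep (cfQ M).den (-(cfQ M).num) s.den (-s.num) δ T) ∧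
      (T = 2 ∨ T = 2 * n - 1 ∧ 2 * δ ≤ (cfQ M).den) := by
  obtain ⟨L, y, rfl⟩ : ∃ L y, M = L ++ [y] :=
    ⟨M.dropLast, M.getLast (by rintro rfl; simp at hMlen), (List.dropLast_append_getLast _).symm⟩
  have hy : 2 ≤ y := by simpa [List.getLast!_eq_getLast?_getD] using hMlast
  have hLpos : ∀ x ∈ L, 0 < x := fun x hx => hMpos x (by simp [hx])
  have hfar : ∀ x ∈ L ++ [y] ++ [2 * n - 2], 0 < x := by
    intro x hx
    rw [List.mem_append, List.mem_singleton] at hx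
    rcases hx with hx | rfl
    · exact hMpos x hx
    · omega
  have hnear : ∀ x ∈ L ++ [y - 1, 2], 0 < x := by
    intro x hx
    simp only [List.mem_append, List.mem_cons, List.not_mem_nil, or_false] at hx
    rcases hx with hx | rfl | rfl
    · exact hLpos x hx
    · omega
    · omega
  obtain ⟨hnum, hden⟩ := cfQ_num_den (L ++ [y]) hMpos
  have hdet := det_cfMat (L ++ [y])
  rw [Matrix.det_fin_two] at hdet
  have hfar_eq : cfQ (L ++ [y] ++ [2 * n - 2]) =
      ((cfMat (L ++ [y]) 0 0 + cfMat (L ++ [y]) 0 1 * (2 * n - 2) : ℤ) : ℚ) /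
        ((cfMat (L ++ [y]) 1 0 + cfMat (L ++ [y]) 1 1 * (2 * n - 2) : ℤ) : ℚ) := by
    rw [cfQ_eq _ hfar, cfMat_append _ [2 * n - 2]]
    have : ((2 * n - 2 : ℕ) : ℤ) = 2 * n - 2 := by omega
    simp [cfMat, Matrix.mul_apply, Fin.sum_univ_two, this]
  have hnear_eq : cfQ (L ++ [y - 1, 2]) =
      ((2 * cfMat (L ++ [y]) 0 1 - cfMat (L ++ [y]) 0 0 : ℤ) : ℚ) /
        ((2 * cfMat (L ++ [y]) 1 1 - cfMat (L ++ [y]) 1 0 : ℤ) : ℚ) := by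
    rw [cfQ_eq _ hnear, cfMat_append, cfMat_append]
    have : ((y - 1 : ℕ) : ℤ) = y - 1 := by omega
    simp only [cfMat, Matrix.mul_apply, Fin.sum_univ_two, this]
    simp
    ring
  have hC : cfMat (L ++ [y]) 1 0 = cfMat L 1 1 := by
    simp [cfMat_append, cfMat, Matrix.mul_apply, Fin.sum_univ_two]
  have hD : cfMat (L ++ [y]) 1 1 = cfMat L 1 0 + cfMat L 1 1 * y := by
    simp [cfMat_append, cfMat, Matrix.mul_apply, Fin.sum_univ_two]
  have hCpos : 0 < cfMat (L ++ [y]) 1 0 := by rw [hC]; exact cfMat_pos L hLpos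
  have hCD : 2 * cfMat (L ++ [y]) 1 0 ≤ cfMat (L ++ [y]) 1 1 := by
    rw [hC] at hCpos ⊢
    rw [hD]
    have := cfMat_nonneg L 1 0
    have hy' : (2 : ℤ) ≤ y := by exact_mod_cast hy
    nlinarith
  have hsden : (0 : ℤ) < s.den := by exact_mod_cast s.den_pos
  unfold memI1 memI2 at hs
  have hlast : (L ++ [y]).getLast! = y := by simp [List.getLast!_eq_getLast?_getD]
  rw [List.dropLast_concat, hlast] at hs
  have hfar1 := cfQ_le_one _ hfar
  have hnear1 := cfQ_le_one _ hnear
  have hfar0 := cfQ_nonneg (L ++ [y] ++ [2 * n - 2])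
  have hnear0 := cfQ_nonneg (L ++ [y - 1, 2])
  rw [hfar_eq] at hs hfar1 hfar0
  rw [hnear_eq] at hs hnear1 hnear0
  rw [hnum, hden]
  set A := cfMat (L ++ [y]) 0 0
  set B := cfMat (L ++ [y]) 0 1
  set C := cfMat (L ++ [y]) 1 0
  set D := cfMat (L ++ [y]) 1 1
  have hn' : (2 : ℤ) ≤ n := by exact_mod_cast hn
  have hfarpos : 0 < C + D * (2 * n - 2) := by nlinarith
  have hnearpos : 0 < 2 * D - C := by linarith
  refine ⟨?_, ?_, ?_⟩
  · split_ifs at hs <;> rcases hs with h | h <;> linarith [h.1]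
  · split_ifs at hs <;> rcases hs with h | h <;> linarith [h.2]
  split_ifs at hs with hk
  · rw [hk.neg_one_pow] at hdet
    rcases hs with ⟨-, h⟩ | ⟨h, -⟩
    · rw [← not_lt, lt_rat_iff _ _ _ hnearpos, not_lt] at h
      refine ⟨D - C, 2, Or.inr ⟨by linarith, by linarith, ⟨A - B, by linear_combination -hdet⟩, ?_⟩,
        Or.inl rfl⟩
      nlinarith
    · rw [lt_rat_iff _ _ _ hfarpos] at h
      refine ⟨C, 2 * n - 1, Or.inl ⟨hCpos, by linarith, ⟨A, by linear_combination -hdet⟩, ?_⟩,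
        Or.inr ⟨rfl, hCD⟩⟩
      nlinarith
  · rw [(Nat.not_even_iff_odd.mp hk).neg_one_pow] at hdet
    rcases hs with ⟨-, h⟩ | ⟨h, -⟩
    · rw [rat_lt_iff _ _ _ hfarpos] at h
      refine ⟨C, 2 * n - 1, Or.inr ⟨hCpos, by linarith, ⟨-A, by linear_combination hdet⟩, ?_⟩,
        Or.inr ⟨rfl, hCD⟩⟩
      nlinarith
    · rw [← not_lt, rat_lt_iff _ _ _ hnearpos, not_lt] at h
      refine ⟨D - C, 2, Or.inl ⟨by linarith, by linarith, ⟨B - A, by linear_combination hdet⟩, ?_⟩,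
        Or.inl rfl⟩
      nlinarith

theorem mul_lt_of_dvd {p q δ m : ℤ} (hq : 0 < q) (hm : q * m < p) (hδ : 0 < δ)
    (hd : p ∣ q * δ + 1) : m ≤ δ := by
  have := Int.le_of_dvd (by positivity) hd
  have : q * m ≤ q * δ := by linarith
  exact le_of_mul_le_mul_left this hq

/-- If the slope `q / p` is strictly between `1 / (m + 1)` and `1 / m`, all slopes outside of this
interval are much steeper or much less steep. -/
theorem exists_steep_of_outside {p q p' q' m : ℤ} (hpq : IsCoprime p q) (hq : 0 < q) (hm : 0 < m)
    (h1 : q * m < p) (h2 : p < q * (m + 1)) (hp' : 0 < p')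
    (h : p' < q' * m ∨ q' * (m + 1) < p') :
    ∃ δ, Steep p q p' q' δ 1 ∨ Steep p (-q) p' (-q') δ 1 := by
  have hq2 : 2 ≤ q := by
    by_contra! hcon
    obtain rfl : q = 1 := by omega
    omega
  have hp : 1 < p := by nlinarith
  rcases h with h | h
  · obtain ⟨δ, hδ0, hδp, hδ⟩ := exists_dvd_mul_add_one hp hpq
    have hmδ := mul_lt_of_dvd hq h1 hδ0 hδ
    refine ⟨δ, Or.inl ⟨hδ0, hδp, hδ, ?_⟩⟩
    have h3 : p' ≤ (q' * p - q * p') * m := by nlinarith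
    have h4 : 0 < q' * p - q * p' := by
      by_contra! hcon
      nlinarith
    nlinarith
  · obtain ⟨δ, hδ0, hδp, hδ⟩ := exists_dvd_mul_add_one hp hpq.neg_right
    have hmδ : m + 1 ≤ δ := by
      obtain ⟨k, hk⟩ := hδ
      have h3 : q * δ = p * (-k) + 1 := by linarith
      have h4 : 0 < -k := by
        by_contra! hcon
        nlinarith
      have h5 : p * 1 ≤ p * (-k) := mul_le_mul_of_nonneg_left (by omega) (by omega)
      have : q * m < q * δ := by linarith
      have := lt_of_mul_lt_mul_left this hq.le
      omega
    refine ⟨δ, Or.inr ⟨hδ0, hδp, hδ, ?_⟩⟩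
    have h3 : p' ≤ (-q' * p - -q * p') * (m + 1) := by nlinarith
    have h4 : 0 < -q' * p - -q * p' := by
      by_contra! hcon
      nlinarith
    nlinarith

/-- A combinatorial cell structure on the sphere with the following faces: an inner disk
(`face = 0`), `k` relator disks (`face = 1, …, k`) with `N` darts and `4 * n` marks each, and an
outer disk (`face = k + 1`). `nxt` runs around a face, `opp` reverses a dart, `src` is the
initial vertex. -/
structure Diagram (X : Type) [Fintype X] (k N n : ℕ) where
  nxt : Equiv.Perm X
  opp : X → X
  src : X → ℕ
  typ : X → Fin 2
  face : X → ℕ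
  mark : X → Prop
  opp_opp : ∀ d, opp (opp d) = d
  src_nxt : ∀ d, src (nxt d) = src (opp d)
  typ_nxt : ∀ d, typ (nxt d) = typ d + 1
  typ_opp : ∀ d, typ (opp d) = typ d
  face_nxt : ∀ d, face (nxt d) = face d
  face_le : ∀ d, face d ≤ k + 1
  exists_face : ∀ j, 1 ≤ j → j ≤ k + 1 → ∃ d, face d = j
  period : ∀ d, 1 ≤ face d → face d ≤ k → (nxt ^ N) d = d
  period_inj : ∀ d, 1 ≤ face d → face d ≤ k → ∀ i < N, ∀ j < N, (nxt ^ i) d = (nxt ^ j) d → i = j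
  transitive : ∀ d, 1 ≤ face d → face d ≤ k → ∀ e, face e = face d → ∃ i < N, (nxt ^ i) d = e

namespace Diagram

open Classical in
/-- The degree of a vertex. -/
noncomputable def deg {X : Type} [Fintype X] {k N n : ℕ} (D : Diagram X k N n) (v : ℕ) : ℕ :=
  (Finset.univ.filter fun d => D.src d = v).card

/-- The darts of the relator disks. -/
def Rel {X : Type} [Fintype X] {k N n : ℕ} (D : Diagram X k N n) (d : X) : Prop :=
  1 ≤ D.face d ∧ D.face d ≤ k

/-- The darts that end in a vertex of degree different from two. -/
def Corner {X : Type} [Fintype X] {k N n : ℕ} (D : Diagram X k N n) (d : X) : Prop :=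
  D.deg (D.src (D.opp d)) ≠ 2

open Classical in
/-- The number of marks among the first `J` darts from `d` on. -/
noncomputable def marks {X : Type} [Fintype X] {k N n : ℕ} (D : Diagram X k N n) (d : X) (J : ℕ) :
    ℕ :=
  ((Finset.range J).filter fun i => D.mark ((D.nxt ^ i) d)).card

open Classical in
/-- The bound for the number of marks along an arc with a given face on the other side. -/
noncomputable def cap (k n f : ℕ) : ℕ := if f = 0 then 4 * n - 2 else if f = k + 1 then 2 else 1

variable {X : Type} [Fintype X] {k N n : ℕ} (D : Diagram X k N n)

/-- The next dart around the initial vertex. -/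
def rot (d : X) : X := D.nxt (D.opp d)

theorem opp_injective : Function.Injective D.opp := fun a b h => by
  rw [← D.opp_opp a, h, D.opp_opp]

theorem rot_injective : Function.Injective D.rot := D.nxt.injective.comp D.opp_injective

theorem src_rot (d : X) : D.src (D.rot d) = D.src d := by
  rw [rot, D.src_nxt, D.opp_opp]

theorem typ_rot (d : X) : D.typ (D.rot d) = D.typ d + 1 := by
  rw [rot, D.typ_nxt, D.typ_opp]

theorem face_pow (d : X) (i : ℕ) : D.face ((D.nxt ^ i) d) = D.face d := by
  induction i with
  | zero => rfl
  | succ i ih => rw [pow_succ', Equiv.Perm.mul_apply, D.face_nxt, ih]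

open Classical in
theorem deg_eq (v : ℕ) (t : Fin 2) :
    D.deg v = 2 * (Finset.univ.filter fun d => D.src d = v ∧ D.typ d = t).card := by
  have key : ∀ t, (Finset.univ.filter fun d => D.src d = v ∧ D.typ d = t).card ≤
      (Finset.univ.filter fun d => D.src d = v ∧ D.typ d = t + 1).card := by
    intro t
    refine Finset.card_le_card_of_injOn D.rot ?_ D.rot_injective.injOn
    intro d hd
    simp only [Finset.coe_filter, Finset.mem_univ, true_and, Set.mem_ofPred_eq] at hd ⊢
    rw [D.src_rot, D.typ_rot, hd.1, hd.2]
    simp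
  have h1 := key t
  have h2 := key (t + 1)
  have h0 (x : Fin 2) : x + 1 + 1 = x := by revert x; decide
  have h3 := h0 t
  rw [h3] at h2
  have h4 : D.deg v = (Finset.univ.filter fun d => D.src d = v ∧ D.typ d = t).card +
      (Finset.univ.filter fun d => D.src d = v ∧ D.typ d = t + 1).card := by
    unfold deg
    rw [← Finset.card_union_of_disjoint]
    · congr 1
      ext d
      have : D.typ d = t ∨ D.typ d = t + 1 := by
        have h5 (x y : Fin 2) : x = y ∨ x = y + 1 := by revert x y; decide
        exact h5 _ _
      simp only [Finset.mem_filter, Finset.mem_univ, true_and, Finset.mem_union]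
      tauto
    · rw [Finset.disjoint_filter]
      rintro d - ⟨-, h⟩ ⟨-, h'⟩
      rw [h] at h'
      revert h'
      generalize t = x
      revert x; decide
  omega

theorem rot_rot_of_deg_two (d : X) (h : D.deg (D.src d) = 2) : D.rot (D.rot d) = d := by
  classical
  rw [D.deg_eq _ (D.typ d)] at h
  have h1 := Finset.card_le_one.mp (show (Finset.univ.filter fun e => D.src e = D.src d ∧
    D.typ e = D.typ d).card ≤ 1 by omega)
  apply h1
  · simp only [Finset.mem_filter, Finset.mem_univ, true_and, D.src_rot, D.typ_rot]
    generalize D.typ d = x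
    revert x; decide
  · simp

theorem rot_four_of_deg_four (d : X) (h : D.deg (D.src d) = 4) :
    D.rot (D.rot (D.rot (D.rot d))) = d := by
  classical
  rw [D.deg_eq _ (D.typ d)] at h
  have h3 (x : Fin 2) : x + 1 + 1 = x := by revert x; decide
  obtain ⟨a, b, hab, hS⟩ := Finset.card_eq_two.mp (show (Finset.univ.filter fun e =>
    D.src e = D.src d ∧ D.typ e = D.typ d).card = 2 by omega)
  have m1 : d ∈ ({a, b} : Finset X) := by rw [← hS]; simp
  have m2 : D.rot (D.rot d) ∈ ({a, b} : Finset X) := by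
    rw [← hS]; simp [D.src_rot, D.typ_rot, h3]
  have m3 : D.rot (D.rot (D.rot (D.rot d))) ∈ ({a, b} : Finset X) := by
    rw [← hS]; simp [D.src_rot, D.typ_rot, h3]
  have hinj := D.rot_injective.comp D.rot_injective
  simp only [Finset.mem_insert, Finset.mem_singleton] at m1 m2 m3
  by_contra hne
  have hne' : D.rot (D.rot d) ≠ d := fun h => hne (by rw [h, h])
  have hne'' : D.rot (D.rot (D.rot (D.rot d))) ≠ D.rot (D.rot d) := fun h => hne' (hinj h)
  grind

theorem two_le_deg (d : X) : 2 ≤ D.deg (D.src d) := by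
  classical
  rw [D.deg_eq _ (D.typ d)]
  have : 0 < (Finset.univ.filter fun e => D.src e = D.src d ∧ D.typ e = D.typ d).card :=
    Finset.card_pos.mpr ⟨d, by simp⟩
  omega

theorem four_le_deg (d : X) (h : D.deg (D.src d) ≠ 2) : 4 ≤ D.deg (D.src d) := by
  have := D.two_le_deg d
  rw [D.deg_eq _ 0] at *
  omega

theorem nxt_opp_nxt (d : X) (h : ¬ D.Corner d) : D.nxt (D.opp (D.nxt d)) = D.opp d := by
  have h' : D.deg (D.src (D.opp d)) = 2 := by unfold Corner at h; tauto
  have := D.rot_rot_of_deg_two (D.opp d) h'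
  simpa [rot, D.opp_opp] using this

theorem face_opp_pow (d : X) (J : ℕ) (h : ∀ i < J, ¬ D.Corner ((D.nxt ^ i) d)) :
    D.face (D.opp ((D.nxt ^ J) d)) = D.face (D.opp d) := by
  induction J with
  | zero => rfl
  | succ J ih =>
    rw [← ih fun i hi => h i (by omega), pow_succ', Equiv.Perm.mul_apply]
    rw [← D.nxt_opp_nxt _ (h J (by omega)), D.face_nxt]

theorem marks_add (d : X) (I J : ℕ) : D.marks d (I + J) =
    D.marks d I + D.marks ((D.nxt ^ I) d) J := by
  classical
  unfold marks
  rw [Finset.card_filter, Finset.card_filter, Finset.card_filter, Finset.sum_range_add]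
  congr 1
  refine Finset.sum_congr rfl fun i _ => ?_
  rw [add_comm I i, pow_add, Equiv.Perm.mul_apply]

open Classical in
theorem card_nonsmooth (hcount : Fintype.card X ≤ 2 * (Finset.univ.image D.src).card + 2 * k) :
    (Finset.univ.filter fun d => D.deg (D.src d) ≠ 2).card ≤ 4 * k ∧
    (4 * k ≤ (Finset.univ.filter fun d => D.deg (D.src d) ≠ 2).card →
      ∀ d, D.deg (D.src d) ≠ 2 → D.deg (D.src d) = 4) := by
  set V := Finset.univ.image D.src
  have h1 : Fintype.card X = ∑ v ∈ V, D.deg v := by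
    rw [← Finset.card_univ]
    exact Finset.card_eq_sum_card_image D.src Finset.univ
  have h2 : (Finset.univ.filter fun d => D.deg (D.src d) ≠ 2).card =
      ∑ v ∈ V, if D.deg v ≠ 2 then D.deg v else 0 := by
    rw [Finset.card_eq_sum_card_fiberwise (f := D.src) (t := V)]
    · refine Finset.sum_congr rfl fun v _ => ?_
      rw [Finset.filter_filter]
      split_ifs with h
      · unfold deg
        congr 1
        ext d
        simp only [Finset.mem_filter, Finset.mem_univ, true_and]
        constructor
        · exact fun h => h.2
        · rintro rfl; exact ⟨h, rfl⟩
      · rw [Finset.card_eq_zero, Finset.filter_eq_empty_iff]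
        rintro d - ⟨h', rfl⟩
        exact h h'
    · intro d _
      simp [V]
  have h3 : ∀ v ∈ V, (if D.deg v ≠ 2 then D.deg v else 0) + 4 ≤ 2 * D.deg v := by
    intro v hv
    obtain ⟨d, -, rfl⟩ := Finset.mem_image.mp hv
    split_ifs with h
    · have := D.four_le_deg d h
      omega
    · omega
  have h4 : ∑ v ∈ V, ((if D.deg v ≠ 2 then D.deg v else 0) + 4) ≤ ∑ v ∈ V, 2 * D.deg v :=
    Finset.sum_le_sum h3
  have h5 : ∑ v ∈ V, ((if D.deg v ≠ 2 then D.deg v else 0) + 4) =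
      (∑ v ∈ V, if D.deg v ≠ 2 then D.deg v else 0) + V.card * 4 := by
    rw [Finset.sum_add_distrib, Finset.sum_const, smul_eq_mul]
  have h6 : ∑ v ∈ V, 2 * D.deg v = 2 * ∑ v ∈ V, D.deg v := (Finset.mul_sum ..).symm
  refine ⟨by omega, fun h7 d hd => ?_⟩
  have h8 := (Finset.sum_eq_sum_iff_of_le h3).mp (by omega) (D.src d) (by simp [V])
  rw [if_pos hd] at h8
  omega

open Classical in
/-- The corners on a face. -/
noncomputable def corners (j : ℕ) : Finset X :=
  Finset.univ.filter fun d => D.face d = j ∧ D.Corner d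

open Classical in
/-- The weight of a corner. -/
noncomputable def weight (d : X) : ℕ := if D.Rel (D.opp d) then 1 else 2

open Classical in
/-- The relator disks have at most `4 * k` corners altogether, counted with weight. -/
theorem sum_weight (hcount : Fintype.card X ≤ 2 * (Finset.univ.image D.src).card + 2 * k) :
    ∑ j ∈ Finset.Icc 1 k, ∑ d ∈ D.corners j, D.weight d ≤ 4 * k ∧
    (4 * k ≤ ∑ j ∈ Finset.Icc 1 k, ∑ d ∈ D.corners j, D.weight d →
      ∀ d, D.deg (D.src d) ≠ 2 → D.deg (D.src d) = 4 ∧ (¬ D.Rel d → D.Rel (D.opp d))) := by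
  obtain ⟨h1, h2⟩ := D.card_nonsmooth hcount
  set A := Finset.univ.filter fun d => D.Rel d ∧ D.Corner d
  set B := A.filter fun d => ¬ D.Rel (D.opp d)
  set NR := Finset.univ.filter fun d => D.Rel d ∧ D.deg (D.src d) ≠ 2
  set NU := Finset.univ.filter fun d => ¬ D.Rel d ∧ D.deg (D.src d) ≠ 2
  have hA (d : X) : d ∈ A ↔ D.Rel d ∧ D.Corner d := by simp [A]
  have hNR (d : X) : d ∈ NR ↔ D.Rel d ∧ D.deg (D.src d) ≠ 2 := by simp [NR]
  have e1 : ∑ j ∈ Finset.Icc 1 k, ∑ d ∈ D.corners j, D.weight d = ∑ d ∈ A, D.weight d := by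
    rw [← Finset.sum_fiberwise_of_maps_to (s := A) (t := Finset.Icc 1 k) (g := D.face)]
    · refine Finset.sum_congr rfl fun j hj => Finset.sum_congr ?_ fun _ _ => rfl
      ext d
      simp only [corners, hA, Rel, Finset.mem_filter, Finset.mem_univ, true_and, Finset.mem_Icc]
        at hj ⊢
      constructor
      · rintro ⟨rfl, h⟩; exact ⟨⟨hj, h⟩, rfl⟩
      · rintro ⟨⟨-, h⟩, rfl⟩; exact ⟨rfl, h⟩
    · intro d hd
      exact Finset.mem_coe.mpr (Finset.mem_Icc.mpr ((hA d).mp hd).1)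
  have e2 : ∑ d ∈ A, D.weight d = A.card + B.card := by
    have : ∀ d ∈ A, D.weight d = 1 + if ¬ D.Rel (D.opp d) then 1 else 0 := by
      intro d _
      unfold weight
      split_ifs <;> simp_all
    rw [Finset.sum_congr rfl this, Finset.sum_add_distrib, ← Finset.card_filter]
    simp [B]
  have hcorner (d : X) : D.Corner d ↔ D.deg (D.src (D.nxt d)) ≠ 2 := by
    rw [D.src_nxt]; rfl
  have e3 : A.card ≤ NR.card := by
    refine Finset.card_le_card_of_injOn D.nxt ?_ D.nxt.injective.injOn
    intro d hd
    rw [Finset.mem_coe, hA, hcorner] at hd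
    rw [Finset.mem_coe, hNR]
    simpa only [Rel, D.face_nxt] using hd
  have hB : B.image D.opp ⊆ NU := by
    intro d hd
    obtain ⟨e, he, rfl⟩ := Finset.mem_image.mp hd
    simp only [A, B, NU, Finset.mem_filter, Finset.mem_univ, true_and] at he ⊢
    exact ⟨he.2, he.1.2⟩
  have e4 : (B.image D.opp).card = B.card := Finset.card_image_of_injective _ D.opp_injective
  have e5 := Finset.card_le_card hB
  have e6 : (Finset.univ.filter fun d => D.deg (D.src d) ≠ 2).card = NR.card + NU.card := by
    rw [← Finset.card_filter_add_card_filter_not (p := fun d => D.Rel d), Finset.filter_filter,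
      Finset.filter_filter]
    simp only [NR, NU, and_comm]
  refine ⟨by omega, fun h => fun d hd => ⟨h2 (by omega) d hd, fun hR => ?_⟩⟩
  have e7 : B.image D.opp = NU := Finset.eq_of_subset_of_card_le hB (by omega)
  have hmem : d ∈ NU := by simp [NU, hR, hd]
  rw [← e7] at hmem
  obtain ⟨e, he, rfl⟩ := Finset.mem_image.mp hmem
  rw [D.opp_opp]
  simp only [A, B, Finset.mem_filter] at he
  exact he.1.2.1

/-- The bound `cap` for the number of marks along each arc of a relator disk. -/
def CapBound : Prop :=
  ∀ d, D.Rel d → ∀ J < N, (∀ i < J, ¬ D.Corner ((D.nxt ^ i) d)) →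
    D.marks d (J + 1) ≤ cap k n (D.face (D.opp d))

open Classical in
theorem marks_le_sum (hcap : D.CapBound) (d : X) (hd : D.Rel d) (M : ℕ) (hM : M ≤ N)
    (hend : M = 0 ∨ D.Corner ((D.nxt ^ (M - 1)) d)) :
    D.marks d M ≤ ∑ i ∈ Finset.range M with D.Corner ((D.nxt ^ i) d),
      cap k n (D.face (D.opp ((D.nxt ^ i) d))) := by
  induction M using Nat.strong_induction_on with
  | _ M ih =>
  rcases Nat.eq_zero_or_pos M with rfl | hM0
  · simp [marks]
  have hlast : D.Corner ((D.nxt ^ (M - 1)) d) := by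
    rcases hend with h | h
    · omega
    · exact h
  have hex : ∃ a, a ≤ M - 1 ∧ ∀ i, a ≤ i → i < M - 1 → ¬ D.Corner ((D.nxt ^ i) d) :=
    ⟨M - 1, le_rfl, fun i _ _ => by omega⟩
  obtain ⟨a, ⟨haM, ha⟩, hmin⟩ : ∃ a, (a ≤ M - 1 ∧ ∀ i, a ≤ i → i < M - 1 →
      ¬ D.Corner ((D.nxt ^ i) d)) ∧ (a = 0 ∨ D.Corner ((D.nxt ^ (a - 1)) d)) := by
    refine ⟨Nat.find hex, Nat.find_spec hex, ?_⟩
    by_contra! hcon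
    obtain ⟨hne, hnc⟩ := hcon
    refine Nat.find_min hex (m := Nat.find hex - 1) (by omega)
      ⟨by have := (Nat.find_spec hex).1; omega, fun i hi hi' => ?_⟩
    rcases eq_or_lt_of_le hi with rfl | hlt
    · exact hnc
    · exact (Nat.find_spec hex).2 i (by omega) hi'
  obtain ⟨J, rfl⟩ : ∃ J, M = a + (J + 1) := ⟨M - 1 - a, by omega⟩
  rw [marks_add]
  have h1 := ih a (by omega) (by omega) hmin
  have hsm : ∀ i < J, ¬ D.Corner ((D.nxt ^ i) ((D.nxt ^ a) d)) := by
    intro i hi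
    rw [← Equiv.Perm.mul_apply, ← pow_add, add_comm]
    exact ha _ (by omega) (by omega)
  have h2 := hcap ((D.nxt ^ a) d) (by simpa only [Rel, D.face_pow] using hd) J (by omega) hsm
  rw [← D.face_opp_pow _ J hsm, ← Equiv.Perm.mul_apply, ← pow_add, add_comm J a] at h2
  refine (add_le_add h1 h2).trans ?_
  have e : a + (J + 1) - 1 = a + J := by omega
  rw [e] at hlast
  rw [← Finset.sum_filter_add_sum_filter_not
    ((Finset.range (a + (J + 1))).filter fun i => D.Corner ((D.nxt ^ i) d)) (fun i => i < a)]
  refine add_le_add (le_of_eq (Finset.sum_congr ?_ fun _ _ => rfl)) ?_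
  · ext i
    simp only [Finset.mem_filter, Finset.mem_range]
    constructor
    · rintro ⟨h, h'⟩; exact ⟨⟨by omega, h'⟩, h⟩
    · rintro ⟨⟨-, h'⟩, h⟩; exact ⟨h, h'⟩
  · exact Finset.single_le_sum (f := fun i => cap k n (D.face (D.opp ((D.nxt ^ i) d))))
      (fun _ _ => Nat.zero_le _) (by simp [hlast])

theorem pow_mem_face (d : X) (hd : D.Rel d) (e : X) (he : D.face e = D.face d) :
    ∃ i < N, (D.nxt ^ i) d = e := D.transitive d hd.1 hd.2 e he

theorem exists_corner (hcap : D.CapBound) (hn : 2 ≤ n) (hN : 0 < N)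
    (hmark : ∀ d, D.Rel d → D.marks d N = 4 * n) (d : X) (hd : D.Rel d) :
    ∃ l, D.face l = D.face d ∧ D.Corner l := by
  by_contra! hcon
  have h := hcap d hd (N - 1) (by omega) fun i _ => hcon _ (D.face_pow d i)
  rw [Nat.sub_add_cancel hN, hmark d hd] at h
  unfold cap at h
  split_ifs at h <;> omega

open Classical in
theorem marks_le_sum_corners (hcap : D.CapBound) (hN : 0 < N) (l : X) (hl : D.Rel l)
    (hc : D.Corner l) :
    D.marks (D.nxt l) N ≤ ∑ d ∈ D.corners (D.face l), cap k n (D.face (D.opp d)) := by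
  have hR : D.Rel (D.nxt l) := by simpa only [Rel, D.face_nxt] using hl
  have hlast : (D.nxt ^ (N - 1)) (D.nxt l) = l := by
    rw [← Equiv.Perm.mul_apply, ← pow_succ, Nat.sub_add_cancel hN, D.period l hl.1 hl.2]
  have h := D.marks_le_sum hcap (D.nxt l) hR N le_rfl (Or.inr (by rwa [hlast]))
  refine h.trans (le_of_eq ?_)
  refine Finset.sum_bij (fun i _ => (D.nxt ^ i) (D.nxt l)) ?_ ?_ ?_ ?_
  · intro i hi
    simp only [Finset.mem_filter, Finset.mem_range] at hi
    simp [corners, D.face_pow, D.face_nxt, hi.2]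
  · intro i hi j hj hij
    simp only [Finset.mem_filter, Finset.mem_range] at hi hj
    exact D.period_inj _ hR.1 hR.2 i hi.1 j hj.1 hij
  · intro d hd
    simp only [corners, Finset.mem_filter, Finset.mem_univ, true_and] at hd
    obtain ⟨i, hi, rfl⟩ := D.pow_mem_face (D.nxt l) hR d (by rw [D.face_nxt, hd.1])
    exact ⟨i, by simp [hi, hd.2], rfl⟩
  · intro i _; rfl

theorem not_rel_iff (d : X) : ¬ D.Rel d ↔ D.face d = 0 ∨ D.face d = k + 1 := by
  have := D.face_le d
  unfold Rel
  omega

theorem cap_opp_of_ne (d : X) (h : D.face (D.opp d) ≠ 0) :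
    cap k n (D.face (D.opp d)) = D.weight d := by
  have := D.face_le (D.opp d)
  unfold cap weight Rel
  split_ifs <;> omega

theorem weight_of_not (d : X) (h : ¬ D.Rel (D.opp d)) : D.weight d = 2 := by
  simp [weight, h]

theorem one_le_weight (d : X) : 1 ≤ D.weight d := by
  unfold weight; split_ifs <;> omega

/-- Every relator disk has corners of total weight at least four. -/
theorem four_le_weight (hcap : D.CapBound) (hn : 2 ≤ n) (hN : 0 < N)
    (hmark : ∀ d, D.Rel d → D.marks d N = 4 * n) (j : ℕ) (hj : 1 ≤ j) (hj' : j ≤ k) :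
    4 ≤ ∑ d ∈ D.corners j, D.weight d := by
  classical
  obtain ⟨d, rfl⟩ := D.exists_face j hj (by omega)
  obtain ⟨l, hl, hc⟩ := D.exists_corner hcap hn hN hmark d ⟨hj, hj'⟩
  rw [← hl] at hj hj' ⊢
  have h := D.marks_le_sum_corners hcap hN l ⟨hj, hj'⟩ hc
  rw [hmark (D.nxt l) (by simpa only [Rel, D.face_nxt] using ⟨hj, hj'⟩)] at h
  set C := D.corners (D.face l)
  set CV := C.filter fun d => D.face (D.opp d) = 0
  set CN := C.filter fun d => ¬ D.face (D.opp d) = 0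
  have hw : ∑ d ∈ CV, D.weight d + ∑ d ∈ CN, D.weight d = ∑ d ∈ C, D.weight d :=
    Finset.sum_filter_add_sum_filter_not C (fun d => D.face (D.opp d) = 0) D.weight
  have hk := Finset.sum_filter_add_sum_filter_not C (fun d => D.face (D.opp d) = 0)
    (fun d => cap k n (D.face (D.opp d)))
  have h1 : ∑ d ∈ CV, D.weight d = CV.card * 2 := by
    rw [Finset.sum_congr rfl fun d hd => D.weight_of_not d ?_, Finset.sum_const, smul_eq_mul]
    rw [D.not_rel_iff]
    exact Or.inl (Finset.mem_filter.mp hd).2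
  have h2 : ∑ d ∈ CV, cap k n (D.face (D.opp d)) = CV.card * (4 * n - 2) := by
    rw [Finset.sum_congr rfl fun d hd => ?_, Finset.sum_const, smul_eq_mul]
    rw [(Finset.mem_filter.mp hd).2]
    simp [cap]
  have h3 : ∑ d ∈ CN, cap k n (D.face (D.opp d)) = ∑ d ∈ CN, D.weight d :=
    Finset.sum_congr rfl fun d hd => D.cap_opp_of_ne d (Finset.mem_filter.mp hd).2
  rw [h1] at hw
  rw [h2, h3] at hk
  rcases Nat.lt_or_ge 1 CV.card with h4 | h4
  · omega
  · interval_cases CV.card <;> omega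

/-- A relator disk of weight four with a corner on the outer disk has just one further corner,
which is on the inner disk and ends a long arc. -/
theorem exists_long_arc (hcap : D.CapBound) (hn : 2 ≤ n) (hN : 0 < N)
    (hmark : ∀ d, D.Rel d → D.marks d N = 4 * n) (l : X) (hl : D.Rel l) (hc : D.Corner l)
    (hout : D.face (D.opp l) = k + 1) (hw : ∑ d ∈ D.corners (D.face l), D.weight d = 4) :
    ∃ J < N, (∀ i < J, ¬ D.Corner ((D.nxt ^ i) (D.nxt l))) ∧
      D.face (D.opp (D.nxt l)) = 0 ∧ 4 * n - 2 ≤ D.marks (D.nxt l) (J + 1) ∧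
      ∀ y, D.face y = D.face l → D.Corner y → D.face (D.opp y) = 0 →
        (D.nxt ^ J) (D.nxt l) = y := by
  classical
  have hR : D.Rel (D.nxt l) := by simpa only [Rel, D.face_nxt] using hl
  have h := D.marks_le_sum_corners hcap hN l hl hc
  rw [hmark (D.nxt l) hR] at h
  set C := D.corners (D.face l)
  have hlC : l ∈ C := by simp [C, corners, hc]
  have hwl : D.weight l = 2 := D.weight_of_not l (by rw [D.not_rel_iff]; exact Or.inr hout)
  obtain ⟨b, hbC, hb0⟩ : ∃ b ∈ C, D.face (D.opp b) = 0 := by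
    by_contra! hcon
    have h' : ∑ d ∈ C, cap k n (D.face (D.opp d)) = ∑ d ∈ C, D.weight d :=
      Finset.sum_congr rfl fun d hd => D.cap_opp_of_ne d (hcon d hd)
    omega
  have hwb : D.weight b = 2 := D.weight_of_not b (by rw [D.not_rel_iff]; exact Or.inl hb0)
  have hlb : b ≠ l := by rintro rfl; omega
  have hC : ∀ e ∈ C, e = l ∨ e = b := by
    intro e he
    by_contra! hcon
    have h1 := Finset.sum_le_sum_of_subset (f := D.weight)
      (show ({l, b, e} : Finset X) ⊆ C by
        intro x hx
        simp only [Finset.mem_insert, Finset.mem_singleton] at hx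
        rcases hx with rfl | rfl | rfl <;> assumption)
    rw [Finset.sum_insert, Finset.sum_insert, Finset.sum_singleton] at h1
    · have := D.one_le_weight e
      omega
    · simpa using hcon.2.symm
    · simp [hlb.symm, hcon.1.symm]
  have hfb : D.face b = D.face l := by
    simp only [C, corners, Finset.mem_filter] at hbC
    exact hbC.2.1
  obtain ⟨J, hJ, hJb⟩ := D.pow_mem_face (D.nxt l) hR b (by rw [D.face_nxt, hfb])
  have hlast : (D.nxt ^ (N - 1)) (D.nxt l) = l := by
    rw [← Equiv.Perm.mul_apply, ← pow_succ, Nat.sub_add_cancel hN, D.period l hl.1 hl.2]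
  have hcor : ∀ i < N, D.Corner ((D.nxt ^ i) (D.nxt l)) → i = N - 1 ∨ i = J := by
    intro i hi hci
    rcases hC _ (show (D.nxt ^ i) (D.nxt l) ∈ C by
      simp [C, corners, D.face_pow, D.face_nxt, hci]) with h1 | h1
    · left
      exact D.period_inj _ hR.1 hR.2 i hi (N - 1) (by omega) (by rw [h1, hlast])
    · right
      exact D.period_inj _ hR.1 hR.2 i hi J hJ (by rw [h1, hJb])
  have hJN : J ≠ N - 1 := by
    rintro rfl
    exact hlb (by rw [← hJb, hlast])
  have hsm : ∀ i < J, ¬ D.Corner ((D.nxt ^ i) (D.nxt l)) := by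
    intro i hi hci
    rcases hcor i (by omega) hci <;> omega
  have hsm2 : ∀ i < N - 1 - (J + 1), ¬ D.Corner ((D.nxt ^ i) ((D.nxt ^ (J + 1)) (D.nxt l))) := by
    intro i hi hci
    rw [← Equiv.Perm.mul_apply, ← pow_add] at hci
    rcases hcor _ (by omega) hci <;> omega
  have h2 := hcap ((D.nxt ^ (J + 1)) (D.nxt l)) (by simpa only [Rel, D.face_pow] using hR)
    (N - 1 - (J + 1)) (by omega) hsm2
  rw [← D.face_opp_pow _ _ hsm2, ← Equiv.Perm.mul_apply (D.nxt ^ (N - 1 - (J + 1))), ← pow_add,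
    show N - 1 - (J + 1) + (J + 1) = N - 1 by omega, hlast, hout] at h2
  have h3 := D.marks_add (D.nxt l) (J + 1) (N - 1 - (J + 1) + 1)
  rw [show J + 1 + (N - 1 - (J + 1) + 1) = N by omega, hmark _ hR] at h3
  have h4 : cap k n (k + 1) = 2 := by simp [cap]
  refine ⟨J, hJ, hsm, ?_, by omega, ?_⟩
  · rw [← D.face_opp_pow _ J hsm, hJb, hb0]
  · intro y hy hyc hy0
    rcases hC y (by simp [C, corners, hy, hyc]) with rfl | rfl
    · omega
    · exact hJb

/-- If the arcs satisfy the bounds `cap`, the outer disk has no boundary in common with the inner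
disk, and no two arcs of maximal length follow one another along the inner disk, then the Euler
characteristic is too small. -/
theorem false_of_bounds (hcap : D.CapBound) (hn : 2 ≤ n) (hN : 0 < N)
    (hmark : ∀ d, D.Rel d → D.marks d N = 4 * n)
    (hcount : Fintype.card X ≤ 2 * (Finset.univ.image D.src).card + 2 * k)
    (hout : ∀ d, D.face d = k + 1 → (∀ i, ¬ D.Corner ((D.nxt ^ i) d)) → D.Rel (D.opp d))
    (hcons : ∀ d z J₁ J₂, D.Rel d → D.Rel z → J₁ < N → J₂ < N →
      (∀ i < J₁, ¬ D.Corner ((D.nxt ^ i) d)) → (∀ i < J₂, ¬ D.Corner ((D.nxt ^ i) z)) →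
      D.face (D.opp d) = 0 → 4 * n - 2 ≤ D.marks d (J₁ + 1) → 4 * n - 2 ≤ D.marks z (J₂ + 1) →
      D.opp ((D.nxt ^ J₂) z) = D.nxt (D.opp d) → False) : False := by
  classical
  obtain ⟨hs1, hs2⟩ := D.sum_weight hcount
  have hw4 := D.four_le_weight hcap hn hN hmark
  have hcard : ∑ j ∈ Finset.Icc 1 k, 4 = 4 * k := by simp [mul_comm]
  have hge : ∑ j ∈ Finset.Icc 1 k, 4 ≤ ∑ j ∈ Finset.Icc 1 k, ∑ d ∈ D.corners j, D.weight d :=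
    Finset.sum_le_sum fun j hj => hw4 j (Finset.mem_Icc.mp hj).1 (Finset.mem_Icc.mp hj).2
  have hW : ∀ d, D.Rel d → ∑ e ∈ D.corners (D.face d), D.weight e = 4 := fun d hd =>
    ((Finset.sum_eq_sum_iff_of_le fun j hj =>
      hw4 j (Finset.mem_Icc.mp hj).1 (Finset.mem_Icc.mp hj).2).mp (by omega) (D.face d)
      (Finset.mem_Icc.mpr hd)).symm
  replace hs2 := hs2 (by omega)
  have hcorner (d : X) : D.Corner d ↔ D.deg (D.src (D.nxt d)) ≠ 2 := by
    rw [D.src_nxt]; rfl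
  obtain ⟨u, hu, hud⟩ : ∃ u, D.face u = k + 1 ∧ D.deg (D.src u) ≠ 2 := by
    obtain ⟨u, hu⟩ := D.exists_face (k + 1) (by omega) le_rfl
    by_contra! hcon
    have hnc : ∀ i, ¬ D.Corner ((D.nxt ^ i) u) := by
      intro i
      rw [hcorner, not_not]
      exact hcon _ (by rw [D.face_nxt, D.face_pow, hu])
    have hR := hout u hu hnc
    have hpow : ∀ i, (D.nxt ^ i) (D.opp ((D.nxt ^ i) u)) = D.opp u := by
      intro i
      induction i with
      | zero => rfl
      | succ i ih =>
        rw [pow_succ, Equiv.Perm.mul_apply, ← pow_succ, pow_succ', Equiv.Perm.mul_apply,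
          D.nxt_opp_nxt _ (hnc i), ih]
    obtain ⟨l, hl, hlc⟩ := D.exists_corner hcap hn hN hmark _ hR
    obtain ⟨i, hi, rfl⟩ := D.pow_mem_face _ hR l hl
    have e : (D.nxt ^ i) (D.opp u) = D.opp ((D.nxt ^ (N - i)) u) := by
      apply (D.nxt ^ (N - i)).injective
      rw [hpow, ← Equiv.Perm.mul_apply, ← pow_add, Nat.sub_add_cancel hi.le,
        D.period _ hR.1 hR.2]
    rw [e] at hlc
    apply hlc
    rw [D.opp_opp]
    exact hcon _ (by rw [D.face_pow, hu])
  have huR : ¬ D.Rel u := by rw [D.not_rel_iff]; exact Or.inr hu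
  obtain ⟨hdeg, hR⟩ := hs2 u hud
  replace hR := hR huR
  obtain ⟨J₁, hJ₁, hsm₁, hV₁, hm₁, -⟩ := D.exists_long_arc hcap hn hN hmark (D.opp u) hR
    (by unfold Corner; rwa [D.opp_opp]) (by rw [D.opp_opp, hu]) (hW _ hR)
  have h4 := D.rot_four_of_deg_four u hdeg
  set v := D.rot (D.rot u) with hv
  have hvd : D.deg (D.src v) ≠ 2 := by rw [hv, D.src_rot, D.src_rot]; exact hud
  have hv0 : D.face v = 0 := by rw [hv, rot, D.face_nxt]; exact hV₁
  have hyR : D.Rel (D.opp v) := (hs2 v hvd).2 (by rw [D.not_rel_iff]; exact Or.inl hv0)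
  have hyc : D.Corner (D.opp v) := by unfold Corner; rwa [D.opp_opp]
  have hxU : D.face (D.opp (D.nxt (D.opp v))) = k + 1 := by
    rw [← D.face_nxt, ← hu, ← h4]
    rfl
  have hxR : D.Rel (D.nxt (D.opp v)) := by simpa only [Rel, D.face_nxt] using hyR
  obtain ⟨l, hl, hlc, hlU⟩ : ∃ l, D.face l = D.face (D.nxt (D.opp v)) ∧ D.Corner l ∧
      D.face (D.opp l) = k + 1 := by
    have hex : ∃ i, D.Corner ((D.nxt ^ i) (D.nxt (D.opp v))) := by
      obtain ⟨i, -, hi⟩ := D.pow_mem_face (D.nxt (D.opp v)) hxR (D.opp v) (by rw [D.face_nxt])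
      exact ⟨i, by rwa [hi]⟩
    refine ⟨_, D.face_pow _ (Nat.find hex), Nat.find_spec hex, ?_⟩
    rw [D.face_opp_pow _ _ fun i hi => Nat.find_min hex hi, hxU]
  have hlR : D.Rel l := by rw [Rel, hl]; exact hxR
  obtain ⟨J₂, hJ₂, hsm₂, hV₂, hm₂, huniq⟩ := D.exists_long_arc hcap hn hN hmark l hlR hlc hlU
    (hW _ hlR)
  have hy := huniq (D.opp v) (by rw [hl, D.face_nxt]) hyc (by rw [D.opp_opp, hv0])
  refine hcons (D.nxt (D.opp u)) (D.nxt l) J₁ J₂ ?_ ?_ hJ₁ hJ₂ hsm₁ hsm₂ hV₁ hm₁ hm₂ ?_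
  · simpa only [Rel, D.face_nxt] using hR
  · simpa only [Rel, D.face_nxt] using hlR
  · rw [hy, D.opp_opp]
    rfl

end Diagram

/-- `Walk src tgt u l v` says that the darts of `l` form a path from `u` to `v`. -/
def Walk (src tgt : ℕ × ℕ → ℕ) : ℕ → List (ℕ × ℕ) → ℕ → Prop
  | u, [], v => u = v
  | u, d :: l, v => src d = u ∧ Walk src tgt (tgt d) l v

theorem walk_append {src tgt : ℕ × ℕ → ℕ} {u v : ℕ} {l l' : List (ℕ × ℕ)} :
    Walk src tgt u (l ++ l') v ↔ ∃ w, Walk src tgt u l w ∧ Walk src tgt w l' v := by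
  induction l generalizing u with
  | nil => simp [Walk]
  | cons d l ih => simp [Walk, ih, and_assoc]

theorem Walk.map {src tgt src' tgt' : ℕ × ℕ → ℕ} {u v : ℕ} {l : List (ℕ × ℕ)}
    (h : Walk src tgt u l v) (φ : ℕ → ℕ)
    (hφ : ∀ d ∈ l, src' d = φ (src d) ∧ tgt' d = φ (tgt d)) :
    Walk src' tgt' (φ u) l (φ v) := by
  induction l generalizing u with
  | nil => exact congrArg φ h
  | cons d l ih =>
    obtain ⟨rfl, h2⟩ := h
    obtain ⟨h3, h4⟩ := hφ d (by simp)
    refine ⟨h3, ?_⟩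
    rw [h4]
    exact ih h2 fun e he => hφ e (by simp [he])

theorem Walk.congr {src tgt src' tgt' : ℕ × ℕ → ℕ} {u v : ℕ} {l : List (ℕ × ℕ)}
    (h : Walk src tgt u l v) (hl : ∀ d ∈ l, src' d = src d ∧ tgt' d = tgt d) :
    Walk src' tgt' u l v :=
  h.map id hl

theorem Walk.src_getElem {src tgt : ℕ × ℕ → ℕ} {u v : ℕ} {l : List (ℕ × ℕ)}
    (h : Walk src tgt u l v) (i : ℕ) (hi : i + 1 < l.length) :
    src l[i + 1] = tgt l[i] := by
  induction l generalizing u i with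
  | nil => simp at hi
  | cons d l ih =>
    obtain _ | i := i
    · obtain _ | ⟨e, l⟩ := l
      · simp at hi
      · exact h.2.1
    · exact ih h.2 i (by simpa using hi)

theorem Walk.src_zero {src tgt : ℕ × ℕ → ℕ} {u v : ℕ} {l : List (ℕ × ℕ)}
    (h : Walk src tgt u l v) (hl : 0 < l.length) : src l[0] = u := by
  obtain _ | ⟨d, l⟩ := l
  · simp at hl
  · exact h.1

theorem Walk.tgt_getElem {src tgt : ℕ × ℕ → ℕ} {u v : ℕ} {l : List (ℕ × ℕ)}
    (h : Walk src tgt u l v) (i : ℕ) (hi : i + 1 = l.length) : tgt l[i] = v := by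
  induction l generalizing u i with
  | nil => simp at hi
  | cons d l ih =>
    obtain _ | i := i
    · obtain _ | ⟨e, l⟩ := l
      · exact h.2
      · simp at hi
    · exact ih h.2 i (by simpa using hi)

/-- The darts of the faces in `J`, where the darts of the face `j` are `(j, i)` with `i < len j`,
and the darts in `B`. -/
def Live (len : ℕ → ℕ) (J : Finset ℕ) (B : List (ℕ × ℕ)) (d : ℕ × ℕ) : Prop :=
  d ∈ B ∨ d.1 ∈ J ∧ d.2 < len d.1

theorem live_tail {len : ℕ → ℕ} {J : Finset ℕ} {B : List (ℕ × ℕ)} {d t t' : ℕ × ℕ} :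
    Live len J (t :: (B ++ [t'])) d ↔ Live len J B d ∨ d = t ∨ d = t' := by
  simp only [Live, List.mem_cons, List.mem_append, List.not_mem_nil, or_false]
  tauto

/-- A planar gluing of strip-labelled polygons, the faces, with one further boundary `bdry`, which
is a closed walk from `base`. The letter of the dart `(j, i)` of the face `j` has phase
`off j + i * num j`. The faces other than the face `0` are relator faces, and no two adjacent ones
of them are mirror images of each other. -/
structure Net (len : ℕ → ℕ) (den num : ℕ → ℤ) where
  faces : Finset ℕ
  bdry : List (ℕ × ℕ)
  base : ℕ
  verts : Finset ℕ
  opp : ℕ × ℕ → ℕ × ℕ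
  src : ℕ × ℕ → ℕ
  lab : ℕ × ℕ → Fin 2 × Bool
  ty : ℕ → Fin 2
  off : ℕ → ℤ
  faceBound : ℕ
  vertBound : ℕ
  nodup : bdry.Nodup
  notMem : ∀ d ∈ bdry, d.1 ∉ faces
  live_opp : ∀ d, Live len faces bdry d → Live len faces bdry (opp d)
  opp_opp : ∀ d, Live len faces bdry d → opp (opp d) = d
  lab_opp : ∀ d, Live len faces bdry d → lab (opp d) = ((lab d).1, !(lab d).2)
  lab_face : ∀ j ∈ faces, ∀ i < len j,
    lab (j, i) = (typeAt (ty j) i, sgn (den j) (off j + i * num j))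
  src_face : ∀ j ∈ faces, ∀ i < len j, src (j, (i + 1) % len j) = src (opp (j, i))
  walk : Walk src (fun d => src (opp d)) base bdry base
  verts_src : ∀ v ∈ verts, v = base ∨ ∃ d, Live len faces bdry d ∧ src d = v
  count : ∑ j ∈ faces, len j + bdry.length + 2 ≤ 2 * verts.card + 2 * faces.card
  lt_faceBound : ∀ d, Live len faces bdry d → d.1 < faceBound
  face_lt : ∀ j ∈ faces, j < faceBound
  src_lt : ∀ d, Live len faces bdry d → src d < vertBound
  base_lt : base < vertBound
  not_mirror : ∀ d, d.1 ∈ faces → d.2 < len d.1 → d.1 ≠ 0 → (opp d).1 ∈ faces → (opp d).1 ≠ 0 →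
    ¬ 2 * den d.1 ∣ off d.1 + d.2 * num d.1 + (off (opp d).1 + (opp d).2 * num (opp d).1) + 1

namespace Net

variable {len : ℕ → ℕ} {den num : ℕ → ℤ}

/-- The element of the free group read along the boundary. -/
def word (X : Net len den num) : F := FreeGroup.mk (X.bdry.map X.lab)

/-- The net that consists of a single vertex. -/
def trivial (len : ℕ → ℕ) (den num : ℕ → ℤ) : Net len den num where
  faces := ∅
  bdry := []
  base := 0
  verts := {0}
  opp := id
  src := 0
  lab := fun _ => (0, true)
  ty := 0
  off := 0
  faceBound := 0
  vertBound := 1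
  nodup := by simp
  notMem := by simp
  live_opp := by simp [Live]
  opp_opp := by simp
  lab_opp := by simp [Live]
  lab_face := by simp
  src_face := by simp
  walk := rfl
  verts_src := by simp
  count := by simp
  lt_faceBound := by simp [Live]
  face_lt := by simp
  src_lt := by simp
  base_lt := by simp
  not_mirror := by simp

theorem word_trivial : (trivial len den num).word = 1 := rfl

variable (X : Net len den num)

theorem verts_lt (v : ℕ) (hv : v ∈ X.verts) : v < X.vertBound := by
  rcases X.verts_src v hv with rfl | ⟨d, hd, rfl⟩
  · exact X.base_lt
  · exact X.src_lt d hd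

theorem ne_of_live {d : ℕ × ℕ} (hd : Live len X.faces X.bdry d) (i : ℕ) : d ≠ (X.faceBound, i) :=
  fun h => absurd (X.lt_faceBound d hd) (by simp [h])

/-- Conjugation by a letter: a net with a tail. -/
def conj (l : Fin 2 × Bool) : Net len den num where
  faces := X.faces
  bdry := (X.faceBound, 0) :: (X.bdry ++ [(X.faceBound, 1)])
  base := X.vertBound
  verts := insert X.vertBound X.verts
  opp := fun d => if d = (X.faceBound, 0) then (X.faceBound, 1) else
    if d = (X.faceBound, 1) then (X.faceBound, 0) else X.opp d
  src := fun d => if d = (X.faceBound, 0) then X.vertBound else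
    if d = (X.faceBound, 1) then X.base else X.src d
  lab := fun d => if d = (X.faceBound, 0) then l else
    if d = (X.faceBound, 1) then (l.1, !l.2) else X.lab d
  ty := X.ty
  off := X.off
  faceBound := X.faceBound + 1
  vertBound := X.vertBound + 1
  nodup := by
    have h (i : ℕ) : (X.faceBound, i) ∉ X.bdry := fun h => X.ne_of_live (Or.inl h) i rfl
    simp only [List.nodup_cons, List.nodup_append, List.mem_append, h]
    simp only [List.mem_singleton, Prod.mk.injEq, X.nodup]
    simp only [true_and, zero_ne_one, List.nodup_nil, List.not_mem_nil, and_true]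
    refine ⟨by tauto, ⟨by tauto, ?_⟩⟩
    rintro a ha b rfl rfl
    exact h 1 ha
  notMem := by
    have h : X.faceBound ∉ X.faces := fun h => lt_irrefl _ (X.face_lt _ h)
    simp only [List.mem_cons, List.mem_append]
    rintro d (rfl | hd | hd | hd)
    · exact h
    · exact X.notMem d hd
    · rw [hd]; exact h
    · simp at hd
  live_opp := by
    intro d hd
    rw [live_tail] at hd ⊢
    by_cases h0 : d = (X.faceBound, 0)
    · simp [h0]
    by_cases h1 : d = (X.faceBound, 1)
    · simp [h1]
    simp only [h0, h1, if_false, or_false] at hd ⊢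
    exact Or.inl (X.live_opp d hd)
  opp_opp := by
    intro d hd
    rw [live_tail] at hd
    by_cases h0 : d = (X.faceBound, 0)
    · simp [h0]
    by_cases h1 : d = (X.faceBound, 1)
    · simp [h1]
    simp only [h0, h1, or_false] at hd
    simp [h0, h1, X.ne_of_live (X.live_opp d hd), X.opp_opp d hd]
  lab_opp := by
    intro d hd
    rw [live_tail] at hd
    by_cases h0 : d = (X.faceBound, 0)
    · simp [h0]
    by_cases h1 : d = (X.faceBound, 1)
    · simp [h1]
    simp only [h0, h1, or_false] at hd
    simp [h0, h1, X.ne_of_live (X.live_opp d hd), X.lab_opp d hd]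
  lab_face := by
    intro j hj i hi
    have hd : Live len X.faces X.bdry (j, i) := Or.inr ⟨hj, hi⟩
    simp only [X.ne_of_live hd, if_false]
    exact X.lab_face j hj i hi
  src_face := by
    intro j hj i hi
    have hd : Live len X.faces X.bdry (j, i) := Or.inr ⟨hj, hi⟩
    have hd' : Live len X.faces X.bdry (j, (i + 1) % len j) := Or.inr ⟨hj, Nat.mod_lt _ (by omega)⟩
    simp only [X.ne_of_live hd, X.ne_of_live hd', X.ne_of_live (X.live_opp _ hd), if_false]
    exact X.src_face j hj i hi
  walk := by
    refine ⟨by simp, ?_⟩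
    simp only [if_true, walk_append]
    refine ⟨X.base, ?_, by simp [Walk]⟩
    simp only [Prod.mk.injEq, one_ne_zero, and_false, if_false]
    refine X.walk.congr fun d hd => ?_
    have hd' : Live len X.faces X.bdry d := Or.inl hd
    simp [X.ne_of_live hd', X.ne_of_live (X.live_opp _ hd')]
  verts_src := by
    intro v hv
    rcases Finset.mem_insert.mp hv with rfl | hv
    · exact Or.inl rfl
    right
    rcases X.verts_src v hv with rfl | ⟨d, hd, rfl⟩
    · exact ⟨(X.faceBound, 1), by simp [Live], by simp⟩
    · exact ⟨d, by rw [live_tail]; exact Or.inl hd, by simp [X.ne_of_live hd]⟩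
  count := by
    have h := X.count
    rw [Finset.card_insert_of_notMem fun h => lt_irrefl _ (X.verts_lt _ h)]
    simp only [List.length_cons, List.length_append, List.length_nil]
    omega
  lt_faceBound := by
    intro d hd
    rw [live_tail] at hd
    rcases hd with hd | rfl | rfl
    · exact (X.lt_faceBound d hd).trans (Nat.lt_succ_self _)
    · exact Nat.lt_succ_self _
    · exact Nat.lt_succ_self _
  face_lt := fun j hj => (X.face_lt j hj).trans (Nat.lt_succ_self _)
  src_lt := by
    intro d hd
    rw [live_tail] at hd
    by_cases h0 : d = (X.faceBound, 0)
    · simp [h0]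
    by_cases h1 : d = (X.faceBound, 1)
    · simpa [h1] using X.base_lt.le
    simp only [h0, h1, or_false] at hd
    simpa [h0, h1] using (X.src_lt d hd).le
  base_lt := Nat.lt_succ_self _
  not_mirror := by
    intro d hd hd2
    have h : Live len X.faces X.bdry d := Or.inr ⟨hd, hd2⟩
    simp only [X.ne_of_live h, if_false]
    exact X.not_mirror d hd hd2

theorem word_conj (l : Fin 2 × Bool) :
    (X.conj l).word = FreeGroup.mk [l] * X.word * (FreeGroup.mk [l])⁻¹ := by
  have h : X.bdry.map (X.conj l).lab = X.bdry.map X.lab := List.map_congr_left fun d hd => by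
    have hd' : Live len X.faces X.bdry d := Or.inl hd
    simp [conj, X.ne_of_live hd']
  have h2 : (X.conj l).word = FreeGroup.mk
      ([l] ++ (X.bdry.map (X.conj l).lab ++ [(l.1, !l.2)])) := by
    simp [word, conj]
  rw [h2, h, word, FreeGroup.inv_mk, FreeGroup.mul_mk, FreeGroup.mul_mk]
  simp [FreeGroup.invRev]

theorem live_attach {len : ℕ → ℕ} {J : Finset ℕ} {B : List (ℕ × ℕ)} {f : ℕ} {d : ℕ × ℕ} :
    Live len (insert f J) (B ++ (List.range (len f)).map (Prod.mk (f + 1))) d ↔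
      Live len J B d ∨ d.1 = f ∧ d.2 < len f ∨ d.1 = f + 1 ∧ d.2 < len f := by
  obtain ⟨a, b⟩ := d
  have h : (a, b) ∈ (List.range (len f)).map (Prod.mk (f + 1)) ↔ a = f + 1 ∧ b < len f := by
    simp only [List.mem_map, List.mem_range, Prod.mk.injEq]
    constructor
    · rintro ⟨i, hi, rfl, rfl⟩
      exact ⟨rfl, hi⟩
    · rintro ⟨rfl, hb⟩
      exact ⟨b, hb, rfl, rfl⟩
  simp only [Live, List.mem_append, h, Finset.mem_insert]
  constructor
  · rintro ((h | h) | ⟨rfl | h, h'⟩) <;> tauto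
  · rintro ((h | h) | ⟨rfl, h⟩ | h) <;> tauto

theorem live_cases {f : ℕ} {d : ℕ × ℕ} (hf : X.faceBound = f)
    (h : Live len X.faces X.bdry d ∨ d.1 = f ∧ d.2 < len f ∨ d.1 = f + 1 ∧ d.2 < len f) :
    (Live len X.faces X.bdry d ∧ d.1 ≠ f ∧ d.1 ≠ f + 1) ∨ (∃ i < len f, d = (f, i)) ∨
      ∃ i < len f, d = (f + 1, i) := by
  rcases h with h | ⟨h, h'⟩ | ⟨h, h'⟩
  · have := X.lt_faceBound d h
    exact Or.inl ⟨h, by omega, by omega⟩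
  · exact Or.inr (Or.inl ⟨_, h', by rw [← h]⟩)
  · exact Or.inr (Or.inr ⟨_, h', by rw [← h]⟩)

/-- A further face is attached at the base vertex. -/
def attach (g : Fin 2) (c : ℤ) (f : ℕ) (hf : X.faceBound = f) (hlen : 0 < len f)
    (hden : 0 < den f) : Net len den num where
  faces := insert f X.faces
  bdry := X.bdry ++ (List.range (len f)).map (Prod.mk (f + 1))
  base := X.base
  verts := X.verts ∪ Finset.Ioo X.vertBound (X.vertBound + len f)
  opp := fun d => if d.1 = f then (f + 1, len f - 1 - d.2) else
    if d.1 = f + 1 then (f, len f - 1 - d.2) else X.opp d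
  src := fun d => if d.1 = f then
      (if d.2 = 0 ∨ d.2 = len f then X.base else X.vertBound + (len f - d.2)) else
    if d.1 = f + 1 then (if d.2 = 0 ∨ d.2 = len f then X.base else X.vertBound + d.2) else X.src d
  lab := fun d => if d.1 = f then
      (typeAt g (len f - 1 - d.2), !sgn (den f) (c + (len f - 1 - d.2 : ℕ) * num f)) else
    if d.1 = f + 1 then (typeAt g d.2, sgn (den f) (c + d.2 * num f)) else X.lab d
  ty := fun j => if j = f then typeAt g (len f - 1) else X.ty j
  off := fun j => if j = f then -1 - (c + (len f - 1 : ℕ) * num f) else X.off j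
  faceBound := f + 2
  vertBound := X.vertBound + len f
  nodup := by
    refine List.Nodup.append X.nodup (List.nodup_range.map fun a b h => (Prod.ext_iff.mp h).2) ?_
    intro d hd hd'
    have h := X.lt_faceBound d (Or.inl hd)
    simp only [List.mem_map] at hd'
    obtain ⟨i, -, rfl⟩ := hd'
    simp only at h
    omega
  notMem := by
    intro d hd
    simp only [List.mem_append, List.mem_map] at hd
    rw [Finset.mem_insert]
    rintro (h | h)
    · rcases hd with hd | ⟨i, -, rfl⟩
      · have := X.lt_faceBound d (Or.inl hd)
        omega
      · simp at h
    · rcases hd with hd | ⟨i, -, rfl⟩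
      · exact X.notMem d hd h
      · have := X.face_lt _ h
        simp only at this
        omega
  live_opp := by
    intro d hd
    rw [live_attach] at hd ⊢
    rcases X.live_cases hf hd with ⟨h, h1, h2⟩ | ⟨i, hi, rfl⟩ | ⟨i, hi, rfl⟩
    · simp only [h1, h2, if_false]
      exact Or.inl (X.live_opp d h)
    · right; right
      simp only [if_true, true_and]
      omega
    · right; left
      simp only [Nat.succ_ne_self, if_false, if_true, true_and]
      omega
  opp_opp := by
    intro d hd
    rw [live_attach] at hd
    rcases X.live_cases hf hd with ⟨h, h1, h2⟩ | ⟨i, hi, rfl⟩ | ⟨i, hi, rfl⟩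
    · have := X.lt_faceBound _ (X.live_opp d h)
      have h3 : (X.opp d).1 ≠ f := by omega
      have h4 : (X.opp d).1 ≠ f + 1 := by omega
      simp only [h1, h2, h3, h4, if_false, X.opp_opp d h]
    · simp only [if_true, Nat.succ_ne_self, if_false, Prod.mk.injEq, true_and]
      omega
    · simp only [if_true, Nat.succ_ne_self, if_false, Prod.mk.injEq, true_and]
      omega
  lab_opp := by
    intro d hd
    rw [live_attach] at hd
    rcases X.live_cases hf hd with ⟨h, h1, h2⟩ | ⟨i, hi, rfl⟩ | ⟨i, hi, rfl⟩
    · have := X.lt_faceBound _ (X.live_opp d h)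
      have h3 : (X.opp d).1 ≠ f := by omega
      have h4 : (X.opp d).1 ≠ f + 1 := by omega
      simp only [h1, h2, h3, h4, if_false, X.lab_opp d h]
    · simp
    · have h3 : len f - 1 - (len f - 1 - i) = i := by omega
      simp [h3]
  lab_face := by
    intro j hj i hi
    by_cases h : j = f
    · subst h
      simp only [if_true]
      obtain ⟨k, hk⟩ := Nat.exists_eq_add_of_lt hi
      have h1 : len j - 1 - i = k := by omega
      have h2 : len j - 1 = k + i := by omega
      rw [h1, h2]
      refine Prod.ext ?_ ?_
      · have h2 (x : Fin 2) : x + x = 0 := by revert x; decide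
        simp only [typeAt, add_nsmul]
        rw [show g + (k • (1 : Fin 2) + i • 1) + i • 1 =
            g + k • 1 + (i • (1 : Fin 2) + i • 1) by abel,
          h2, add_zero]
      · simp only
        rw [← sgn_mirror _ _ hden]
        congr 1
        push_cast
        ring
    · have hj' := Finset.mem_of_mem_insert_of_ne hj h
      have := X.face_lt j hj'
      have h' : j ≠ f + 1 := by omega
      simp only [h, h', if_false]
      exact X.lab_face j hj' i hi
  src_face := by
    intro j hj i hi
    by_cases h : j = f
    · subst h
      simp only [if_true, Nat.succ_ne_self, if_false]
      rcases Nat.lt_or_ge (i + 1) (len j) with h | h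
      · rw [Nat.mod_eq_of_lt h]
        have h1 : ¬ (i + 1 = 0 ∨ i + 1 = len j) := by omega
        have h2 : ¬ (len j - 1 - i = 0 ∨ len j - 1 - i = len j) := by omega
        rw [if_neg h1, if_neg h2]
        omega
      · have h1 : i + 1 = len j := by omega
        have h2 : len j - 1 - i = 0 := by omega
        simp [h1, h2]
    · have hj' := Finset.mem_of_mem_insert_of_ne hj h
      have := X.face_lt j hj'
      have h' : j ≠ f + 1 := by omega
      have := X.lt_faceBound _ (X.live_opp (j, i) (Or.inr ⟨hj', hi⟩))
      have h3 : (X.opp (j, i)).1 ≠ f := by omega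
      have h4 : (X.opp (j, i)).1 ≠ f + 1 := by omega
      simp only [h, h', h3, h4, if_false]
      exact X.src_face j hj' i hi
  walk := by
    rw [walk_append]
    refine ⟨X.base, X.walk.congr fun d hd => ?_, ?_⟩
    · have h1 := X.lt_faceBound d (Or.inl hd)
      have h2 := X.lt_faceBound _ (X.live_opp d (Or.inl hd))
      have h3 : d.1 ≠ f := by omega
      have h4 : d.1 ≠ f + 1 := by omega
      have h5 : (X.opp d).1 ≠ f := by omega
      have h6 : (X.opp d).1 ≠ f + 1 := by omega
      simp only [h3, h4, h5, h6, if_false, and_self]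
    · have key : ∀ k ≤ len f, Walk
          (fun d => if d.1 = f then
            (if d.2 = 0 ∨ d.2 = len f then X.base else X.vertBound + (len f - d.2)) else
            if d.1 = f + 1 then (if d.2 = 0 ∨ d.2 = len f then X.base else X.vertBound + d.2)
            else X.src d)
          (fun d => if d.1 = f then (0 : ℕ) else
            if d.2 + 1 = len f then X.base else X.vertBound + (d.2 + 1))
          X.base ((List.range k).map (Prod.mk (f + 1)))
          (if k = 0 ∨ k = len f then X.base else X.vertBound + k) := by
        intro k
        induction k with
        | zero => intro; simp [Walk]
        | succ k ih =>
          intro hk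
          rw [List.range_succ, List.map_append, walk_append]
          refine ⟨_, ih (by omega), ?_⟩
          simp [Walk]
      have h := key (len f) le_rfl
      simp only [or_true, if_true] at h
      refine h.congr fun d hd => ⟨rfl, ?_⟩
      simp only [List.mem_map, List.mem_range] at hd
      obtain ⟨i, hi, rfl⟩ := hd
      simp only [Nat.succ_ne_self, if_false, if_true]
      by_cases h1 : i + 1 = len f
      · have h2 : len f - 1 - i = 0 := by omega
        simp [h1, h2]
      · have h2 : ¬ (len f - 1 - i = 0 ∨ len f - 1 - i = len f) := by omega
        rw [if_neg h1, if_neg h2]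
        omega
  verts_src := by
    intro v hv
    rcases Finset.mem_union.mp hv with hv | hv
    · rcases X.verts_src v hv with rfl | ⟨d, hd, rfl⟩
      · exact Or.inl rfl
      · have := X.lt_faceBound d hd
        have h3 : d.1 ≠ f := by omega
        have h4 : d.1 ≠ f + 1 := by omega
        exact Or.inr ⟨d, live_attach.mpr (Or.inl hd), by simp only [h3, h4, if_false]⟩
    · rw [Finset.mem_Ioo] at hv
      refine Or.inr ⟨(f + 1, v - X.vertBound),
        live_attach.mpr (Or.inr (Or.inr ⟨rfl, by simp only; omega⟩)), ?_⟩
      have h2 : ¬ (v - X.vertBound = 0 ∨ v - X.vertBound = len f) := by omega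
      simp only [Nat.succ_ne_self, if_false, if_true, h2]
      omega
  count := by
    have h := X.count
    have h1 : f ∉ X.faces := fun h => absurd (X.face_lt f h) (by omega)
    have h2 : Disjoint X.verts (Finset.Ioo X.vertBound (X.vertBound + len f)) := by
      rw [Finset.disjoint_left]
      intro v hv hv'
      have := X.verts_lt v hv
      rw [Finset.mem_Ioo] at hv'
      omega
    rw [Finset.sum_insert h1, Finset.card_insert_of_notMem h1, Finset.card_union_of_disjoint h2]
    simp only [List.length_append, List.length_map, List.length_range, Nat.card_Ioo]
    omega
  lt_faceBound := by
    intro d hd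
    rw [live_attach] at hd
    rcases hd with h | h | h
    · have := X.lt_faceBound d h
      omega
    · omega
    · omega
  face_lt := by
    intro j hj
    rcases Finset.mem_insert.mp hj with rfl | hj
    · omega
    · have := X.face_lt j hj
      omega
  src_lt := by
    intro d hd
    rw [live_attach] at hd
    have hb := X.base_lt
    rcases X.live_cases hf hd with ⟨h, h1, h2⟩ | ⟨i, hi, rfl⟩ | ⟨i, hi, rfl⟩
    · simp only [h1, h2, if_false]
      have := X.src_lt d h
      omega
    · simp only [if_true]
      split_ifs <;> omega
    · simp only [Nat.succ_ne_self, if_false, if_true]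
      split_ifs <;> omega
  base_lt := X.base_lt.trans_le (Nat.le_add_right _ _)
  not_mirror := by
    intro d hd hd2
    have h : Live len X.faces X.bdry d ∨ d.1 = f ∧ d.2 < len f ∨ d.1 = f + 1 ∧ d.2 < len f := by
      rcases Finset.mem_insert.mp hd with h | h
      · exact Or.inr (Or.inl ⟨h, h ▸ hd2⟩)
      · exact Or.inl (Or.inr ⟨h, hd2⟩)
    rcases X.live_cases hf h with ⟨h, h1, h2⟩ | ⟨i, hi, rfl⟩ | ⟨i, hi, rfl⟩
    · have := X.lt_faceBound _ (X.live_opp d h)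
      have h3 : (X.opp d).1 ≠ f := by omega
      simp only [h1, h2, h3, if_false, Finset.mem_insert, false_or]
      exact X.not_mirror d (Finset.mem_of_mem_insert_of_ne hd h1) hd2
    · intro _ h1
      simp only [if_true, Finset.mem_insert, Nat.succ_ne_self, false_or] at h1
      have := X.face_lt _ h1
      omega
    · simp only [Finset.mem_insert, Nat.succ_ne_self, false_or] at hd
      have := X.face_lt _ hd
      omega

theorem word_attach (g : Fin 2) (c : ℤ) (f : ℕ) (hf : X.faceBound = f) (hlen : 0 < len f)
    (hden : 0 < den f) : (X.attach g c f hf hlen hden).word =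
      X.word * stripF (den f) (num f) (len f) g c := by
  have h : X.bdry.map (X.attach g c f hf hlen hden).lab = X.bdry.map X.lab :=
    List.map_congr_left fun d hd => by
      have := X.lt_faceBound d (Or.inl hd)
      have h3 : d.1 ≠ f := by omega
      have h4 : d.1 ≠ f + 1 := by omega
      simp only [attach, h3, h4, if_false]
  have h2 : (X.attach g c f hf hlen hden).word = FreeGroup.mk
      (X.bdry.map (X.attach g c f hf hlen hden).lab ++ strip (den f) (num f) (len f) g c) := by
    rw [strip_eq_map_range]
    simp only [word, attach, List.map_append, List.map_map]
    congr 2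
    refine List.map_congr_left fun i _ => ?_
    simp
  rw [h2, h, word, stripF, FreeGroup.mul_mk]

/-- The phase of a dart of a face. -/
def phase (d : ℕ × ℕ) : ℤ := X.off d.1 + d.2 * num d.1

theorem opp_ne {d : ℕ × ℕ} (hd : Live len X.faces X.bdry d) : X.opp d ≠ d := fun h => by
  have := X.lab_opp d hd
  rw [h] at this
  have := (Prod.ext_iff.mp this).2
  simp at this

theorem live_remove {P Q : List (ℕ × ℕ)} {x y : ℕ × ℕ} (h : X.bdry = P ++ x :: y :: Q)
    (d : ℕ × ℕ) : Live len X.faces (P ++ Q) d ↔ Live len X.faces X.bdry d ∧ d ≠ x ∧ d ≠ y := by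
  have h1 := X.nodup
  have hx := X.notMem x (by simp [h])
  have hy := X.notMem y (by simp [h])
  have h2 : d ∈ P ++ Q → d ≠ x ∧ d ≠ y := by
    rw [h, List.nodup_append] at h1
    obtain ⟨-, h3, h4⟩ := h1
    simp only [List.nodup_cons, List.mem_cons, not_or] at h3
    intro hd
    rcases List.mem_append.mp hd with hd | hd
    · exact ⟨h4 d hd x (by simp), h4 d hd y (by simp)⟩
    · constructor <;> rintro rfl <;> tauto
  have h3 : d.1 ∈ X.faces → d ≠ x ∧ d ≠ y := fun hd =>
    ⟨by rintro rfl; exact hx hd, by rintro rfl; exact hy hd⟩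
  simp only [Live, h, List.mem_append, List.mem_cons] at h2 ⊢
  tauto

theorem walk_split {P Q : List (ℕ × ℕ)} {x y : ℕ × ℕ} (h : X.bdry = P ++ x :: y :: Q) :
    Walk X.src (fun d => X.src (X.opp d)) X.base P (X.src x) ∧ X.src y = X.src (X.opp x) ∧
      Walk X.src (fun d => X.src (X.opp d)) (X.src (X.opp y)) Q X.base := by
  have hw := X.walk
  rw [h, walk_append] at hw
  obtain ⟨w, h1, rfl, h2, h3⟩ := hw
  exact ⟨h1, h2, h3⟩

/-- Two adjacent boundary darts that are opposite to each other are removed. -/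
def spike {P Q : List (ℕ × ℕ)} {x y : ℕ × ℕ} (h : X.bdry = P ++ x :: y :: Q)
    (hxy : X.opp x = y) : Net len den num where
  faces := X.faces
  bdry := P ++ Q
  base := X.base
  verts := X.verts.erase (X.src y)
  opp := X.opp
  src := X.src
  lab := X.lab
  ty := X.ty
  off := X.off
  faceBound := X.faceBound
  vertBound := X.vertBound
  nodup := by
    have h1 := X.nodup
    rw [h] at h1
    exact h1.sublist ((List.Sublist.refl P).append ((List.sublist_cons_self y Q).cons x))
  notMem := fun d hd => X.notMem d (by
    simp only [h, List.mem_append, List.mem_cons] at hd ⊢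
    tauto)
  live_opp := by
    intro d hd
    rw [X.live_remove h] at hd ⊢
    refine ⟨X.live_opp d hd.1, fun h1 => hd.2.2 ?_, fun h1 => hd.2.1 ?_⟩
    · rw [← hxy, ← h1, X.opp_opp d hd.1]
    · rw [← X.opp_opp d hd.1, h1, ← hxy, X.opp_opp x (Or.inl (by simp [h]))]
  opp_opp := fun d hd => X.opp_opp d ((X.live_remove h d).mp hd).1
  lab_opp := fun d hd => X.lab_opp d ((X.live_remove h d).mp hd).1
  lab_face := X.lab_face
  src_face := X.src_face
  walk := by
    obtain ⟨h1, -, h3⟩ := X.walk_split h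
    rw [← hxy, X.opp_opp x (Or.inl (by simp [h]))] at h3
    exact walk_append.mpr ⟨_, h1, h3⟩
  verts_src := by
    intro v hv
    rw [Finset.mem_erase] at hv
    rcases X.verts_src v hv.2 with h1 | ⟨d, hd, rfl⟩
    · exact Or.inl h1
    by_cases hdx : d = x
    · subst hdx
      obtain ⟨-, h2, h3⟩ := X.walk_split h
      rw [← hxy, X.opp_opp d (Or.inl (by simp [h]))] at h3
      cases Q with
      | nil => exact Or.inl h3
      | cons z Q => exact Or.inr ⟨z, Or.inl (by simp), h3.1⟩
    · refine Or.inr ⟨d, (X.live_remove h d).mpr ⟨hd, hdx, ?_⟩, rfl⟩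
      rintro rfl
      exact hv.1 rfl
  count := by
    have h1 := X.count
    have h2 := Finset.pred_card_le_card_erase (s := X.verts) (a := X.src y)
    simp only [h, List.length_append, List.length_cons] at h1 ⊢
    omega
  lt_faceBound := fun d hd => X.lt_faceBound d ((X.live_remove h d).mp hd).1
  face_lt := X.face_lt
  src_lt := fun d hd => X.src_lt d ((X.live_remove h d).mp hd).1
  base_lt := X.base_lt
  not_mirror := X.not_mirror

/-- Two adjacent boundary darts with inverse labels are identified. -/
def fold {P Q : List (ℕ × ℕ)} {x y : ℕ × ℕ} (h : X.bdry = P ++ x :: y :: Q)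
    (hlab : X.lab y = ((X.lab x).1, !(X.lab x).2)) (hxy : X.opp x ≠ y)
    (hm : (X.opp x).1 ∈ X.faces → (X.opp x).1 ≠ 0 → (X.opp y).1 ∈ X.faces → (X.opp y).1 ≠ 0 →
      den (X.opp x).1 = den (X.opp y).1 ∧
      ¬ 2 * den (X.opp x).1 ∣ X.phase (X.opp x) + X.phase (X.opp y) + 1) : Net len den num :=
  have hx : Live len X.faces X.bdry x := Or.inl (by simp [h])
  have hy : Live len X.faces X.bdry y := Or.inl (by simp [h])
  have hxx : X.opp x ≠ x := X.opp_ne hx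
  have hyy : X.opp y ≠ y := X.opp_ne hy
  have hox : X.opp (X.opp x) = x := X.opp_opp x hx
  have hoy : X.opp (X.opp y) = y := X.opp_opp y hy
  have hyx : X.opp y ≠ x := fun h1 => hxy (by rw [← h1, hoy])
  have hne : x ≠ y := fun h1 => by
    have h2 := X.nodup
    rw [h, h1] at h2
    simp [List.nodup_append] at h2
  have hee : X.opp x ≠ X.opp y := fun h1 => hne (by rw [← hox, h1, hoy])
  have hφ (d) (_ : Live len X.faces (P ++ Q) d) :
      (fun v => if v = X.src (X.opp y) then X.src x else v)
      (X.src (if d = X.opp x then X.opp y else if d = X.opp y then X.opp x else X.opp d)) =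
      (fun v => if v = X.src (X.opp y) then X.src x else v) (X.src (X.opp d)) := by
    by_cases h1 : d = X.opp x
    · simp [h1, hox]
    by_cases h2 : d = X.opp y
    · simp [h2, hoy, hee.symm, (X.walk_split h).2.1]
    simp [h1, h2]
  { faces := X.faces
    bdry := P ++ Q
    base := if X.base = X.src (X.opp y) then X.src x else X.base
    verts := X.verts.image fun v => if v = X.src (X.opp y) then X.src x else v
    opp := fun d => if d = X.opp x then X.opp y else if d = X.opp y then X.opp x else X.opp d
    src := fun d => (fun v => if v = X.src (X.opp y) then X.src x else v) (X.src d)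
    lab := X.lab
    ty := X.ty
    off := X.off
    faceBound := X.faceBound
    vertBound := X.vertBound
    nodup := by
      have h1 := X.nodup
      rw [h] at h1
      exact h1.sublist ((List.Sublist.refl P).append ((List.sublist_cons_self y Q).cons x))
    notMem := fun d hd => X.notMem d (by
      simp only [h, List.mem_append, List.mem_cons] at hd ⊢
      tauto)
    live_opp := by
      intro d hd
      rw [X.live_remove h] at hd ⊢
      split_ifs with h1 h2
      · exact ⟨X.live_opp y hy, hyx, hyy⟩
      · exact ⟨X.live_opp x hx, hxx, hxy⟩
      · refine ⟨X.live_opp d hd.1, fun h3 => h1 ?_, fun h3 => h2 ?_⟩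
        · rw [← h3, X.opp_opp d hd.1]
        · rw [← h3, X.opp_opp d hd.1]
    opp_opp := by
      intro d hd
      rw [X.live_remove h] at hd
      by_cases h1 : d = X.opp x
      · simp [h1, hee.symm]
      by_cases h2 : d = X.opp y
      · simp [h2, hee.symm]
      have h3 : X.opp d ≠ X.opp x := fun h3 => hd.2.1 (by rw [← hox, ← h3, X.opp_opp d hd.1])
      have h4 : X.opp d ≠ X.opp y := fun h3 => hd.2.2 (by rw [← hoy, ← h3, X.opp_opp d hd.1])
      simp [h1, h2, h3, h4, X.opp_opp d hd.1]
    lab_opp := by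
      intro d hd
      rw [X.live_remove h] at hd
      by_cases h1 : d = X.opp x
      · simp [h1, X.lab_opp x hx, X.lab_opp y hy, hlab]
      by_cases h2 : d = X.opp y
      · simp [h2, hee.symm, X.lab_opp x hx, X.lab_opp y hy, hlab]
      simp [h1, h2, X.lab_opp d hd.1]
    lab_face := X.lab_face
    src_face := fun j hj i hi => by
      rw [X.src_face j hj i hi, hφ (j, i) (Or.inr ⟨hj, hi⟩)]
    walk := by
      obtain ⟨h1, -, h3⟩ := X.walk_split h
      refine walk_append.mpr ⟨_, h1.map (fun v => if v = X.src (X.opp y) then X.src x else v)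
        fun d hd => ⟨rfl, hφ d (Or.inl (by simp [hd]))⟩, ?_⟩
      have h4 := h3.map (fun v => if v = X.src (X.opp y) then X.src x else v)
        fun d hd => ⟨rfl, hφ d (Or.inl (by simp [hd]))⟩
      simpa using h4
    verts_src := by
      intro v hv
      obtain ⟨w, hw, rfl⟩ := Finset.mem_image.mp hv
      rcases X.verts_src w hw with rfl | ⟨d, hd, rfl⟩
      · exact Or.inl rfl
      right
      by_cases hdx : d = x
      · subst hdx
        exact ⟨X.opp y, (X.live_remove h _).mpr ⟨X.live_opp y hy, hyx, hyy⟩, by simp⟩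
      by_cases hdy : d = y
      · subst hdy
        exact ⟨X.opp x, (X.live_remove h _).mpr ⟨X.live_opp x hx, hxx, hxy⟩,
          by simp [(X.walk_split h).2.1]⟩
      exact ⟨d, (X.live_remove h d).mpr ⟨hd, hdx, hdy⟩, rfl⟩
    count := by
      have h1 := X.count
      have h2 := Finset.pred_card_le_card_erase (s := X.verts) (a := X.src (X.opp y))
      have h3 : X.verts.erase (X.src (X.opp y)) ⊆
          X.verts.image fun v => if v = X.src (X.opp y) then X.src x else v := by
        intro v hv
        rw [Finset.mem_erase] at hv
        exact Finset.mem_image.mpr ⟨v, hv.2, by simp [hv.1]⟩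
      have h4 := Finset.card_le_card h3
      simp only [h, List.length_append, List.length_cons] at h1 ⊢
      omega
    lt_faceBound := fun d hd => X.lt_faceBound d ((X.live_remove h d).mp hd).1
    face_lt := X.face_lt
    src_lt := by
      intro d hd
      simp only
      split_ifs
      · exact X.src_lt x hx
      · exact X.src_lt d ((X.live_remove h d).mp hd).1
    base_lt := by
      split_ifs
      · exact X.src_lt x hx
      · exact X.base_lt
    not_mirror := by
      intro d h1 h2 h3
      by_cases hd : d = X.opp x
      · subst hd
        simp only [if_true]
        exact fun h4 h5 => (hm h1 h3 h4 h5).2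
      by_cases hd' : d = X.opp y
      · subst hd'
        simp only [hee.symm, if_true, if_false]
        intro h4 h5
        obtain ⟨h6, h7⟩ := hm h4 h5 h1 h3
        rw [← h6]
        rwa [add_comm (X.phase _)] at h7
      simp only [hd, hd', if_false]
      exact X.not_mirror d h1 h2 h3 }

theorem mk_append_cancel {P Q : List (Fin 2 × Bool)} {a : Fin 2 × Bool} :
    (FreeGroup.mk (P ++ a :: (a.1, !a.2) :: Q) : F) = FreeGroup.mk (P ++ Q) :=
  Quot.sound FreeGroup.Red.Step.not

theorem mk_bdry {P Q : List (ℕ × ℕ)} {x y : ℕ × ℕ} (h : X.bdry = P ++ x :: y :: Q)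
    (hlab : X.lab y = ((X.lab x).1, !(X.lab x).2)) :
    X.word = FreeGroup.mk ((P ++ Q).map X.lab) := by
  rw [word, h, List.map_append, List.map_cons, List.map_cons, hlab, mk_append_cancel,
    List.map_append]

/-- The darts of the face of `d` other than `d`, in cyclic order. -/
def rest (len : ℕ → ℕ) (d : ℕ × ℕ) : List (ℕ × ℕ) :=
  (List.range (len d.1 - 1)).map fun t => (d.1, (d.2 + 1 + t) % len d.1)

theorem nodup_rest (d : ℕ × ℕ) : (rest len d).Nodup := by
  refine List.Nodup.map_on ?_ List.nodup_range
  intro a ha b hb hab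
  rw [List.mem_range] at ha hb
  have h : (d.2 + 1 + a) ≡ (d.2 + 1 + b) [MOD len d.1] := (Prod.ext_iff.mp hab).2
  have h2 := Nat.ModEq.add_left_cancel' _ h
  rwa [Nat.ModEq, Nat.mod_eq_of_lt (by omega), Nat.mod_eq_of_lt (by omega)] at h2

theorem mem_rest {d e : ℕ × ℕ} (hd : d.2 < len d.1) :
    e ∈ rest len d ↔ e.1 = d.1 ∧ e.2 < len d.1 ∧ e ≠ d := by
  obtain ⟨j, i⟩ := d
  obtain ⟨a, b⟩ := e
  simp only at hd
  simp only [rest, List.mem_map, List.mem_range, Prod.mk.injEq, ne_eq, not_and]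
  constructor
  · rintro ⟨t, ht, rfl, rfl⟩
    refine ⟨rfl, Nat.mod_lt _ (by omega), fun _ h => ?_⟩
    have h1 : i + (1 + t) ≡ i + 0 [MOD len j] := by
      rw [Nat.ModEq, add_zero, Nat.mod_eq_of_lt hd, ← add_assoc, h]
    have h2 := Nat.ModEq.add_left_cancel' _ h1
    rw [Nat.ModEq, Nat.mod_eq_of_lt (by omega), Nat.mod_eq_of_lt (by omega)] at h2
    omega
  · rintro ⟨rfl, hb, hne⟩
    have := hne rfl
    rcases Nat.lt_or_ge i b with h | h
    · exact ⟨b - (i + 1), by omega, rfl, by rw [Nat.mod_eq_of_lt (by omega)]; omega⟩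
    · refine ⟨b + len a - (i + 1), by omega, rfl, ?_⟩
      rw [show i + 1 + (b + len a - (i + 1)) = b + len a by omega, Nat.add_mod_right,
        Nat.mod_eq_of_lt hb]

theorem walk_rest {d : ℕ × ℕ} (hd : d.1 ∈ X.faces) (hd' : d.2 < len d.1) :
    Walk X.src (fun d => X.src (X.opp d)) (X.src (X.opp d)) (rest len d) (X.src d) := by
  obtain ⟨j, i⟩ := d
  simp only at hd hd'
  have key : ∀ m, Walk X.src (fun d => X.src (X.opp d)) (X.src (j, (i + 1) % len j))
      ((List.range m).map fun t => (j, (i + 1 + t) % len j)) (X.src (j, (i + 1 + m) % len j)) := by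
    intro m
    induction m with
    | zero => exact rfl
    | succ m ih =>
      rw [List.range_succ, List.map_append, walk_append]
      refine ⟨_, ih, rfl, ?_⟩
      have h := X.src_face j hd ((i + 1 + m) % len j) (Nat.mod_lt _ (by omega))
      rw [Nat.mod_add_mod] at h
      exact h.symm
  have h := key (len j - 1)
  rwa [X.src_face j hd i hd', show i + 1 + (len j - 1) = i + len j by omega, Nat.add_mod_right,
    Nat.mod_eq_of_lt hd'] at h

theorem map_lab_rest {d : ℕ × ℕ} (hd : d.1 ∈ X.faces) (hd' : d.2 < len d.1) (hden : 0 < den d.1)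
    (h2 : Even (len d.1)) (hdvd : 2 * den d.1 ∣ (len d.1 : ℤ)) :
    (rest len d).map X.lab =
      strip (den d.1) (num d.1) (len d.1 - 1) ((X.lab d).1 + 1) (X.phase d + num d.1) := by
  obtain ⟨j, i⟩ := d
  simp only [phase] at hd hd' hden h2 hdvd ⊢
  rw [strip_eq_map_range, rest, List.map_map]
  refine List.map_congr_left fun t ht => ?_
  rw [X.lab_face j hd i hd', Function.comp_apply, X.lab_face j hd _ (Nat.mod_lt _ (by omega))]
  have e := Nat.mod_add_div (i + 1 + t) (len j)
  generalize (i + 1 + t) % len j = a at e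
  generalize (i + 1 + t) / len j = b at e
  refine Prod.ext ?_ ?_
  · simp only
    rw [← typeAt_succ, typeAt, typeAt, typeAt, add_assoc, ← add_nsmul, ← e]
    obtain ⟨k, hk⟩ := h2
    rw [hk, show a + (k + k) * b = a + 2 * (k * b) by ring, add_nsmul, mul_nsmul,
      show 2 • (1 : Fin 2) = 0 from rfl]
    simp
  · simp only
    obtain ⟨k, hk⟩ := hdvd
    have e' : (a : ℤ) + len j * b = i + 1 + t := by exact_mod_cast e
    rw [← sgn_add _ _ hden (k * b * num j), show X.off j + a * num j + 2 * den j * (k * b * num j) =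
      X.off j + (a + (2 * den j * k) * b) * num j by ring, ← hk, e']
    congr 1
    ring

theorem live_merge {P Q : List (ℕ × ℕ)} {x y : ℕ × ℕ} (h : X.bdry = P ++ x :: y :: Q)
    (hx : (X.opp x).1 ∈ X.faces) (hy : (X.opp y).1 ∈ X.faces)
    (hne : (X.opp x).1 ≠ (X.opp y).1) (d : ℕ × ℕ) :
    Live len ((X.faces.erase (X.opp x).1).erase (X.opp y).1)
      (P ++ (rest len (X.opp x) ++ (rest len (X.opp y) ++ Q))) d ↔
    Live len X.faces X.bdry d ∧ (d ≠ x ∧ d ≠ y) ∧ d ≠ X.opp x ∧ d ≠ X.opp y := by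
  have hx' : (X.opp x).2 < len (X.opp x).1 :=
    ((X.live_opp x (Or.inl (by simp [h]))).resolve_left fun h1 => X.notMem _ h1 hx).2
  have hy' : (X.opp y).2 < len (X.opp y).1 :=
    ((X.live_opp y (Or.inl (by simp [h]))).resolve_left fun h1 => X.notMem _ h1 hy).2
  rw [← and_assoc, ← X.live_remove h]
  have h1 : d ∈ P ++ Q → d.1 ∉ X.faces := fun hd => X.notMem d (by
    simp only [h, List.mem_append, List.mem_cons] at hd ⊢
    tauto)
  have h2 : d = X.opp x → d.1 = (X.opp x).1 := fun h => by rw [h]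
  have h3 : d = X.opp y → d.1 = (X.opp y).1 := fun h => by rw [h]
  have h4 : d.1 = (X.opp x).1 → d.1 ∈ X.faces ∧ (d.2 < len d.1 ↔ d.2 < len (X.opp x).1) :=
    fun h => by rw [h]; exact ⟨hx, Iff.rfl⟩
  have h5 : d.1 = (X.opp y).1 → d.1 ∈ X.faces ∧ (d.2 < len d.1 ↔ d.2 < len (X.opp y).1) :=
    fun h => by rw [h]; exact ⟨hy, Iff.rfl⟩
  have h6 : d.1 = (X.opp x).1 → d.1 ≠ (X.opp y).1 := fun h => by rw [h]; exact hne
  simp only [Live, List.mem_append, mem_rest hx', mem_rest hy', Finset.mem_erase, ne_eq] at h1 ⊢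
  tauto

/-- Two faces at adjacent boundary darts are merged with the exterior. -/
def merge {P Q : List (ℕ × ℕ)} {x y : ℕ × ℕ} (h : X.bdry = P ++ x :: y :: Q)
    (hx : (X.opp x).1 ∈ X.faces) (hy : (X.opp y).1 ∈ X.faces)
    (hne : (X.opp x).1 ≠ (X.opp y).1) (hlx : 2 ≤ len (X.opp x).1) (hly : 2 ≤ len (X.opp y).1) :
    Net len den num :=
  have hlive := X.live_merge h hx hy hne
  have hLx : Live len X.faces X.bdry x := Or.inl (by simp [h])
  have hLy : Live len X.faces X.bdry y := Or.inl (by simp [h])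
  have hx' : (X.opp x).2 < len (X.opp x).1 :=
    ((X.live_opp x hLx).resolve_left fun h1 => X.notMem _ h1 hx).2
  have hy' : (X.opp y).2 < len (X.opp y).1 :=
    ((X.live_opp y hLy).resolve_left fun h1 => X.notMem _ h1 hy).2
  have hnxt {d : ℕ × ℕ} (hd : d.1 ∈ X.faces) (hd' : d.2 < len d.1) (hl : 2 ≤ len d.1) :
      ∃ e ∈ rest len d, X.src e = X.src (X.opp d) := by
    refine ⟨(d.1, (d.2 + 1) % len d.1), (mem_rest hd').mpr ⟨rfl, Nat.mod_lt _ (by omega), fun h1 =>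
      ?_⟩, X.src_face d.1 hd d.2 hd'⟩
    have h2 : (d.2 + 1) % len d.1 = d.2 := congrArg Prod.snd h1
    rcases Nat.lt_or_ge (d.2 + 1) (len d.1) with h3 | h3
    · rw [Nat.mod_eq_of_lt h3] at h2
      omega
    · rw [show d.2 + 1 = len d.1 by omega, Nat.mod_self] at h2
      omega
  { faces := (X.faces.erase (X.opp x).1).erase (X.opp y).1
    bdry := P ++ (rest len (X.opp x) ++ (rest len (X.opp y) ++ Q))
    base := X.base
    verts := X.verts
    opp := X.opp
    src := X.src
    lab := X.lab
    ty := X.ty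
    off := X.off
    faceBound := X.faceBound
    vertBound := X.vertBound
    nodup := by
      have h1 := X.nodup
      rw [h] at h1
      replace h1 := h1.sublist
        ((List.Sublist.refl P).append ((List.sublist_cons_self y Q).cons x))
      rw [List.nodup_append'] at h1
      have h2 (d) (hd : d ∈ P ++ Q) : d ∉ rest len (X.opp x) ∧ d ∉ rest len (X.opp y) := by
        have h3 : d.1 ∉ X.faces := X.notMem d (by
          simp only [h, List.mem_append, List.mem_cons] at hd ⊢
          tauto)
        rw [mem_rest hx', mem_rest hy']
        exact ⟨fun h4 => h3 (h4.1 ▸ hx), fun h4 => h3 (h4.1 ▸ hy)⟩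
      refine List.nodup_append'.mpr ⟨h1.1, List.nodup_append'.mpr ⟨nodup_rest _,
        List.nodup_append'.mpr ⟨nodup_rest _, h1.2.1, ?_⟩, ?_⟩, ?_⟩
      · exact fun d hd hd' => (h2 d (by simp [hd'])).2 hd
      · intro d hd hd'
        rcases List.mem_append.mp hd' with hd' | hd'
        · rw [mem_rest hx'] at hd
          rw [mem_rest hy'] at hd'
          exact hne (hd.1.symm.trans hd'.1)
        · exact (h2 d (by simp [hd'])).1 hd
      · intro d hd hd'
        have h3 := h2 d (by simp [hd])
        have h4 := @h1.2.2 d hd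
        simp only [List.mem_append] at hd'
        tauto
    notMem := by
      intro d hd
      simp only [Finset.mem_erase, not_and]
      intro hd1 hd2
      simp only [List.mem_append, mem_rest hx', mem_rest hy'] at hd
      rcases hd with hd | hd | hd | hd
      · exact X.notMem d (by simp [h, hd])
      · exact absurd hd.1 hd2
      · exact absurd hd.1 hd1
      · exact X.notMem d (by simp [h, hd])
    live_opp := by
      intro d hd
      rw [hlive] at hd ⊢
      obtain ⟨hd, ⟨h1, h2⟩, h3, h4⟩ := hd
      have hdd := X.opp_opp d hd
      refine ⟨X.live_opp d hd, ⟨fun h5 => h3 (by rw [← h5, hdd]), fun h5 => h4 (by rw [← h5, hdd])⟩,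
        fun h5 => h1 ?_, fun h5 => h2 ?_⟩
      · rw [← hdd, h5, X.opp_opp x hLx]
      · rw [← hdd, h5, X.opp_opp y hLy]
    opp_opp := fun d hd => X.opp_opp d ((hlive d).mp hd).1
    lab_opp := fun d hd => X.lab_opp d ((hlive d).mp hd).1
    lab_face := fun j hj => X.lab_face j (Finset.mem_of_mem_erase (Finset.mem_of_mem_erase hj))
    src_face := fun j hj => X.src_face j (Finset.mem_of_mem_erase (Finset.mem_of_mem_erase hj))
    walk := by
      obtain ⟨h1, h2, h3⟩ := X.walk_split h
      have h4 := X.walk_rest hx hx'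
      have h5 := X.walk_rest hy hy'
      rw [X.opp_opp _ hLx] at h4
      rw [X.opp_opp _ hLy, h2] at h5
      exact walk_append.mpr ⟨_, h1, walk_append.mpr ⟨_, h4, walk_append.mpr ⟨_, h5, h3⟩⟩⟩
    verts_src := by
      intro v hv
      obtain ⟨-, h2, h3⟩ := X.walk_split h
      obtain ⟨ex, hex, hsx⟩ := hnxt hx hx' hlx
      obtain ⟨ey, hey, hsy⟩ := hnxt hy hy' hly
      rw [X.opp_opp _ hLx] at hsx
      rw [X.opp_opp _ hLy] at hsy
      rcases X.verts_src v hv with h4 | ⟨d, hd, rfl⟩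
      · exact Or.inl h4
      by_cases h5 : d = x
      · exact Or.inr ⟨ex, Or.inl (by simp [hex]), by rw [h5, hsx]⟩
      by_cases h6 : d = y
      · exact Or.inr ⟨ey, Or.inl (by simp [hey]), by rw [h6, hsy]⟩
      by_cases h7 : d = X.opp x
      · exact Or.inr ⟨ey, Or.inl (by simp [hey]), by rw [h7, hsy, h2]⟩
      by_cases h8 : d = X.opp y
      · cases Q with
        | nil => exact Or.inl (by rw [h8]; exact h3)
        | cons z Q => exact Or.inr ⟨z, Or.inl (by simp), by rw [h8, h3.1]⟩
      exact Or.inr ⟨d, (hlive d).mpr ⟨hd, ⟨h5, h6⟩, h7, h8⟩, rfl⟩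
    count := by
      have h1 := X.count
      have hy2 : (X.opp y).1 ∈ X.faces.erase (X.opp x).1 := Finset.mem_erase.mpr ⟨hne.symm, hy⟩
      have h2 := Finset.add_sum_erase _ len hx
      have h3 := Finset.add_sum_erase _ len hy2
      have h4 := Finset.card_erase_add_one hx
      have h5 := Finset.card_erase_add_one hy2
      simp only [h, rest, List.length_append, List.length_cons, List.length_map,
        List.length_range] at h1 ⊢
      omega
    lt_faceBound := fun d hd => X.lt_faceBound d ((hlive d).mp hd).1
    face_lt := fun j hj => X.face_lt j (Finset.mem_of_mem_erase (Finset.mem_of_mem_erase hj))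
    src_lt := fun d hd => X.src_lt d ((hlive d).mp hd).1
    base_lt := X.base_lt
    not_mirror := fun d h1 h2 h3 h4 =>
      X.not_mirror d (Finset.mem_of_mem_erase (Finset.mem_of_mem_erase h1)) h2 h3
        (Finset.mem_of_mem_erase (Finset.mem_of_mem_erase h4)) }

theorem even_add_of_typeAt_eq {g : Fin 2} {i j : ℕ} (h : typeAt g i = typeAt g j) :
    Even (i + j) := by
  have key (i : ℕ) : typeAt g (2 * i + 1) ≠ g := by
    rw [typeAt_succ, typeAt_two_mul]
    clear h
    revert g
    decide
  rcases Nat.even_or_odd' i with ⟨a, rfl | rfl⟩ <;> rcases Nat.even_or_odd' j with ⟨b, rfl | rfl⟩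
  · exact ⟨a + b, by ring⟩
  · rw [typeAt_two_mul] at h
    exact absurd h.symm (key b)
  · rw [typeAt_two_mul] at h
    exact absurd h (key a)
  · exact ⟨a + b + 1, by ring⟩

theorem exists_reduced {p q : ℤ} {N : ℕ} (hp : 0 < p) (hlen : ∀ j, j ≠ 0 → len j = N)
    (hden : ∀ j, j ≠ 0 → den j = p) (hnum : ∀ j, j ≠ 0 → num j = q) (hN : 0 < N) (hN2 : Even N)
    (hdvd : 2 * p ∣ N) (X : Net len den num) (h0 : 0 ∈ X.faces) :
    ∃ Y : Net len den num, 0 ∈ Y.faces ∧ Y.word = X.word ∧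
      FreeGroup.IsReduced (Y.bdry.map Y.lab) := by
  obtain ⟨k, hk⟩ : ∃ k, k = ∑ j ∈ X.faces, len j + X.bdry.length := ⟨_, rfl⟩
  induction k using Nat.strong_induction_on generalizing X with
  | _ k ih =>
  by_cases hred : FreeGroup.IsReduced (X.bdry.map X.lab)
  · exact ⟨X, h0, rfl, hred⟩
  obtain ⟨P, x, y, Q, h, hlab⟩ : ∃ P x y Q, X.bdry = P ++ x :: y :: Q ∧
      X.lab y = ((X.lab x).1, !(X.lab x).2) := by
    by_contra! hno
    refine hred ?_
    rw [FreeGroup.IsReduced, List.isChain_map, List.isChain_iff_forall_rel_of_append_cons_cons]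
    intro x y P Q h h1
    by_contra h2
    refine hno P x y Q h (Prod.ext h1.symm ?_)
    cases hx : (X.lab x).2 <;> cases hy : (X.lab y).2 <;> simp_all
  have hlength : X.bdry.length = (P ++ Q).length + 2 := by simp [h]; omega
  have hX := X.mk_bdry h hlab
  by_cases hxy : X.opp x = y
  · obtain ⟨Y, hY0, hY, hYr⟩ := ih _ (by rw [hk, hlength]; exact Nat.lt_add_of_pos_right two_pos)
      (X.spike h hxy) h0 rfl
    exact ⟨Y, hY0, hY.trans hX.symm, hYr⟩
  by_cases hm : ((X.opp x).1 ∈ X.faces ∧ (X.opp x).1 ≠ 0 ∧ (X.opp y).1 ∈ X.faces ∧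
      (X.opp y).1 ≠ 0) ∧ 2 * p ∣ X.phase (X.opp x) + X.phase (X.opp y) + 1
  swap
  · obtain ⟨Y, hY0, hY, hYr⟩ := ih _ (by rw [hk, hlength]; exact Nat.lt_add_of_pos_right two_pos)
      (X.fold h hlab hxy fun h1 h2 h3 h4 => by
        rw [hden _ h2, hden _ h4]
        exact ⟨rfl, fun h5 => hm ⟨⟨h1, h2, h3, h4⟩, h5⟩⟩) h0 rfl
    exact ⟨Y, hY0, hY.trans hX.symm, hYr⟩
  obtain ⟨⟨h1, h2, h3, h4⟩, h5⟩ := hm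
  have hLx : Live len X.faces X.bdry x := Or.inl (by simp [h])
  have hLy : Live len X.faces X.bdry y := Or.inl (by simp [h])
  have h6 := ((X.live_opp x hLx).resolve_left fun h' => X.notMem _ h' h1).2
  have h7 := ((X.live_opp y hLy).resolve_left fun h' => X.notMem _ h' h3).2
  have hty : (X.lab (X.opp x)).1 = (X.lab (X.opp y)).1 := by
    rw [X.lab_opp x hLx, X.lab_opp y hLy, hlab]
  have hne : (X.opp x).1 ≠ (X.opp y).1 := fun heq => by
    have h8 := X.lab_face _ h1 _ h6
    have h9 := X.lab_face _ h3 _ h7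
    rw [Prod.mk.eta] at h8 h9
    rw [h8, h9, heq] at hty
    obtain ⟨e, he⟩ := even_add_of_typeAt_eq hty
    have he' : ((X.opp x).2 + (X.opp y).2 : ℤ) = 2 * e := by
      rw [← Nat.cast_add, he]
      push_cast
      ring
    obtain ⟨f, hf⟩ := h5
    simp only [phase, heq] at hf
    have : 2 * (p * f - X.off (X.opp y).1 - e * num (X.opp y).1) = 1 := by
      linear_combination -hf + num (X.opp y).1 * he'
    omega
  have hlN : 2 ≤ N := by
    obtain ⟨e, he⟩ := hN2
    omega
  have hlx := hlen _ h2
  have hly := hlen _ h4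
  have hsum : ∑ j ∈ X.faces, len j =
      ∑ j ∈ (X.faces.erase (X.opp x).1).erase (X.opp y).1, len j + N + N := by
    have e1 := Finset.sum_erase_add X.faces len h1
    have e2 := Finset.sum_erase_add (X.faces.erase (X.opp x).1) len
      (Finset.mem_erase.mpr ⟨hne.symm, h3⟩)
    omega
  have hlr : (rest len (X.opp x)).length = N - 1 ∧ (rest len (X.opp y)).length = N - 1 := by
    simp [rest, hlx, hly]
  obtain ⟨Y, hY0, hY, hYr⟩ := ih _ (by
      rw [hk, hlength, hsum]
      change ∑ j ∈ (X.faces.erase (X.opp x).1).erase (X.opp y).1, len j +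
        (P ++ (rest len (X.opp x) ++ (rest len (X.opp y) ++ Q))).length < _
      simp only [List.length_append, hlr]
      omega)
    (X.merge h h1 h3 hne (by omega) (by omega))
    (Finset.mem_erase.mpr ⟨h4.symm, Finset.mem_erase.mpr ⟨h2.symm, h0⟩⟩) rfl
  refine ⟨Y, hY0, hY.trans ?_, hYr⟩
  change FreeGroup.mk
    ((P ++ (rest len (X.opp x) ++ (rest len (X.opp y) ++ Q))).map X.lab) = _
  rw [hX]
  simp only [List.map_append, ← FreeGroup.mul_mk]
  rw [X.map_lab_rest h1 h6 (by rw [hden _ h2]; exact hp) (by rwa [hlx])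
      (by rw [hlx, hden _ h2]; exact hdvd),
    X.map_lab_rest h3 h7 (by rw [hden _ h4]; exact hp) (by rwa [hly])
      (by rw [hly, hden _ h4]; exact hdvd), hlx, hly, hden _ h2, hden _ h4, hnum _ h2, hnum _ h4,
    hty]
  obtain ⟨e, he⟩ := hN2
  obtain ⟨K, rfl⟩ : ∃ K, e = K + 1 := ⟨e - 1, by omega⟩
  have hinv := stripF_inv p q hp (2 * K) ((X.lab (X.opp y)).1 + 1) (X.phase (X.opp x) + q)
  rw [typeAt_two_mul] at hinv
  have hcg := strip_congr p q hp (2 * K + 1) ((X.lab (X.opp y)).1 + 1)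
    (c := -1 - (X.phase (X.opp x) + q + (2 * K : ℕ) * q)) (c' := X.phase (X.opp y) + q) (by
      obtain ⟨f, hf⟩ := h5
      obtain ⟨f', hf'⟩ := hdvd
      refine ⟨f + q * f', ?_⟩
      have : (N : ℤ) = 2 * K + 2 := by omega
      push_cast
      linear_combination hf + q * hf' - q * this)
  rw [show N - 1 = 2 * K + 1 by omega, hcg, ← mul_assoc (FreeGroup.mk (strip _ _ _ _ _))]
  change _ * (stripF _ _ _ _ _ * stripF _ _ _ _ _ * _) = _
  rw [← hinv, mul_inv_cancel, one_mul]

theorem exists_word_eq_mul {p q : ℤ} {N : ℕ} (hp : 0 < p) (hlen : ∀ j, j ≠ 0 → len j = N)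
    (hden : ∀ j, j ≠ 0 → den j = p) (hnum : ∀ j, j ≠ 0 → num j = q) (hN : 0 < N)
    (X : Net len den num) (h0 : 0 ∈ X.faces) (g : Fin 2) (c : ℤ) :
    ∃ Y : Net len den num, 0 ∈ Y.faces ∧ Y.word = X.word * stripF p q N g c := by
  have hf : X.faceBound ≠ 0 := (X.face_lt 0 h0).ne'
  refine ⟨X.attach g c X.faceBound rfl (by rwa [hlen _ hf]) (by rwa [hden _ hf]),
    Finset.mem_insert_of_mem h0, ?_⟩
  rw [word_attach, hlen _ hf, hden _ hf, hnum _ hf]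

theorem exists_word_eq_conj (X : Net len den num) (h0 : 0 ∈ X.faces) (z : F) :
    ∃ Y : Net len den num, 0 ∈ Y.faces ∧ Y.word = z * X.word * z⁻¹ := by
  obtain ⟨l, rfl⟩ : ∃ l, FreeGroup.mk l = z := ⟨z.toWord, FreeGroup.mk_toWord⟩
  induction l with
  | nil => exact ⟨X, h0, by simp [← FreeGroup.one_eq_mk]⟩
  | cons a l ih =>
    obtain ⟨Y, hY, hYw⟩ := ih
    refine ⟨Y.conj a, hY, ?_⟩
    have h : (FreeGroup.mk (a :: l) : F) = FreeGroup.mk [a] * FreeGroup.mk l := by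
      rw [FreeGroup.mul_mk, List.singleton_append]
    rw [word_conj, hYw, h]
    group

theorem exists_word_eq_of_mem_normalClosure {p q : ℤ} {N : ℕ} (hp : 0 < p)
    (hlen : ∀ j, j ≠ 0 → len j = N) (hden : ∀ j, j ≠ 0 → den j = p)
    (hnum : ∀ j, j ≠ 0 → num j = q) (hN : 0 < N) (X : Net len den num) (h0 : 0 ∈ X.faces) {w : F}
    (hw : w ∈ Subgroup.normalClosure {stripF p q N 0 0}) :
    ∃ Y : Net len den num, 0 ∈ Y.faces ∧ Y.word = X.word * w := by
  have hinv : (stripF p q N 0 0)⁻¹ = stripF p q N (typeAt 0 (N - 1))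
      (-1 - (0 + (N - 1 : ℕ) * q)) := by
    obtain ⟨K, rfl⟩ : ∃ K, N = K + 1 := ⟨N - 1, by omega⟩
    exact stripF_inv p q hp K 0 0
  have hconj (z : F) (g : Fin 2) (c : ℤ) (X : Net len den num) (h0 : 0 ∈ X.faces) :
      ∃ Y : Net len den num, 0 ∈ Y.faces ∧ Y.word = X.word * (z * stripF p q N g c * z⁻¹) := by
    obtain ⟨Y, hY, hYw⟩ := X.exists_word_eq_conj h0 z⁻¹
    obtain ⟨Y', hY', hYw'⟩ := Y.exists_word_eq_mul hp hlen hden hnum hN hY g c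
    obtain ⟨Y'', hY'', hYw''⟩ := Y'.exists_word_eq_conj hY' z
    refine ⟨Y'', hY'', ?_⟩
    rw [hYw'', hYw', hYw]
    group
  rw [Subgroup.normalClosure] at hw
  induction hw using Subgroup.closure_induction'' generalizing X with
  | one => exact ⟨X, h0, (mul_one _).symm⟩
  | mem x hx =>
    obtain ⟨a, rfl, ha⟩ := Group.mem_conjugatesOfSet_iff.mp hx
    obtain ⟨z, rfl⟩ := isConj_iff.mp ha
    exact hconj z _ _ X h0
  | inv_mem x hx =>
    obtain ⟨a, rfl, ha⟩ := Group.mem_conjugatesOfSet_iff.mp hx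
    obtain ⟨z, rfl⟩ := isConj_iff.mp ha
    obtain ⟨Y, hY, hYw⟩ := hconj z _ _ X h0
    refine ⟨Y, hY, hYw.trans ?_⟩
    rw [← hinv]
    group
  | mul x y _ _ hx hy =>
    obtain ⟨Y, hY, hYw⟩ := hx X h0
    obtain ⟨Y', hY', hYw'⟩ := hy Y hY
    exact ⟨Y', hY', by rw [hYw', hYw, mul_assoc]⟩

/-- A word that is conjugate to the word of the face `0`, or to its inverse, modulo the normal
closure of the word of the other faces is the boundary word of a net. -/
theorem exists_word_eq {p q : ℤ} {N : ℕ} (hp : 0 < p) (hlen : ∀ j, j ≠ 0 → len j = N)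
    (hden : ∀ j, j ≠ 0 → den j = p) (hnum : ∀ j, j ≠ 0 → num j = q) (hN : 0 < N)
    (hlen0 : 0 < len 0) (hden0 : 0 < den 0) {w v : F}
    (hv : v = stripF (den 0) (num 0) (len 0) 0 0 ∨ v = (stripF (den 0) (num 0) (len 0) 0 0)⁻¹)
    (hw : IsConj (QuotientGroup.mk' (Subgroup.normalClosure {stripF p q N 0 0}) w)
      (QuotientGroup.mk' (Subgroup.normalClosure {stripF p q N 0 0}) v)) :
    ∃ X : Net len den num, 0 ∈ X.faces ∧ X.word = w := by
  obtain ⟨g, c, rfl⟩ : ∃ g c, v = stripF (den 0) (num 0) (len 0) g c := by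
    rcases hv with hv | hv
    · exact ⟨0, 0, hv⟩
    · obtain ⟨K, hK⟩ : ∃ K, len 0 = K + 1 := ⟨len 0 - 1, by omega⟩
      rw [hK, stripF_inv _ _ hden0] at hv
      exact ⟨_, _, hK ▸ hv⟩
  obtain ⟨z, hz⟩ := isConj_iff.mp hw.symm
  obtain ⟨z, rfl⟩ := QuotientGroup.mk'_surjective _ z
  rw [← map_inv, ← map_mul, ← map_mul, QuotientGroup.mk'_eq_mk'] at hz
  obtain ⟨ν, hν, hz⟩ := hz
  have hf : (Net.trivial len den num).faceBound = 0 := rfl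
  have hX0 : 0 ∈ ((Net.trivial len den num).attach g c 0 hf hlen0 hden0).faces :=
    Finset.mem_insert_self _ _
  obtain ⟨X, hX, hXw⟩ := exists_word_eq_conj _ hX0 z
  obtain ⟨Y, hY, hYw⟩ := X.exists_word_eq_of_mem_normalClosure hp hlen hden hnum hN hX hν
  refine ⟨Y, hY, ?_⟩
  rw [hYw, hXw, word_attach, word_trivial, one_mul, hz]

end Net

theorem card_lows_shift (p q c a b x : ℤ) :
    (lows p q (c + x * q) (a - x) (b - x)).card = (lows p q c a b).card := by
  refine Finset.card_nbij' (· + x) (· - x) ?_ ?_ (fun i _ => by simp) fun i _ => by simp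
  · intro i hi
    simp only [Finset.mem_coe, mem_lows] at hi ⊢
    refine ⟨by omega, ?_⟩
    rw [show c + (i + x) * q = c + x * q + i * q by ring]
    exact hi.2
  · intro i hi
    simp only [Finset.mem_coe, mem_lows] at hi ⊢
    refine ⟨by omega, ?_⟩
    rw [show c + x * q + (i - x) * q = c + i * q by ring]
    exact hi.2

theorem card_ups_shift (p q c a b x : ℤ) :
    (ups p q (c + x * q) (a - x) (b - x)).card = (ups p q c a b).card := by
  rw [← lows_flip, ← lows_flip, ← card_lows_shift p (-q) (-1 - c) a b x]
  congr 2
  ring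

/-- Exactly one place in `p` consecutive ones is lowest over its integer part. -/
theorem card_dvd_add_mul {p q : ℤ} {P : ℕ} (hP : (P : ℤ) = p) (hp : 0 < p) (hpq : IsCoprime p q)
    (c : ℤ) (t : ℕ) : ((Finset.range (P * t)).filter fun i : ℕ => p ∣ c + i * q).card = t := by
  obtain ⟨u, v, huv⟩ := hpq
  have h1 : ∀ i : ℕ, p ∣ c + i * q ↔ i ≡ ((-c * v) % p).toNat [MOD P] := by
    intro i
    rw [← Int.natCast_modEq_iff, Int.toNat_of_nonneg (Int.emod_nonneg _ hp.ne'), hP,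
      Int.ModEq, Int.emod_emod, ← Int.ModEq, Int.modEq_iff_dvd]
    constructor
    · rintro ⟨w, hw⟩
      refine ⟨-w * v - i * u, ?_⟩
      linear_combination -v * hw + i * huv
    · rintro ⟨w, hw⟩
      refine ⟨c * u - q * w, ?_⟩
      linear_combination -q * hw - c * huv
  simp only [h1]
  rw [← Nat.count_eq_card_filter_range, Nat.count_modEq_card _ (by omega)]
  rw [Nat.mul_mod_right, Nat.mul_div_cancel_left _ (by omega)]
  simp

theorem card_le_of_steep {p q c p' q' c' a b δ T : ℤ} (hp : 0 < p) (hp' : 0 < p')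
    (hpq : IsCoprime p q) (hst : Steep p q p' q' δ T ∨ Steep p (-q) p' (-q') δ T) (hT : 0 < T)
    (hag : Agree p q c p' q' c' a b) :
    ((lows p q c a b).card : ℤ) ≤ T ∧ ((ups p q c a b).card : ℤ) ≤ T := by
  rcases hst with hst | hst
  · exact hst.card_le hp hp' hpq hT hag
  · have := hst.card_le hp hp' hpq.neg_right hT (hag.flip hp hp')
    rw [lows_flip, ups_flip] at this
    exact this.symm

theorem not_full_full_of_steep {p q cf cg p' q' c' a b δ T : ℤ} (hp : 0 < p) (hp' : 0 < p')
    (hpq : IsCoprime p q) (hst : Steep p q p' q' δ T ∨ Steep p (-q) p' (-q') δ T) (hT : 3 ≤ T)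
    (hδ : 2 * δ ≤ p) (hf : Agree p q cf p' q' c' 0 b) (hg : Agree p q cg p' q' c' a (-1))
    (hfc : 2 * T ≤ (lows p q cf 0 b).card + (ups p q cf 0 b).card)
    (hgc : 2 * T ≤ (lows p q cg a (-1)).card + (ups p q cg a (-1)).card) : False := by
  have h1 := card_le_of_steep hp hp' hpq hst (by omega) hf
  have h2 := card_le_of_steep hp hp' hpq hst (by omega) hg
  rcases hst with hst | hst
  · exact hst.not_full_full hp hp' hpq hT hδ hf hg (by omega) (by omega) (by omega) (by omega)
  · refine hst.not_full_full hp hp' hpq.neg_right hT hδ (hf.flip hp hp') (hg.flip hp hp')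
      ?_ ?_ ?_ ?_ <;> simp only [lows_flip, ups_flip] <;> omega

theorem Agree.shift {p q c p' q' c' a b : ℤ} (h : Agree p q c p' q' c' a b) (x : ℤ) :
    Agree p q (c + x * q) p' q' (c' + x * q') (a - x) (b - x) := by
  intro i hi hi'
  have := h (i + x) (by omega) (by omega)
  rwa [show c + (i + x) * q = c + x * q + i * q by ring,
    show c' + (i + x) * q' = c' + x * q' + i * q' by ring] at this

theorem sgn_eq_of_dvd {p c c' : ℤ} (hp : 0 < p) (h : 2 * p ∣ c - c') : sgn p c = sgn p c' := by
  obtain ⟨w, hw⟩ := h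
  rw [← sgn_add p c' hp w, ← hw]
  congr 1
  ring

/-- A diagram whose darts carry phases: the face `j` is read along a line of slope
`num j / den j`. -/
structure PhasedDiagram (X : Type) [Fintype X] (k N n : ℕ) (den num : ℕ → ℤ) extends
    Diagram X k N n where
  ph : X → ℤ
  ph_nxt : ∀ d, 2 * den (face d) ∣ ph (nxt d) - (ph d + num (face d))
  sgn_opp : ∀ d, sgn (den (face (opp d))) (ph (opp d)) = !sgn (den (face d)) (ph d)
  mark_iff : ∀ d, mark d ↔ den (face d) ∣ ph d ∨ den (face d) ∣ ph d + 1
  not_mirror : ∀ d, toDiagram.Rel d → toDiagram.Rel (opp d) →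
    ¬ 2 * den (face d) ∣ ph d + ph (opp d) + 1
  transitive_outer : ∀ d e, face d = k + 1 → face e = k + 1 → ∃ i : ℕ, (nxt ^ i) d = e

namespace PhasedDiagram

variable {X : Type} [Fintype X] {k N n : ℕ} {den num : ℕ → ℤ} (D : PhasedDiagram X k N n den num)

theorem ph_pow (d : X) (i : ℕ) :
    2 * den (D.face d) ∣ D.ph ((D.nxt ^ i) d) - (D.ph d + i * num (D.face d)) := by
  induction i with
  | zero => simp
  | succ i ih =>
    have h := D.ph_nxt ((D.nxt ^ i) d)
    rw [D.face_pow] at h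
    rw [pow_succ', Equiv.Perm.mul_apply]
    refine (dvd_add h ih).trans (dvd_of_eq ?_)
    push_cast
    ring

theorem ph_opp_pow (d : X) (J : ℕ) (h : ∀ i < J, ¬ D.Corner ((D.nxt ^ i) d)) :
    2 * den (D.face (D.opp d)) ∣
      D.ph (D.opp ((D.nxt ^ J) d)) - (D.ph (D.opp d) - J * num (D.face (D.opp d))) := by
  induction J with
  | zero => simp
  | succ J ih =>
    have h1 := ih fun i hi => h i (by omega)
    have h2 := D.ph_nxt (D.opp ((D.nxt ^ (J + 1)) d))
    rw [D.face_opp_pow d (J + 1) h, pow_succ', Equiv.Perm.mul_apply,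
      D.nxt_opp_nxt _ (h J (by omega))] at h2
    rw [pow_succ', Equiv.Perm.mul_apply]
    refine (dvd_sub h1 h2).trans (dvd_of_eq ?_)
    push_cast
    ring

/-- Along an arc, the phases on the two sides have the same signs. -/
theorem sgn_window (hden : ∀ j, 0 < den j) (d : X) {J : ℕ}
    (h : ∀ i < J, ¬ D.Corner ((D.nxt ^ i) d)) (i : ℕ) (hi : i ≤ J) :
    sgn (den (D.face d)) (D.ph d + i * num (D.face d)) =
      sgn (den (D.face (D.opp d))) (-1 - D.ph (D.opp d) + i * num (D.face (D.opp d))) := by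
  have h' : ∀ a < i, ¬ D.Corner ((D.nxt ^ a) d) := fun a ha => h a (by omega)
  have h1 := sgn_eq_of_dvd (hden _) (D.ph_pow d i)
  have h2 := sgn_eq_of_dvd (hden _) (D.ph_opp_pow d i h')
  have h3 := D.sgn_opp ((D.nxt ^ i) d)
  rw [D.face_opp_pow d i h', D.face_pow, h1, h2] at h3
  rw [show -1 - D.ph (D.opp d) + i * num (D.face (D.opp d)) =
    -1 - (D.ph (D.opp d) - i * num (D.face (D.opp d))) by ring, sgn_mirror _ _ (hden _), h3,
    Bool.not_not]

theorem mark_pow_iff (d : X) (i : ℕ) (t : ℤ) : D.mark ((D.nxt ^ i) d) ↔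
    den (D.face d) ∣ D.ph d + 2 * den (D.face d) * t + i * num (D.face d) ∨
      den (D.face d) ∣ D.ph d + 2 * den (D.face d) * t + i * num (D.face d) + 1 := by
  obtain ⟨w, hw⟩ := D.ph_pow d i
  rw [D.mark_iff, D.face_pow]
  have e : D.ph ((D.nxt ^ i) d) = D.ph d + 2 * den (D.face d) * t + i * num (D.face d) +
    den (D.face d) * (2 * w - 2 * t) := by linear_combination hw
  rw [e, add_right_comm _ _ (1 : ℤ), dvd_add_left (dvd_mul_right _ _),
    dvd_add_left (dvd_mul_right _ _)]

theorem marks_le (d : X) (J : ℕ) (t : ℤ) : D.marks d (J + 1) ≤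
    (lows (den (D.face d)) (num (D.face d)) (D.ph d + 2 * den (D.face d) * t) 0 J).card +
      (ups (den (D.face d)) (num (D.face d)) (D.ph d + 2 * den (D.face d) * t) 0 J).card := by
  classical
  refine le_trans ?_ (Finset.card_union_le _ _)
  refine Finset.card_le_card_of_injOn (fun i : ℕ => (i : ℤ)) ?_ Nat.cast_injective.injOn
  intro i hi
  simp only [Finset.coe_filter, Finset.mem_range, Set.mem_ofPred_eq, D.mark_pow_iff d i t] at hi
  simp only [Finset.coe_union, Set.mem_union, Finset.mem_coe, mem_lows, mem_ups]
  have : (0 : ℤ) ≤ i ∧ (i : ℤ) ≤ J := ⟨by positivity, by omega⟩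
  tauto

theorem marks_eq {P : ℕ} (hN : N = 2 * P * n) {d : X} (hP : (P : ℤ) = den (D.face d))
    (hp : 1 < den (D.face d)) (hpq : IsCoprime (den (D.face d)) (num (D.face d))) :
    D.marks d N = 4 * n := by
  classical
  unfold Diagram.marks
  have h0 := fun i => D.mark_pow_iff d i 0
  simp only [mul_zero, add_zero] at h0
  simp only [h0]
  rw [Finset.filter_or, Finset.card_union_of_disjoint]
  · have h1 := card_dvd_add_mul hP (by omega) hpq (D.ph d) (2 * n)
    have h2 := card_dvd_add_mul hP (by omega) hpq (D.ph d + 1) (2 * n)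
    simp only [add_right_comm _ (1 : ℤ)] at h2
    rw [show P * (2 * n) = N by rw [hN]; ring] at h1 h2
    omega
  · rw [Finset.disjoint_filter]
    intro i _ h1 h2
    have := Int.le_of_dvd one_pos ((dvd_add_right h1).mp h2)
    omega

theorem agree_window (hden : ∀ j, 0 < den j) (hnum : ∀ j, 0 ≤ num j ∧ num j ≤ den j) (d : X)
    {J : ℕ} (h : ∀ i < J, ¬ D.Corner ((D.nxt ^ i) d)) :
    ∃ t, Agree (den (D.face d)) (num (D.face d)) (D.ph d + 2 * den (D.face d) * t)
      (den (D.face (D.opp d))) (num (D.face (D.opp d))) (-1 - D.ph (D.opp d)) 0 J :=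
  exists_agree (hden _) (hnum _).1 (hnum _).2 (hden _) (hnum _).1 (hnum _).2
    (D.sgn_window hden d h)

theorem typ_pow (d : X) (i : ℕ) : D.typ ((D.nxt ^ i) d) = typeAt (D.typ d) i := by
  induction i with
  | zero => exact (typeAt_zero _).symm
  | succ i ih => rw [pow_succ', Equiv.Perm.mul_apply, D.typ_nxt, ih, typeAt_succ]

theorem nxt_pow_opp_pow (d : X) (i : ℕ) (h : ∀ a < i, ¬ D.Corner ((D.nxt ^ a) d)) :
    (D.nxt ^ i) (D.opp ((D.nxt ^ i) d)) = D.opp d := by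
  induction i with
  | zero => rfl
  | succ i ih =>
    rw [pow_succ, Equiv.Perm.mul_apply, ← pow_succ, pow_succ', Equiv.Perm.mul_apply,
      D.nxt_opp_nxt _ (h i (by omega)), ih fun a ha => h a (by omega)]

theorem opp_ne (d : X) : D.opp d ≠ d := fun h => by
  have := D.sgn_opp d
  rw [h] at this
  simp at this

/-- The outer disk cannot be glued to itself all along its boundary. -/
theorem face_opp_ne_outer (d : X) (hd : D.face d = k + 1)
    (h : ∀ i, ¬ D.Corner ((D.nxt ^ i) d)) : D.face (D.opp d) ≠ k + 1 := fun hd' => by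
  obtain ⟨j, hj⟩ := D.transitive_outer d (D.opp d) hd hd'
  have ht := D.typ_pow d j
  rw [hj, D.typ_opp] at ht
  obtain ⟨l, hl⟩ := Net.even_add_of_typeAt_eq ((typeAt_zero (D.typ d)).trans ht)
  have h1 := D.nxt_pow_opp_pow d l fun a _ => h a
  rw [← hj, show j = l + l by omega, pow_add, Equiv.Perm.mul_apply] at h1
  exact D.opp_ne _ ((D.nxt ^ l).injective h1)

/-- There is no diagram of relator disks between two disks whose slopes are steep in comparison
with the slope of the relator. -/
theorem false_of_steep (hden : ∀ j, 0 < den j) (hnum : ∀ j, 0 ≤ num j ∧ num j ≤ den j) {p q : ℤ}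
    (hp : 1 < p) (hpq : IsCoprime p q) (hrel : ∀ j, 1 ≤ j → j ≤ k → den j = p ∧ num j = q)
    {P : ℕ} (hP : (P : ℤ) = p) (hN : N = 2 * P * n) (hn : 2 ≤ n)
    (hcount : Fintype.card X ≤ 2 * (Finset.univ.image D.src).card + 2 * k)
    (hinner : ∃ δ T : ℤ, (Steep p q (den 0) (num 0) δ T ∨ Steep p (-q) (den 0) (-num 0) δ T) ∧
      (T = 2 ∨ T = 2 * n - 1 ∧ 2 * δ ≤ p))
    (houter : ∃ δ : ℤ, Steep p q (den (k + 1)) (num (k + 1)) δ 1 ∨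
      Steep p (-q) (den (k + 1)) (-num (k + 1)) δ 1)
    (hne : num (k + 1) * den 0 ≠ num 0 * den (k + 1)) : False := by
  have hp0 : 0 < p := by omega
  obtain ⟨δ, T, hst, hT⟩ := hinner
  obtain ⟨δ', hst'⟩ := houter
  refine D.toDiagram.false_of_bounds ?_ hn (hN ▸ Nat.mul_pos (by omega) (by omega)) ?_ hcount ?_ ?_
  · intro d hd J _ hsm
    obtain ⟨t, hag⟩ := D.agree_window hden hnum d hsm
    refine (D.marks_le d J t).trans ?_
    obtain ⟨h1, h2⟩ := hrel _ hd.1 hd.2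
    rw [h1, h2] at hag ⊢
    unfold Diagram.cap
    split_ifs with h3 h4
    · rw [h3] at hag
      have := card_le_of_steep hp0 (hden 0) hpq hst (by omega) hag
      omega
    · rw [h4] at hag
      have := card_le_of_steep hp0 (hden _) hpq hst' one_pos hag
      omega
    · have hR : D.Rel (D.opp d) := ⟨by omega, by have := D.face_le (D.opp d); omega⟩
      obtain ⟨h5, h6⟩ := hrel _ hR.1 hR.2
      rw [h5, h6] at hag
      refine card_le_one_of_parallel hp hpq (fun h7 => D.not_mirror d hd hR ?_) hag
      rw [h1]
      exact ⟨-t, by linear_combination h7⟩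
  · intro d hd
    obtain ⟨h1, h2⟩ := hrel _ hd.1 hd.2
    exact D.marks_eq hN (by rw [h1, hP]) (by rwa [h1]) (by rwa [h1, h2])
  · intro d hd hsm
    have h1 := D.face_opp_ne_outer d hd hsm
    by_contra hR
    have h2 := D.face_le (D.opp d)
    have h3 : D.face (D.opp d) = 0 := by
      unfold Diagram.Rel at hR
      omega
    choose t ht using fun J : ℕ => D.agree_window hden hnum d (J := J) fun i _ => hsm i
    simp only [hd, h3] at ht
    refine hne (slope_eq_of_agree (hden (k + 1)) (hden 0) (c := D.ph d + 2 * den (k + 1) * t 0)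
      (c' := -1 - D.ph (D.opp d)) fun b => ?_)
    have e1 := ht 0 0 le_rfl (Nat.cast_nonneg _)
    have e2 := ht b 0 le_rfl (Nat.cast_nonneg _)
    rw [← e2] at e1
    simp only [zero_mul, add_zero, mul_comm (2 : ℤ), mul_assoc] at e1
    rw [Int.add_mul_ediv_left _ _ (hden _).ne', Int.add_mul_ediv_left _ _ (hden _).ne'] at e1
    rw [show t 0 = t b by omega]
    exact ht b
  · intro d z J₁ J₂ hd hz _ _ hsm₁ hsm₂ h0 hm₁ hm₂ hdz
    obtain ⟨h1, h2⟩ := hrel _ hd.1 hd.2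
    obtain ⟨h3, h4⟩ := hrel _ hz.1 hz.2
    obtain ⟨t, hag⟩ := D.agree_window hden hnum d hsm₁
    have hk := D.marks_le d J₁ t
    rw [h0] at hag
    rw [h1, h2] at hag hk
    have h5 : D.face (D.opp z) = 0 := by
      rw [← D.face_opp_pow z J₂ hsm₂, hdz, D.face_nxt, h0]
    have h6 := D.ph_opp_pow z J₂ hsm₂
    have h7 := D.ph_nxt (D.opp d)
    rw [hdz, h5] at h6
    rw [h0] at h7
    obtain ⟨t', hag'⟩ := exists_agree (J := J₂) (c := D.ph z) (q := q)
      (c' := -1 - D.ph (D.opp d) + (-1 - J₂ : ℤ) * num 0) hp0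
      (by rw [← h2]; exact (hnum _).1) (by rw [← h1, ← h2]; exact (hnum _).2) (hden 0) (hnum 0).1
      (hnum 0).2 fun i hi => by
        have h8 := D.sgn_window hden z hsm₂ i hi
        rw [h3, h4, h5] at h8
        refine h8.trans (sgn_eq_of_dvd (hden 0) ?_)
        refine (dvd_sub h6 h7).trans (dvd_of_eq ?_)
        ring
    have hk' := D.marks_le z J₂ t'
    have hag'' := hag'.shift (J₂ + 1)
    rw [h3, h4, ← card_lows_shift _ _ _ _ _ (J₂ + 1), ← card_ups_shift _ _ _ _ _ (J₂ + 1)] at hk'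
    rw [show -1 - D.ph (D.opp d) + (-1 - J₂ : ℤ) * num 0 + (J₂ + 1) * num 0 =
      -1 - D.ph (D.opp d) by ring] at hag''
    have e : (J₂ : ℤ) - (J₂ + 1) = -1 := by ring
    rw [e] at hag'' hk'
    rcases hT with rfl | ⟨rfl, hδ⟩
    · have := card_le_of_steep hp0 (hden 0) hpq hst two_pos hag
      omega
    · exact not_full_full_of_steep hp0 (hden 0) hpq hst (by omega) hδ hag hag'' (by omega)
        (by omega)

end PhasedDiagram

theorem val_finRotate {n : ℕ} (i : Fin n) : (finRotate n i : ℕ) = (i + 1) % n := by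
  obtain _ | n := n
  · exact i.elim0
  · rw [finRotate_apply, Fin.val_add, Fin.val_one', Nat.add_mod_mod]

theorem val_finRotate_pow {n : ℕ} (i : Fin n) (m : ℕ) :
    ((finRotate n ^ m) i : ℕ) = (i + m) % n := by
  induction m with
  | zero => simp [Nat.mod_eq_of_lt i.2]
  | succ m ih =>
    rw [pow_succ', Equiv.Perm.mul_apply, val_finRotate, ih, Nat.mod_add_mod, add_assoc]

theorem sigmaCongrRight_pow {ι : Type} {A : ι → Type} (f : ∀ j, Equiv.Perm (A j)) (m : ℕ)
    (y : Σ j, A j) :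
    (Equiv.sigmaCongrRight f ^ m) y = ⟨y.1, (f y.1 ^ m) y.2⟩ := by
  induction m with
  | zero => rfl
  | succ m ih => rw [pow_succ', Equiv.Perm.mul_apply, ih, pow_succ']; rfl

namespace Net

variable {len : ℕ → ℕ} {den num : ℕ → ℤ} (X : Net len den num)

/-- The number of darts of a face, where `none` is the outer face. -/
def degree (j : Option {x // x ∈ X.faces}) : ℕ := j.elim X.bdry.length fun x => len x

/-- The darts, sorted by faces. -/
abbrev Dart : Type := Σ j, Fin (X.degree j)

/-- A dart as a dart of the net. -/
def toPair : X.Dart → ℕ × ℕ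
  | ⟨none, i⟩ => X.bdry[i]'i.2
  | ⟨some j, i⟩ => (j, i)

theorem toPair_injective : Function.Injective X.toPair := by
  rintro ⟨_ | j, i⟩ ⟨_ | j', l⟩ h <;> simp only [toPair] at h
  · have h1 := (X.nodup.getElem_inj_iff).1 h
    rw [Fin.ext h1]
  · exact absurd j'.2 (by simpa [h] using X.notMem (X.bdry[i]'(i.2)) (List.getElem_mem _))
  · exact absurd j.2 (by simpa [← h] using X.notMem (X.bdry[l]'(l.2)) (List.getElem_mem _))
  · obtain ⟨h1, h2⟩ := Prod.mk.inj h
    obtain rfl := Subtype.ext h1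
    rw [Fin.ext h2]

theorem live_iff {d : ℕ × ℕ} : Live len X.faces X.bdry d ↔ ∃ y, X.toPair y = d := by
  constructor
  · rintro (h | ⟨h1, h2⟩)
    · obtain ⟨i, hi, rfl⟩ := List.mem_iff_getElem.1 h
      exact ⟨⟨none, i, hi⟩, rfl⟩
    · exact ⟨⟨some ⟨d.1, h1⟩, d.2, h2⟩, rfl⟩
  · rintro ⟨⟨_ | j, i⟩, rfl⟩
    · exact Or.inl (List.getElem_mem _)
    · exact Or.inr ⟨j.2, i.2⟩

theorem live_toPair (y : X.Dart) : Live len X.faces X.bdry (X.toPair y) := X.live_iff.2 ⟨y, rfl⟩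

/-- The dart on the other side of the edge. -/
noncomputable def oppDart (y : X.Dart) : X.Dart :=
  (X.live_iff.1 (X.live_opp _ (X.live_toPair y))).choose

theorem toPair_oppDart (y : X.Dart) : X.toPair (X.oppDart y) = X.opp (X.toPair y) :=
  (X.live_iff.1 (X.live_opp _ (X.live_toPair y))).choose_spec

theorem oppDart_oppDart (y : X.Dart) : X.oppDart (X.oppDart y) = y := by
  apply X.toPair_injective
  rw [toPair_oppDart, toPair_oppDart, X.opp_opp _ (X.live_toPair y)]

/-- The next dart of the same face. -/
def nextDart : Equiv.Perm X.Dart := Equiv.sigmaCongrRight fun j => finRotate (X.degree j)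

theorem src_nextDart (y : X.Dart) :
    X.src (X.toPair (X.nextDart y)) = X.src (X.opp (X.toPair y)) := by
  obtain ⟨_ | j, i⟩ := y
  · have hi : (i : ℕ) < X.bdry.length := i.2
    have h1 : X.toPair (X.nextDart ⟨none, i⟩) =
        X.bdry[(i + 1) % X.bdry.length]'(Nat.mod_lt _ (by omega)) := by
      exact getElem_congr_idx (c := X.bdry) (val_finRotate i)
    rw [h1]
    simp only [toPair]
    obtain h2 | h2 := Nat.lt_or_ge (i + 1) X.bdry.length
    · simp only [Nat.mod_eq_of_lt h2]
      exact X.walk.src_getElem i h2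
    · have h3 : (i : ℕ) + 1 = X.bdry.length := by omega
      simp only [h3, Nat.mod_self]
      rw [X.walk.src_zero (by omega), ← X.walk.tgt_getElem i h3]
      rfl
  · have h1 : X.toPair (X.nextDart ⟨some j, i⟩) = (j.1, (i + 1) % len j) := by
      exact congrArg (Prod.mk j.1) (val_finRotate i)
    rw [h1]
    exact X.src_face j j.2 i i.2

/-- The index of a face in a diagram: the outer face comes last. -/
noncomputable def faceIndex (j : Option {x // x ∈ X.faces}) : ℕ :=
  j.elim X.faces.card fun x => ((X.faces.orderIsoOfFin rfl).symm x : ℕ)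

theorem faceIndex_zero (h0 : 0 ∈ X.faces) : X.faceIndex (some ⟨0, h0⟩) = 0 := by
  have hc : 0 < X.faces.card := Finset.card_pos.2 ⟨0, h0⟩
  have h : (X.faces.orderIsoOfFin rfl).symm ⟨0, h0⟩ ≤ ⟨0, hc⟩ := by
    rw [OrderIso.symm_apply_le]
    exact Nat.zero_le _
  exact Nat.le_zero.1 h

theorem faceIndex_some_lt (j : {x // x ∈ X.faces}) : X.faceIndex (some j) < X.faces.card :=
  Fin.is_lt _

theorem faceIndex_injective : Function.Injective X.faceIndex := by
  rintro (_ | j) (_ | j') h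
  · rfl
  · exact absurd (X.faceIndex_some_lt j') (by rw [← h]; exact lt_irrefl _)
  · exact absurd (X.faceIndex_some_lt j) (by rw [h]; exact lt_irrefl _)
  · simp only [faceIndex, Option.elim_some] at h
    rw [(X.faces.orderIsoOfFin rfl).symm.injective (Fin.ext h)]

theorem exists_faceIndex {i : ℕ} (hi : i ≤ X.faces.card) : ∃ j, X.faceIndex j = i := by
  obtain h | rfl := hi.lt_or_eq
  · exact ⟨some (X.faces.orderIsoOfFin rfl ⟨i, h⟩), by simp [faceIndex]⟩
  · exact ⟨none, rfl⟩

theorem nextDart_pow (m : ℕ) (y : X.Dart) :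
    ((X.nextDart ^ m) y).1 = y.1 ∧ (((X.nextDart ^ m) y).2 : ℕ) = (y.2 + m) % X.degree y.1 := by
  rw [nextDart, sigmaCongrRight_pow]
  exact ⟨rfl, val_finRotate_pow _ _⟩

theorem nextDart_pow_degree (y : X.Dart) : (X.nextDart ^ X.degree y.1) y = y := by
  obtain ⟨j, i⟩ := y
  rw [nextDart, sigmaCongrRight_pow]
  congr 1
  apply Fin.ext
  rw [val_finRotate_pow, Nat.add_mod_right, Nat.mod_eq_of_lt i.2]

theorem exists_nextDart_pow {y z : X.Dart} (h : z.1 = y.1) :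
    ∃ m < X.degree y.1, (X.nextDart ^ m) y = z := by
  obtain ⟨j, i⟩ := y
  obtain ⟨j', i'⟩ := z
  obtain rfl : j' = j := h
  have hi := i.2
  have hi' := i'.2
  have hd : 0 < X.degree j' := by omega
  refine ⟨(X.degree j' - i + i') % X.degree j', Nat.mod_lt _ hd, ?_⟩
  rw [nextDart, sigmaCongrRight_pow]
  congr 1
  apply Fin.ext
  rw [val_finRotate_pow, Nat.add_mod_mod, show (i : ℕ) + (X.degree j' - i + i') =
    X.degree j' + i' by omega, Nat.add_mod_left, Nat.mod_eq_of_lt hi']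

theorem card_dart : Fintype.card X.Dart = ∑ j ∈ X.faces, len j + X.bdry.length := by
  simp only [Fintype.card_sigma, Fintype.sum_option, Fintype.card_fin]
  rw [add_comm, ← Finset.sum_coe_sort X.faces len]
  rfl

theorem exists_phasedDiagram {p q p₁ q₁ : ℤ} {N L₁ : ℕ} (n : ℕ)
    (hlen : ∀ j, j ≠ 0 → len j = N) (hden : ∀ j, j ≠ 0 → den j = p)
    (hnum : ∀ j, j ≠ 0 → num j = q) (hN0 : 0 < N) (hN : Even N) (hp : 2 * p ∣ N)
    (hlen0 : Even (len 0)) (hden0 : 2 * den 0 ∣ len 0) (h0 : 0 ∈ X.faces)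
    (hb : X.bdry.map X.lab = strip p₁ q₁ L₁ 0 0) (hL0 : 0 < L₁) (hL : Even L₁)
    (hp₁ : 2 * p₁ ∣ L₁) :
    ∃ (k : ℕ) (den' num' : ℕ → ℤ) (D : PhasedDiagram X.Dart k N n den' num'),
      den' 0 = den 0 ∧ num' 0 = num 0 ∧ den' (k + 1) = p₁ ∧ num' (k + 1) = q₁ ∧
      (∀ j, 1 ≤ j → j ≤ k → den' j = p ∧ num' j = q) ∧
      (∀ j, (den' j = den 0 ∧ num' j = num 0) ∨ (den' j = p₁ ∧ num' j = q₁) ∨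
        (den' j = p ∧ num' j = q)) ∧
      Fintype.card X.Dart ≤ 2 * (Finset.univ.image D.src).card + 2 * k := by
  classical
  have hbl : X.bdry.length = L₁ := by simpa using congrArg List.length hb
  have hcard : 0 < X.faces.card := Finset.card_pos.2 ⟨0, h0⟩
  obtain ⟨k, hk⟩ : ∃ k, X.faces.card = k + 1 := ⟨_, (Nat.sub_add_cancel hcard).symm⟩
  let den' : ℕ → ℤ := fun j => if j = 0 then den 0 else if j = k + 1 then p₁ else p
  let num' : ℕ → ℤ := fun j => if j = 0 then num 0 else if j = k + 1 then q₁ else q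
  let T : Option {x // x ∈ X.faces} → Fin 2 := fun j => j.elim 0 fun x => X.ty x
  let O : Option {x // x ∈ X.faces} → ℤ := fun j => j.elim 0 fun x => X.off x
  have hnone : X.faceIndex none = k + 1 := hk
  have hzero : ∀ j : {x // x ∈ X.faces}, X.faceIndex (some j) = 0 ↔ j.1 = 0 := by
    intro j
    exact ⟨fun h => congrArg Subtype.val (Option.some_inj.1
      (X.faceIndex_injective (h.trans (X.faceIndex_zero h0).symm))),
      fun h => by rw [← X.faceIndex_zero h0]; congr 2; exact Subtype.ext h⟩
  have hsome : ∀ j : {x // x ∈ X.faces}, X.faceIndex (some j) < k + 1 := fun j =>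
    hk ▸ X.faceIndex_some_lt j
  have hdenS : ∀ j : {x // x ∈ X.faces}, den' (X.faceIndex (some j)) = den j := by
    intro j
    have h1 := hsome j
    by_cases hj : j.1 = 0
    · simp only [den', (hzero j).2 hj, hj, if_true]
    · simp only [den', mt (hzero j).1 hj, h1.ne, if_false, hden _ hj]
  have hnumS : ∀ j : {x // x ∈ X.faces}, num' (X.faceIndex (some j)) = num j := by
    intro j
    have h1 := hsome j
    by_cases hj : j.1 = 0
    · simp only [num', (hzero j).2 hj, hj, if_true]
    · simp only [num', mt (hzero j).1 hj, h1.ne, if_false, hnum _ hj]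
  have hdenN : den' (X.faceIndex none) = p₁ := by simp [den', hnone]
  have hnumN : num' (X.faceIndex none) = q₁ := by simp [num', hnone]
  have hdeg : ∀ j, Even (X.degree j) ∧ 2 * den' (X.faceIndex j) ∣ X.degree j := by
    rintro (_ | j)
    · rw [hdenN]
      simp only [degree, Option.elim_none, hbl]
      exact ⟨hL, hp₁⟩
    · rw [hdenS]
      simp only [degree, Option.elim_some]
      by_cases hj : j.1 = 0
      · rw [hj]
        exact ⟨hlen0, hden0⟩
      · rw [hlen _ hj, hden _ hj]
        exact ⟨hN, hp⟩
  let ph : X.Dart → ℤ := fun y => O y.1 + (y.2 : ℕ) * num' (X.faceIndex y.1)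
  have hlab : ∀ y : X.Dart, X.lab (X.toPair y) =
      (typeAt (T y.1) y.2, sgn (den' (X.faceIndex y.1)) (ph y)) := by
    rintro ⟨_ | j, i⟩
    · have hi : (i : ℕ) < X.bdry.length := i.2
      have h : (X.bdry.map X.lab)[(i : ℕ)]'(by simpa using hi) = (strip p₁ q₁ L₁ 0 0)[(i : ℕ)]'(by
        simpa using hbl ▸ hi) := by simp only [hb]
      rw [List.getElem_map, strip_getElem] at h
      simp only [ph, hdenN, hnumN]
      exact h
    · simp only [ph, hdenS, hnumS]
      exact X.lab_face j j.2 i i.2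
  have hrel : ∀ y : X.Dart, 1 ≤ X.faceIndex y.1 → X.faceIndex y.1 ≤ k →
      (X.toPair y).1 ≠ 0 ∧ (X.toPair y).1 ∈ X.faces ∧ (X.toPair y).2 < len (X.toPair y).1 ∧
        X.degree y.1 = N ∧ den' (X.faceIndex y.1) = den (X.toPair y).1 ∧
        ph y = X.off (X.toPair y).1 + (X.toPair y).2 * num (X.toPair y).1 := by
    rintro ⟨_ | j, i⟩ h1 h2
    · dsimp only at h2
      omega
    · have hj : j.1 ≠ 0 := mt (hzero j).2 (by dsimp only at h1; omega)
      exact ⟨hj, j.2, i.2, hlen _ hj, hdenS j, by simp only [ph, hnumS]; rfl⟩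
  have hnext : ∀ y : X.Dart, (X.nextDart y).1 = y.1 ∧
      ((X.nextDart y).2 : ℕ) = (y.2 + 1) % X.degree y.1 := X.nextDart_pow 1
  refine ⟨k, den', num', {
    nxt := X.nextDart
    opp := X.oppDart
    src := fun y => X.src (X.toPair y)
    typ := fun y => (X.lab (X.toPair y)).1
    face := fun y => X.faceIndex y.1
    mark := fun y => den' (X.faceIndex y.1) ∣ ph y ∨ den' (X.faceIndex y.1) ∣ ph y + 1
    opp_opp := X.oppDart_oppDart
    src_nxt := fun y => by rw [X.src_nextDart, X.toPair_oppDart]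
    typ_nxt := fun y => by
      simp only [hlab, (hnext y).1, (hnext y).2]
      rw [typeAt_mod (hdeg _).1, typeAt_succ]
    typ_opp := fun y => by rw [X.toPair_oppDart, X.lab_opp _ (X.live_toPair y)]
    face_nxt := fun y => rfl
    face_le := ?_
    exists_face := ?_
    period := ?_
    period_inj := ?_
    transitive := ?_
    ph := ph
    ph_nxt := ?_
    sgn_opp := ?_
    mark_iff := fun _ => Iff.rfl
    not_mirror := ?_
    transitive_outer := ?_ }, ?_⟩
  · rintro ⟨_ | j, i⟩
    · exact hnone.le
    · exact (hsome j).le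
  · intro i h1 h2
    obtain ⟨j, rfl⟩ := X.exists_faceIndex (hk ▸ h2)
    have h3 : 0 < X.degree j := by
      obtain _ | j := j
      · exact hL0.trans_eq hbl.symm
      · have hj : j.1 ≠ 0 := mt (hzero j).2 (by omega)
        simpa only [degree, Option.elim_some, hlen _ hj] using hN0
    exact ⟨⟨j, 0, h3⟩, rfl⟩
  · intro y h1 h2
    rw [← (hrel y h1 h2).2.2.2.1]
    exact X.nextDart_pow_degree y
  · intro y h1 h2 i hi j hj h
    have h3 := (X.nextDart_pow i y).2
    rw [h, (X.nextDart_pow j y).2] at h3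
    have h4 : j ≡ i [MOD N] := (hrel y h1 h2).2.2.2.1 ▸ Nat.ModEq.add_left_cancel' _ h3
    exact (h4.eq_of_lt_of_lt hj hi).symm
  · intro y h1 h2 z hz
    rw [← (hrel y h1 h2).2.2.2.1]
    exact X.exists_nextDart_pow (X.faceIndex_injective hz)
  · intro y
    simp only [ph, (hnext y).1, (hnext y).2]
    obtain ⟨c, hc⟩ := (hdeg y.1).2
    refine ⟨-(c * num' (X.faceIndex y.1) * (((y.2 : ℕ) + 1) / X.degree y.1 : ℕ)), ?_⟩
    have h := congrArg (Nat.cast : ℕ → ℤ) (Nat.mod_add_div ((y.2 : ℕ) + 1) (X.degree y.1))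
    push_cast at h ⊢
    linear_combination num' (X.faceIndex y.1) * h -
      num' (X.faceIndex y.1) * (((y.2 : ℕ) + 1 : ℤ) / (X.degree y.1 : ℤ)) * hc
  · intro y
    have h := X.lab_opp _ (X.live_toPair y)
    rw [← X.toPair_oppDart, hlab, hlab] at h
    exact (Prod.mk.inj h).2
  · intro y ⟨h1, h2⟩ ⟨h3, h4⟩
    obtain ⟨a1, a2, a3, -, a4, a5⟩ := hrel y h1 h2
    obtain ⟨b1, b2, b3, -, b4, b5⟩ := hrel _ h3 h4
    rw [X.toPair_oppDart] at b1 b2 b5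
    have h := X.not_mirror _ a2 a3 a1 b2 b1
    rw [← a4, ← a5, ← b5] at h
    exact h
  · intro y z hy hz
    obtain ⟨m, -, hm⟩ := X.exists_nextDart_pow (X.faceIndex_injective (hz.trans hy.symm))
    exact ⟨m, hm⟩
  · refine ⟨by simp [den'], by simp [num'], by simp [den'], by simp [num'], ?_, ?_, ?_⟩
    · intro j h1 h2
      simp only [den', num', show j ≠ 0 by omega, show j ≠ k + 1 by omega, if_false, and_self]
    · intro j
      by_cases h1 : j = 0
      · simp [den', num', h1]
      · by_cases h2 : j = k + 1
        · simp [den', num', h2]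
        · simp [den', num', h1, h2]
    · have h1 := X.count
      have h2 : X.verts ⊆ Finset.univ.image fun y => X.src (X.toPair y) := by
        intro v hv
        rw [Finset.mem_image]
        obtain rfl | ⟨d, hd, rfl⟩ := X.verts_src v hv
        · have h3 : 0 < X.bdry.length := hbl ▸ hL0
          exact ⟨⟨none, 0, h3⟩, Finset.mem_univ _, X.walk.src_zero h3⟩
        · obtain ⟨y, rfl⟩ := X.live_iff.1 hd
          exact ⟨y, Finset.mem_univ _, rfl⟩
      have h3 := Finset.card_le_card h2
      rw [X.card_dart]
      simp only
      omega

end Net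

theorem not_isConj_of_steep {r s s' : ℚ} {n : ℕ} (hn : 2 ≤ n) (hr0 : 0 ≤ r) (hr1 : r ≤ 1)
    (hrd : r.den ≠ 1) (hs0 : 0 ≤ s) (hs1 : s ≤ 1) (hs0' : 0 ≤ s') (hs1' : s' ≤ 1) (hne : s ≠ s')
    (hinner : ∃ δ T : ℤ, (Steep r.den r.num s'.den s'.num δ T ∨
      Steep r.den (-r.num) s'.den (-s'.num) δ T) ∧ (T = 2 ∨ T = 2 * n - 1 ∧ 2 * δ ≤ r.den))
    (houter : ∃ δ : ℤ, Steep r.den r.num s.den s.num δ 1 ∨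
      Steep r.den (-r.num) s.den (-s.num) δ 1) {v : F} (hv : v = uWord s' ∨ v = (uWord s')⁻¹) :
    ¬ IsConj (heckQ r n (uWord s)) (heckQ r n v) := by
  intro hconj
  have hd : ∀ t : ℚ, 0 ≤ t → t ≤ 1 → (0 : ℤ) < t.den ∧ 0 ≤ t.num ∧ t.num ≤ t.den := fun t h0 h1 =>
    ⟨mod_cast t.den_pos, Rat.num_nonneg.2 h0, by
      rw [← Rat.num_div_den t, div_le_one (mod_cast t.den_pos)] at h1
      exact_mod_cast h1⟩
  have hrpos := r.den_pos
  have hpos' := s'.den_pos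
  let len : ℕ → ℕ := fun j => if j = 0 then 2 * s'.den else 2 * r.den * n
  let den : ℕ → ℤ := fun j => if j = 0 then s'.den else r.den
  let num : ℕ → ℤ := fun j => if j = 0 then s'.num else r.num
  have hlen : ∀ j, j ≠ 0 → len j = 2 * r.den * n := fun j hj => if_neg hj
  have hden : ∀ j, j ≠ 0 → den j = r.den := fun j hj => if_neg hj
  have hnum : ∀ j, j ≠ 0 → num j = r.num := fun j hj => if_neg hj
  have hN0 : 0 < 2 * r.den * n := by positivity
  have hN : Even (2 * r.den * n) := by rw [mul_assoc]; exact even_two_mul _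
  have hp : (2 * r.den : ℤ) ∣ (2 * r.den * n : ℕ) := by push_cast; exact dvd_mul_right _ _
  have hu : uWord r ^ n = stripF r.den r.num (2 * r.den * n) 0 0 := by
    rw [stripF_pow _ _ (hd r hr0 hr1).1 _ rfl, uWord_eq r hr0]
  rw [uWord_eq s' hs0'] at hv
  have hconj' : IsConj
      (QuotientGroup.mk' (Subgroup.normalClosure {stripF r.den r.num (2 * r.den * n) 0 0})
        (uWord s))
      (QuotientGroup.mk' (Subgroup.normalClosure {stripF r.den r.num (2 * r.den * n) 0 0}) v) := by
    rw [← hu]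
    exact hconj
  obtain ⟨X, h0, hX⟩ := Net.exists_word_eq (len := len) (den := den) (num := num)
    (hd r hr0 hr1).1 hlen hden hnum hN0 (by simp [len, hpos']) (by simp [den, hpos']) hv hconj'
  obtain ⟨Y, h0, hY, hred⟩ := Net.exists_reduced (hd r hr0 hr1).1 hlen hden hnum hN0 hN hp X h0
  rw [hX, uWord_eq s hs0] at hY
  have hb : Y.bdry.map Y.lab = strip s.den s.num (2 * s.den) 0 0 := by
    rw [← hred.reduce_eq, ← (strip_isReduced s.den s.num (2 * s.den) 0 0).reduce_eq]
    exact FreeGroup.reduce.sound hY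
  obtain ⟨k, den', num', D, hd0, hn0, hd1, hn1, hrel, hall, hcount⟩ :=
    Y.exists_phasedDiagram n hlen hden hnum hN0 hN hp (by simp [len]) (by simp [den, len]) h0 hb
      (by have := s.den_pos; omega) (even_two_mul _) (by simp)
  have hall' : ∀ j, 0 < den' j ∧ 0 ≤ num' j ∧ num' j ≤ den' j := by
    intro j
    obtain ⟨h1, h2⟩ | ⟨h1, h2⟩ | ⟨h1, h2⟩ := hall j <;> rw [h1, h2]
    exacts [hd s' hs0' hs1', hd s hs0 hs1, hd r hr0 hr1]
  refine D.false_of_steep (fun j => (hall' j).1) (fun j => (hall' j).2) (p := r.den) (q := r.num)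
    (by exact_mod_cast lt_of_le_of_ne hrpos hrd.symm) (Rat.isCoprime_num_den r).symm hrel rfl rfl hn
    hcount ?_ ?_ ?_
  · rw [hd0, hn0]
    exact hinner
  · rw [hd1, hn1]
    exact houter
  · rw [hd0, hn0, hd1, hn1]
    exact mt Rat.eq_iff_mul_eq_mul.2 hne

theorem runLengths_map_range {a : ℕ → ℕ} (h0 : a 0 = 0) (ha : StrictMono a) {f : ℕ → ℤ}
    (hf : ∀ l i, a l ≤ i → i < a (l + 1) → f i = (-1) ^ l) (K : ℕ) :
    runLengths ((List.range (a K)).map f) = (List.range K).map fun l => a (l + 1) - a l := by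
  have hlt : ∀ l, a l < a (l + 1) := fun l => ha (Nat.lt_succ_self l)
  have hB : (List.range (a K)).map f =
      ((List.range K).map fun l => List.replicate (a (l + 1) - a l) ((-1 : ℤ) ^ l)).flatten := by
    induction K with
    | zero => simp [h0]
    | succ K ih =>
      have h := List.range_add (n := a K) (m := a (K + 1) - a K)
      rw [Nat.add_sub_cancel' (hlt K).le] at h
      rw [List.range_succ, List.map_append, List.flatten_append, ← ih, h, List.map_append,
        List.map_map]
      congr 1
      simp only [List.map_cons, List.map_nil, List.flatten_cons, List.flatten_nil, List.append_nil]
      rw [List.eq_replicate_iff]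
      refine ⟨by simp, fun b hb => ?_⟩
      obtain ⟨c, hc, rfl⟩ := List.mem_map.1 hb
      rw [List.mem_range] at hc
      exact hf K (a K + c) (by omega) (by omega)
  rw [runLengths, hB, List.splitBy_flatten]
  · simp [Function.comp_def]
  · intro h
    obtain ⟨l, -, hl⟩ := List.mem_map.1 h
    have := congrArg List.length hl
    have := hlt l
    simp at *
    omega
  · intro b hb
    obtain ⟨l, -, rfl⟩ := List.mem_map.1 hb
    rw [List.isChain_iff_getElem]
    intro i hi
    simp
  · rw [List.isChain_iff_getElem]
    intro i hi
    have h1 := hlt i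
    have h2 := hlt (i + 1)
    refine ⟨by simp; omega, by simp; omega, ?_⟩
    simp [pow_succ, self_eq_neg]

theorem signList_eq (s : ℚ) :
    signList s = (List.range (2 * s.den)).map fun i : ℕ => (-1 : ℤ) ^ (⌊(i : ℚ) * s⌋.toNat) := by
  simp only [signList, bind_pure_comp, List.map_eq_map, List.map_map]
  rfl

theorem mem_CS {s : ℚ} {m : ℕ} (hm : 1 ≤ m) (h1 : s.num * m ≤ s.den)
    (h2 : (s.den : ℤ) ≤ s.num * (m + 1)) {x : ℕ} (hx : x ∈ CS s) : x = m ∨ x = m + 1 := by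
  have hd := s.den_pos
  have hn : 0 < s.num := by
    have : (0 : ℤ) < s.den := mod_cast hd
    nlinarith
  obtain ⟨q, hq⟩ := Int.eq_ofNat_of_zero_le hn.le
  rw [hq] at h1 h2 hn
  norm_cast at h1 h2 hn
  set p := s.den with hp
  let a : ℕ → ℕ := fun l => (l * p + (q - 1)) / q
  have ha : ∀ l, l * p ≤ a l * q ∧ a l * q < l * p + q := by
    intro l
    have := Nat.div_add_mod (l * p + (q - 1)) q
    have := Nat.mod_lt (l * p + (q - 1)) hn
    have : a l * q = q * ((l * p + (q - 1)) / q) := mul_comm _ _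
    omega
  have hstep : ∀ l, a (l + 1) = a l + m ∨ a (l + 1) = a l + (m + 1) := by
    intro l
    obtain ⟨h3, h4⟩ := ha l
    obtain ⟨h5, h6⟩ := ha (l + 1)
    have h7 : a l + m < a (l + 1) + 1 := by nlinarith
    have h8 : a (l + 1) < a l + m + 2 := by nlinarith
    omega
  have hmono : StrictMono a := strictMono_nat_of_lt_succ fun l => by
    have := hstep l
    omega
  have h0 : a 0 = 0 := by
    have := (ha 0).2
    nlinarith
  have hK : a (2 * q) = 2 * p := by
    obtain ⟨h3, h4⟩ := ha (2 * q)
    have h5 : 2 * p < a (2 * q) + 1 := by nlinarith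
    have h6 : a (2 * q) < 2 * p + 1 := by nlinarith
    omega
  have hf : ∀ l i, a l ≤ i → i < a (l + 1) →
      (-1 : ℤ) ^ (⌊(i : ℚ) * s⌋.toNat) = (-1) ^ l := by
    intro l i h3 h4
    have h5 : ⌊(i : ℚ) * s⌋ = l := by
      have h6 : (i : ℚ) * s = (i * q : ℕ) / (p : ℕ) := by
        rw [← Rat.num_div_den s, hq]
        push_cast
        ring
      obtain ⟨h7, -⟩ := ha l
      obtain ⟨-, h8⟩ := ha (l + 1)
      rw [h6, Int.floor_eq_iff, le_div_iff₀ (by exact_mod_cast hd), div_lt_iff₀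
        (by exact_mod_cast hd)]
      constructor
      · have h9 : l * p ≤ i * q := by nlinarith
        exact_mod_cast h9
      · have h9 : i * q < (l + 1) * p := by nlinarith
        exact_mod_cast h9
    rw [h5, Int.toNat_natCast]
  rw [CS, signList_eq, ← hp, ← hK, runLengths_map_range h0 hmono hf] at hx
  obtain ⟨l, -, rfl⟩ := List.mem_map.1 hx
  have := hstep l
  omega

/-- If `u_s` is conjugate to `u_{s'}^{±1}`, then `1 / (m + 1) ≤ s ≤ 1 / m`. -/
theorem num_mul_bounds {M : List ℕ} {m n : ℕ} (hMlen : 2 ≤ M.length) (hMpos : ∀ x ∈ M, 0 < x)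
    (hMlast : 2 ≤ M.getLast!) (hm : M.head? = some m) (hn : 2 ≤ n) {s s' : ℚ} (hne : s ≠ s')
    (hs : memI1 M n s ∨ memI2 M n s) (hs' : memI1 M n s' ∨ memI2 M n s') {v : F}
    (hv : v = uWord s' ∨ v = (uWord s')⁻¹)
    (hconj : IsConj (heckQ (cfQ M) n (uWord s)) (heckQ (cfQ M) n v)) :
    s.num * m ≤ s.den ∧ (s.den : ℤ) ≤ s.num * (m + 1) := by
  obtain ⟨hr1, hr2⟩ := cfQ_num_den_bounds M m hMlen hMpos hMlast hm
  obtain ⟨hs0, hs1, -⟩ := exists_steep_of_mem M n hMlen hMpos hMlast hn s hs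
  obtain ⟨hs0', hs1', hinner⟩ := exists_steep_of_mem M n hMlen hMpos hMlast hn s' hs'
  have hm0 : (0 : ℤ) < m := mod_cast hMpos m (List.mem_of_mem_head? (by simp [hm]))
  have hd : (0 : ℤ) < (cfQ M).den := mod_cast (cfQ M).den_pos
  have hq : 0 < (cfQ M).num := by nlinarith
  have hqp : (cfQ M).num < (cfQ M).den := by nlinarith
  have hr : cfQ M < 1 := by
    rw [← Rat.num_div_den (cfQ M), div_lt_one (mod_cast (cfQ M).den_pos)]
    exact_mod_cast hqp
  by_contra h
  have houter := exists_steep_of_outside (Rat.isCoprime_num_den (cfQ M)).symm hq hm0 hr1 hr2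
    (p' := s.den) (q' := s.num) (mod_cast s.den_pos) (by
      by_contra h'
      exact h (by omega))
  exact not_isConj_of_steep hn (Rat.num_nonneg.1 hq.le) hr.le (by omega) hs0 hs1 hs0' hs1' hne
    hinner houter hv hconj

/-- Lemma 3.3: if `m ≥ 2` and `s ≠ s'` in `I₁(r;n) ∪ I₂(r;n)` are such that
`u_s` is conjugate in `Heck(r;n)` to `u_{s'}^{±1}`, then both `CS(s)` and
`CS(s')` consist of `m` and `m+1`. -/
theorem statement10
    (M : List ℕ) (m n : ℕ) (r : ℚ)
    (hMlen : 2 ≤ M.length) (hMpos : ∀ x ∈ M, 0 < x) (hMlast : 2 ≤ M.getLast!)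
    (hm : M.head? = some m) (hn : 2 ≤ n) (hr : r = cfQ M)
    (hm2 : 2 ≤ m)
    (s s' : ℚ) (hss' : s ≠ s')
    (hs : memI1 M n s ∨ memI2 M n s) (hs' : memI1 M n s' ∨ memI2 M n s')
    (hconj : IsConj (heckQ r n (uWord s)) (heckQ r n (uWord s')) ∨
      IsConj (heckQ r n (uWord s)) ((heckQ r n (uWord s'))⁻¹)) :
    (∀ x ∈ CS s, x = m ∨ x = m + 1) ∧ (∀ x ∈ CS s', x = m ∨ x = m + 1) := by
  subst hr
  have hv : ∃ v v', (v = uWord s' ∨ v = (uWord s')⁻¹) ∧ (v' = uWord s ∨ v' = (uWord s)⁻¹) ∧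
      IsConj (heckQ (cfQ M) n (uWord s)) (heckQ (cfQ M) n v) ∧
      IsConj (heckQ (cfQ M) n (uWord s')) (heckQ (cfQ M) n v') := by
    obtain h | h := hconj
    · exact ⟨_, _, Or.inl rfl, Or.inl rfl, h, h.symm⟩
    · refine ⟨_, _, Or.inr rfl, Or.inr rfl, by rwa [map_inv], ?_⟩
      obtain ⟨c, hc⟩ := isConj_iff.1 h
      rw [map_inv]
      exact (isConj_iff.2 ⟨c, by rw [← conj_inv, hc, inv_inv]⟩ : IsConj _ _).symm
  obtain ⟨v, v', hv, hv', h1, h2⟩ := hv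
  obtain ⟨h3, h4⟩ := num_mul_bounds hMlen hMpos hMlast hm hn hss' hs hs' hv h1
  obtain ⟨h5, h6⟩ := num_mul_bounds hMlen hMpos hMlast hm hn hss'.symm hs' hs hv' h2
  exact ⟨fun _ => mem_CS (by omega) h3 h4, fun _ => mem_CS (by omega) h5 h6⟩

end Heckoid
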